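/- Let T and U be computable consistent extensions of PA and n ≥ 1. The following are equivalent: (1) (T,U) is a C⁻_n-pair; (2) there is a Σ_n ∧ Π_n sentence in HCons(Δ_n,T) ∩ HCons(Δ_n,U) \ (Th(T) ∪ Th(U)); (3) there is a sentence in HCons(Δ_n,T) ∩ HCons(Δ_n,U) \ (Th(T) ∪ Th(U)); (4) HCons(Δ_n,T) \ Th(U) ≠ ∅; (5) there is a Σ_n sentence φ with T ⊬ φ and U ⊬ φ such that φ is Δ_n(Th(T) ∩ Th(U))-conservative over every subtheory V of T or of U that proves all of Th(T) ∩ Th(U); (6) there is a sentence φ with U ⊬ φ such that φ is Δ_n(Th(T) ∩ Th(U))-conservative over every subtheory V of T that proves all of Th(T) ∩ Th(U). -/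

import Mathlib

open FirstOrder Language
open scoped FirstOrder

namespace Guaspari

/-- The first-order language of arithmetic: a constant `0`, a unary function `S`,
binary functions `+` (coded `false`) and `·` (coded `true`), and a binary relation `≤`. -/
def LA : FirstOrder.Language :=
  ⟨fun n => match n with | 0 => Unit | 1 => Unit | 2 => Bool | _ => Empty,
   fun n => match n with | 2 => Unit | _ => Empty⟩

/-- Sentences of the language of arithmetic. -/
abbrev Snt : Type := LA.Sentence

/-- Theories (sets of sentences) in the language of arithmetic. -/
abbrev Thy : Type := LA.Theory

/-- The term `0`. -/
def zeroT {α : Type} {n : ℕ} : LA.Term (α ⊕ Fin n) :=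
  Constants.term (show LA.Constants from Unit.unit)

/-- The term `S t`. -/
def succT {α : Type} {n : ℕ} (t : LA.Term (α ⊕ Fin n)) : LA.Term (α ⊕ Fin n) :=
  Functions.apply₁ (show LA.Functions 1 from Unit.unit) t

/-- The term `t + u`. -/
def addT {α : Type} {n : ℕ} (t u : LA.Term (α ⊕ Fin n)) : LA.Term (α ⊕ Fin n) :=
  Functions.apply₂ (show LA.Functions 2 from false) t u

/-- The term `t * u`. -/
def mulT {α : Type} {n : ℕ} (t u : LA.Term (α ⊕ Fin n)) : LA.Term (α ⊕ Fin n) :=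
  Functions.apply₂ (show LA.Functions 2 from true) t u

/-- The atomic formula `t ≤ u`. -/
def leF {α : Type} {n : ℕ} (t u : LA.Term (α ⊕ Fin n)) : LA.BoundedFormula α n :=
  Relations.boundedFormula₂ (show LA.Relations 2 from Unit.unit) t u

/-- The `i`-th (de Bruijn-indexed) bound variable as a term. -/
def vT {m : ℕ} (i : Fin m) : LA.Term (Empty ⊕ Fin m) := Term.var (Sum.inr i)

/-- The induction axiom for the formula `φ(x₀,…,x_{k-1}, x_k)` with induction on `x_k`,
universally closed over the parameters `x₀,…,x_{k-1}`. -/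
def indAxiom {k : ℕ} (φ : LA.BoundedFormula Empty (k + 1)) : Snt :=
  let base := ∀' ((vT (Fin.last k) =' zeroT) ⟹ φ)
  let step := ∀' (φ ⟹
    ∀' ((vT (Fin.last (k + 1)) =' succT (vT (Fin.castSucc (Fin.last k)))) ⟹ φ.liftAt 1 k))
  ((base ⊓ step) ⟹ ∀' φ).alls

/-- The axioms of Peano arithmetic `PA`: the basic axioms for `0`, `S`, `+`, `·`, `≤`,
together with the full induction scheme. -/
def PAAx : Thy :=
  {∀' ∼(succT (vT 0) =' zeroT),
   ∀' ∀' ((succT (vT 0) =' succT (vT 1)) ⟹ (vT 0 =' vT 1)),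
   ∀' (addT (vT 0) zeroT =' vT 0),
   ∀' ∀' (addT (vT 0) (succT (vT 1)) =' succT (addT (vT 0) (vT 1))),
   ∀' (mulT (vT 0) zeroT =' zeroT),
   ∀' ∀' (mulT (vT 0) (succT (vT 1)) =' addT (mulT (vT 0) (vT 1)) (vT 0)),
   ∀' ∀' (leF (vT 0) (vT 1) ⇔ ∃' (addT (vT 2) (vT 0) =' vT 1))} ∪
  {φ | ∃ (k : ℕ) (ψ : LA.BoundedFormula Empty (k + 1)), φ = indAxiom ψ}

/-- `Prv T φ`: the sentence `φ` is provable from the theory `T` (equivalently, by the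
Gödel completeness theorem, `φ` holds in every model of `T`). -/
def Prv (T : Thy) (φ : Snt) : Prop := T ⊨ᵇ φ

/-- `Th T`: the set of sentences provable from `T`. -/
def Th (T : Thy) : Set Snt := {φ | Prv T φ}

/-- `Con T`: the theory `T` is consistent. -/
def Con (T : Thy) : Prop := ¬ Prv T ⊥

/-- The theory `T + φ`. -/
def add (T : Thy) (φ : Snt) : Thy := insert φ T

/-- `T` is an extension of `PA`. -/
def ExtPA (T : Thy) : Prop := ∀ φ ∈ PAAx, Prv T φ

/-- `V` is a subtheory of `T` (containing `PA`, as assumed throughout the paper). -/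
def SubThy (V T : Thy) : Prop := ExtPA V ∧ ∀ φ, Prv V φ → Prv T φ

/-- Δ₀ (bounded) formulas. -/
inductive IsDelta0 : ∀ {m : ℕ}, LA.BoundedFormula Empty m → Prop
  | falsum {m : ℕ} : IsDelta0 (⊥ : LA.BoundedFormula Empty m)
  | equal {m : ℕ} (t u : LA.Term (Empty ⊕ Fin m)) : IsDelta0 (t =' u)
  | le {m : ℕ} (t u : LA.Term (Empty ⊕ Fin m)) : IsDelta0 (leF t u)
  | imp {m : ℕ} {φ ψ : LA.BoundedFormula Empty m} :
      IsDelta0 φ → IsDelta0 ψ → IsDelta0 (φ ⟹ ψ)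
  | ball {m : ℕ} (t : LA.Term (Empty ⊕ Fin m)) {φ : LA.BoundedFormula Empty (m + 1)} :
      IsDelta0 φ →
      IsDelta0 (∀' (leF (vT (Fin.last m)) (t.relabel (Sum.map id Fin.castSucc)) ⟹ φ))
  | bex {m : ℕ} (t : LA.Term (Empty ⊕ Fin m)) {φ : LA.BoundedFormula Empty (m + 1)} :
      IsDelta0 φ →
      IsDelta0 (∃' (leF (vT (Fin.last m)) (t.relabel (Sum.map id Fin.castSucc)) ⊓ φ))

mutual
  /-- `Σ_k` formulas (cumulatively: every `Π_k` formula is `Σ_{k+1}`). -/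
  inductive IsSigmaFml : ℕ → ∀ {m : ℕ}, LA.BoundedFormula Empty m → Prop
    | ofDelta0 {m : ℕ} {φ : LA.BoundedFormula Empty m} : IsDelta0 φ → IsSigmaFml 0 φ
    | ofPi {k : ℕ} {m : ℕ} {φ : LA.BoundedFormula Empty m} :
        IsPiFml k φ → IsSigmaFml (k + 1) φ
    | ex {k : ℕ} {m : ℕ} {φ : LA.BoundedFormula Empty (m + 1)} :
        IsSigmaFml (k + 1) φ → IsSigmaFml (k + 1) (∃' φ)
  /-- `Π_k` formulas (cumulatively: every `Σ_k` formula is `Π_{k+1}`). -/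
  inductive IsPiFml : ℕ → ∀ {m : ℕ}, LA.BoundedFormula Empty m → Prop
    | ofDelta0 {m : ℕ} {φ : LA.BoundedFormula Empty m} : IsDelta0 φ → IsPiFml 0 φ
    | ofSigma {k : ℕ} {m : ℕ} {φ : LA.BoundedFormula Empty m} :
        IsSigmaFml k φ → IsPiFml (k + 1) φ
    | all {k : ℕ} {m : ℕ} {φ : LA.BoundedFormula Empty (m + 1)} :
        IsPiFml (k + 1) φ → IsPiFml (k + 1) (∀' φ)
end

/-- The set of `Σ_k` sentences. -/
def SigmaS (k : ℕ) : Set Snt := {φ | IsSigmaFml k φ}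

/-- The set of `Π_k` sentences. -/
def PiS (k : ℕ) : Set Snt := {φ | IsPiFml k φ}

/-- The set of `Σ_k ∧ Π_k` sentences, i.e. sentences of the form `σ ∧ π` with
`σ` a `Σ_k` sentence and `π` a `Π_k` sentence. -/
def SigAndPiS (k : ℕ) : Set Snt :=
  {φ | ∃ σ ∈ SigmaS k, ∃ π ∈ PiS k, φ = σ ⊓ π}

/-- `B(Σ_k)` sentences: Boolean combinations of `Σ_k` sentences. -/
inductive IsBoolSigma (k : ℕ) : Snt → Prop
  | base {φ : Snt} : φ ∈ SigmaS k → IsBoolSigma k φ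
  | not {φ : Snt} : IsBoolSigma k φ → IsBoolSigma k (∼φ)
  | imp {φ ψ : Snt} : IsBoolSigma k φ → IsBoolSigma k ψ → IsBoolSigma k (φ ⟹ ψ)
  | inf {φ ψ : Snt} : IsBoolSigma k φ → IsBoolSigma k ψ → IsBoolSigma k (φ ⊓ ψ)
  | sup {φ ψ : Snt} : IsBoolSigma k φ → IsBoolSigma k ψ → IsBoolSigma k (φ ⊔ ψ)

/-- The set of `B(Σ_k)` sentences. -/
def BSigmaS (k : ℕ) : Set Snt := {φ | IsBoolSigma k φ}

/-- The set of `Γ` sentences provable in `T`, `Th_Γ(T)`. -/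
def ThIn (Γ : Set Snt) (T : Thy) : Set Snt := Γ ∩ Th T

instance (i : ℕ) : Encodable (LA.Functions i) :=
  match i with
  | 0 => inferInstanceAs (Encodable Unit)
  | 1 => inferInstanceAs (Encodable Unit)
  | 2 => inferInstanceAs (Encodable Bool)
  | (_ + 3) => inferInstanceAs (Encodable Empty)

instance (i : ℕ) : Encodable (LA.Relations i) :=
  match i with
  | 0 => inferInstanceAs (Encodable Empty)
  | 1 => inferInstanceAs (Encodable Empty)
  | 2 => inferInstanceAs (Encodable Unit)
  | (_ + 3) => inferInstanceAs (Encodable Empty)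

/-- A Gödel numbering of sentences, via Mathlib's encoding of bounded formulas. -/
def gnum (φ : Snt) : ℕ :=
  Encodable.encode
    (show List ((Σ k, LA.Term (Empty ⊕ Fin k)) ⊕ ((Σ n, LA.Relations n) ⊕ ℕ)) from
      BoundedFormula.encoding.encode (⟨0, φ⟩ : Σ n, LA.BoundedFormula Empty n))

/-- The (axiom set of the) theory `T` is computable. -/
def CompThy (T : Thy) : Prop :=
  ComputablePred (fun m : ℕ => ∃ φ ∈ T, gnum φ = m)

/-- `T` is a computable consistent extension of `PA`. -/
def GoodThy (T : Thy) : Prop := CompThy T ∧ Con T ∧ ExtPA T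

/-- `φ` is `Γ`-conservative over `T` for a class of sentences `Γ`:
every `Γ` sentence provable in `T + φ` is provable in `T`. -/
def ConsIn (Γ : Set Snt) (T : Thy) (φ : Snt) : Prop :=
  ∀ γ ∈ Γ, Prv (add T φ) γ → Prv T γ

/-- `φ` is hereditarily `Γ`-conservative over `T`: `Γ`-conservative over every
subtheory of `T` (containing `PA`). -/
def HConsIn (Γ : Set Snt) (T : Thy) (φ : Snt) : Prop :=
  ∀ V : Thy, SubThy V T → ConsIn Γ V φ

/-- `φ` is `Σ_k↓Π_k`-conservative over `V`. -/
def SPCons (k : ℕ) (V : Thy) (φ : Snt) : Prop :=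
  ∀ σ ∈ SigmaS k, ∀ π ∈ PiS k, Prv (add V φ) (σ ⊓ π) → Prv V (σ ⊔ π)

/-- `φ` is hereditarily `Σ_k↓Π_k`-conservative over `T`. -/
def HSPCons (k : ℕ) (T : Thy) (φ : Snt) : Prop :=
  ∀ V : Thy, SubThy V T → SPCons k V φ

/-- The theory `S` is `Σ_k↓Π_k`-conservative over `PA`. -/
def ThySPConsPA (k : ℕ) (S : Thy) : Prop :=
  ∀ σ ∈ SigmaS k, ∀ π ∈ PiS k, Prv S (σ ⊓ π) → Prv PAAx (σ ⊔ π)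

/-- `δ` is a `Δ_k(S)` sentence: `S`-provably equivalent to both a `Σ_k` sentence
and a `Π_k` sentence. -/
def IsDeltaIn (k : ℕ) (S : Thy) (δ : Snt) : Prop :=
  (∃ σ ∈ SigmaS k, Prv S (δ ⇔ σ)) ∧ ∃ π ∈ PiS k, Prv S (δ ⇔ π)

/-- `φ` is `Δ_k(S)`-conservative over `V`. -/
def DeltaConsRel (k : ℕ) (S V : Thy) (φ : Snt) : Prop :=
  ∀ δ : Snt, IsDeltaIn k S δ → Prv (add V φ) δ → Prv V δ

/-- `φ` is `Δ_k`-conservative over `T`, i.e. `Δ_k(Th(T))`-conservative over `T`. -/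
def DeltaCons (k : ℕ) (T : Thy) (φ : Snt) : Prop := DeltaConsRel k (Th T) T φ

/-- `φ` is hereditarily `Δ_k`-conservative over `T`. -/
def HDeltaCons (k : ℕ) (T : Thy) (φ : Snt) : Prop :=
  ∀ V : Thy, SubThy V T → DeltaConsRel k (Th V) V φ

/-- `φ` is doubly `Π_k`-conservative over `T`: `φ` is `Π_k`-conservative and `¬φ` is
`Σ_k`-conservative over `T`. -/
def DCons (k : ℕ) (T : Thy) (φ : Snt) : Prop :=
  ConsIn (PiS k) T φ ∧ ConsIn (SigmaS k) T (∼φ)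

/-- `φ` is hereditarily doubly `Π_k`-conservative over `T`. -/
def HDCons (k : ℕ) (T : Thy) (φ : Snt) : Prop :=
  ∀ V : Thy, SubThy V T → DCons k V φ

/-- `(T,U)` is a `B_n`-pair. -/
def Bpair (n : ℕ) (T U : Thy) : Prop :=
  (¬ ThIn (PiS n) T ⊆ Th U ∨ Con (T ∪ ThIn (PiS n) U)) ∧
  (¬ ThIn (PiS n) U ⊆ Th T ∨ Con (U ∪ ThIn (PiS n) T))

/-- `(T,U)` is a `C_n`-pair. -/
def Cpair (n : ℕ) (T U : Thy) : Prop :=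
  Con (T ∪ ThIn (PiS n) U) ∧ Con (U ∪ ThIn (PiS n) T)

/-- `(T,U)` is a `C⁻_n`-pair. -/
def Cmpair (n : ℕ) (T U : Thy) : Prop :=
  Con (T ∪ ThIn (PiS n) U) ∨ Con (U ∪ ThIn (PiS n) T)

/-- `(T,U)` is a `C^∧_n`-pair. -/
def Capair (n : ℕ) (T U : Thy) : Prop :=
  Con (T ∪ ThIn (SigAndPiS n) U) ∧ Con (U ∪ ThIn (SigAndPiS n) T)

/-- `(T,U)` is a `C^B_n`-pair. -/
def CBpair (n : ℕ) (T U : Thy) : Prop :=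
  Con (T ∪ ThIn (BSigmaS n) U)

end Guaspari

namespace Guaspari

/-! ## Models of PA -/

class PAM (M : Type) extends LA.Structure M where
  models : M ⊨ PAAx

section basic
variable {M : Type}

def opZ (M : Type) [LA.Structure M] : M :=
  ((show LA.Constants from Unit.unit : LA.Constants) : M)
def opS [LA.Structure M] (x : M) : M :=
  Structure.funMap (L := LA) (n := 1) (show LA.Functions 1 from Unit.unit) ![x]
def opA [LA.Structure M] (x y : M) : M :=
  Structure.funMap (L := LA) (n := 2) (show LA.Functions 2 from false) ![x, y]
def opM [LA.Structure M] (x y : M) : M :=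
  Structure.funMap (L := LA) (n := 2) (show LA.Functions 2 from true) ![x, y]
def opL [LA.Structure M] (x y : M) : Prop :=
  Structure.RelMap (L := LA) (n := 2) (show LA.Relations 2 from Unit.unit) ![x, y]

variable [LA.Structure M] {α : Type} {n : ℕ}

@[simp] theorem rz_zeroT (w : α ⊕ Fin n → M) : (zeroT : LA.Term (α ⊕ Fin n)).realize w = opZ M :=
  Term.realize_constants
@[simp] theorem rz_succT (w : α ⊕ Fin n → M) (t) : (succT t).realize w = opS (t.realize w) :=
  Term.realize_functions_apply₁
@[simp] theorem rz_addT (w : α ⊕ Fin n → M) (t u) :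
    (addT t u).realize w = opA (t.realize w) (u.realize w) := Term.realize_functions_apply₂
@[simp] theorem rz_mulT (w : α ⊕ Fin n → M) (t u) :
    (mulT t u).realize w = opM (t.realize w) (u.realize w) := Term.realize_functions_apply₂
@[simp] theorem rz_leF (w : α → M) (v : Fin n → M) (t u) :
    (leF t u).Realize w v ↔ opL (t.realize (Sum.elim w v)) (u.realize (Sum.elim w v)) :=
  BoundedFormula.realize_rel₂
@[simp] theorem rz_vT (w : Empty → M) (v : Fin n → M) (i) :
    (vT i).realize (Sum.elim w v) = v i := rfl

/-! Definability with parameters -/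
def Df (P : (Fin n → M) → Prop) : Prop :=
  ∃ φ : LA.BoundedFormula M n, ∀ v, P v ↔ φ.Realize id v
def Tf (t : (Fin n → M) → M) : Prop :=
  ∃ τ : LA.Term (M ⊕ Fin n), ∀ v, t v = τ.realize (Sum.elim id v)

theorem Tf.var (i : Fin n) : Tf (fun v : Fin n → M => v i) := ⟨Term.var (Sum.inr i), fun _ => rfl⟩
theorem Tf.const (a : M) : Tf (fun _ : Fin n → M => a) := ⟨Term.var (Sum.inl a), fun _ => rfl⟩
theorem Tf.opS {t : (Fin n → M) → M} (h : Tf t) : Tf (fun v => opS (t v)) := by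
  obtain ⟨τ, h⟩ := h; exact ⟨succT τ, fun v => by simp [h]⟩
theorem Tf.opA {t u : (Fin n → M) → M} (h : Tf t) (h' : Tf u) : Tf (fun v => opA (t v) (u v)) := by
  obtain ⟨τ, h⟩ := h; obtain ⟨τ', h'⟩ := h'; exact ⟨addT τ τ', fun v => by simp [h, h']⟩
theorem Tf.opM {t u : (Fin n → M) → M} (h : Tf t) (h' : Tf u) : Tf (fun v => opM (t v) (u v)) := by
  obtain ⟨τ, h⟩ := h; obtain ⟨τ', h'⟩ := h'; exact ⟨mulT τ τ', fun v => by simp [h, h']⟩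

theorem Df.eq {t u : (Fin n → M) → M} (h : Tf t) (h' : Tf u) : Df (fun v => t v = u v) := by
  obtain ⟨τ, h⟩ := h; obtain ⟨τ', h'⟩ := h'; exact ⟨τ =' τ', fun v => by simp [h, h']⟩
theorem Df.opL {t u : (Fin n → M) → M} (h : Tf t) (h' : Tf u) : Df (fun v => opL (t v) (u v)) := by
  obtain ⟨τ, h⟩ := h; obtain ⟨τ', h'⟩ := h'; exact ⟨leF τ τ', fun v => by simp [h, h']⟩
theorem Df.not {P : (Fin n → M) → Prop} (h : Df P) : Df (fun v => ¬ P v) := by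
  obtain ⟨τ, h⟩ := h; exact ⟨∼τ, fun v => by simp [h]⟩
theorem Df.imp {P Q : (Fin n → M) → Prop} (h : Df P) (h' : Df Q) : Df (fun v => P v → Q v) := by
  obtain ⟨τ, h⟩ := h; obtain ⟨τ', h'⟩ := h'; exact ⟨τ ⟹ τ', fun v => by simp [h, h']⟩
theorem Df.and {P Q : (Fin n → M) → Prop} (h : Df P) (h' : Df Q) : Df (fun v => P v ∧ Q v) := by
  obtain ⟨τ, h⟩ := h; obtain ⟨τ', h'⟩ := h'; exact ⟨τ ⊓ τ', fun v => by simp [h, h']⟩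
theorem Df.or {P Q : (Fin n → M) → Prop} (h : Df P) (h' : Df Q) : Df (fun v => P v ∨ Q v) := by
  obtain ⟨τ, h⟩ := h; obtain ⟨τ', h'⟩ := h'; exact ⟨τ ⊔ τ', fun v => by simp [h, h']⟩
theorem Df.iff {P Q : (Fin n → M) → Prop} (h : Df P) (h' : Df Q) : Df (fun v => P v ↔ Q v) := by
  obtain ⟨τ, h⟩ := h; obtain ⟨τ', h'⟩ := h'; exact ⟨τ ⇔ τ', fun v => by simp [h, h']⟩
theorem Df.prop (p : Prop) : Df (fun _ : Fin n → M => p) := by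
  by_cases hp : p
  · exact ⟨⊤, fun v => by simp [hp]⟩
  · exact ⟨⊥, fun v => by simp [hp]⟩
theorem Df.all {P : (Fin n → M) → M → Prop}
    (h : Df (fun w : Fin (n+1) → M => P (Fin.init w) (w (Fin.last n)))) : Df (fun v => ∀ y, P v y) := by
  obtain ⟨τ, h⟩ := h; refine ⟨∀' τ, fun v => ?_⟩
  rw [BoundedFormula.realize_all]
  refine forall_congr' fun y => ?_
  rw [← h]; simp
theorem Df.ex {P : (Fin n → M) → M → Prop}
    (h : Df (fun w : Fin (n+1) → M => P (Fin.init w) (w (Fin.last n)))) : Df (fun v => ∃ y, P v y) := by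
  obtain ⟨τ, h⟩ := h; refine ⟨∃' τ, fun v => ?_⟩
  rw [BoundedFormula.realize_ex]
  refine exists_congr fun y => ?_
  rw [← h]; simp
theorem Df.of_iff {P Q : (Fin n → M) → Prop} (h : Df P) (e : ∀ v, Q v ↔ P v) : Df Q := by
  obtain ⟨τ, h⟩ := h; exact ⟨τ, fun v => (e v).trans (h v)⟩

end basic

section ind
variable {M : Type} [PAM M]

theorem pam_mem {φ : Snt} (h : φ ∈ PAAx) : M ⊨ φ := PAM.models.realize_of_mem φ h

theorem ind_param {k : ℕ} (φ : LA.BoundedFormula Empty (k+1)) (p : Fin k → M)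
    (h0 : φ.Realize default (Fin.snoc p (opZ M) : Fin (k+1) → M))
    (hs : ∀ x : M, φ.Realize default (Fin.snoc p x : Fin (k+1) → M) →
      φ.Realize default (Fin.snoc p (opS x) : Fin (k+1) → M)) (x : M) :
    φ.Realize default (Fin.snoc p x : Fin (k+1) → M) := by
  have h : M ⊨ indAxiom φ := pam_mem (Or.inr ⟨k, φ, rfl⟩)
  unfold indAxiom at h
  simp only [Sentence.Realize, BoundedFormula.realize_alls] at h
  have := h p
  simp only [BoundedFormula.realize_imp, BoundedFormula.realize_inf, BoundedFormula.realize_all,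
    BoundedFormula.realize_bdEqual, rz_zeroT, rz_succT, rz_vT] at this
  have key := this ⟨?_, ?_⟩ x
  · exact key
  · intro a ha
    simp only [Fin.snoc_last] at ha
    subst ha; exact h0
  · intro a ha b hb
    simp only [Fin.snoc_last, Fin.snoc_castSucc] at hb
    rw [BoundedFormula.realize_liftAt_one (by omega)]
    have e := hs a ha
    convert e using 1
    funext i
    refine Fin.lastCases ?_ (fun j => ?_) i
    · simp [hb, Fin.snoc]
    · simp [Fin.snoc]

theorem Df.ind {P : M → Prop} (hP : Df (fun v : Fin 1 → M => P (v 0)))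
    (h0 : P (opZ M)) (hs : ∀ x, P x → P (opS x)) (x : M) : P x := by
  classical
  obtain ⟨φ, hφ⟩ := hP
  let e := Fintype.equivFin φ.freeVarFinset
  let ψ : LA.BoundedFormula (Fin (Fintype.card φ.freeVarFinset)) 1 := φ.restrictFreeVar e
  let χ : LA.BoundedFormula Empty (Fintype.card φ.freeVarFinset + 1) :=
    ψ.relabel (fun i => Sum.inr i)
  let p : Fin (Fintype.card φ.freeVarFinset) → M := fun i => (e.symm i : M)
  have key : ∀ y : M, P y ↔ χ.Realize default
      (Fin.snoc p y : Fin (Fintype.card φ.freeVarFinset + 1) → M) := by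
    intro y
    have h1 := hφ ![y]
    simp only [Matrix.cons_val_zero] at h1
    rw [h1, BoundedFormula.realize_relabel]
    symm
    have := BoundedFormula.realize_restrictFreeVar (φ := φ) (f := e) (v := p) (v' := id)
      (by intro a; simp [p]) (xs := ![y])
    rw [← this]
    have e1 : (Sum.elim (default : Empty → M) ((Fin.snoc p y : Fin (Fintype.card φ.freeVarFinset + 1) → M) ∘ Fin.castAdd 1) ∘ fun i => Sum.inr i : Fin (Fintype.card φ.freeVarFinset) → M) = p := by
      funext i
      change (Fin.snoc p y : Fin (Fintype.card φ.freeVarFinset + 1) → M) (Fin.castSucc i) = _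
      rw [Fin.snoc_castSucc]
    have e2 : (Fin.snoc p y : Fin (Fintype.card φ.freeVarFinset + 1) → M) ∘ Fin.natAdd (Fintype.card φ.freeVarFinset) = ![y] := by
      funext i
      have : i = 0 := Subsingleton.elim _ _
      subst this
      change (Fin.snoc p y : Fin (Fintype.card φ.freeVarFinset + 1) → M) (Fin.last _) = _
      rw [Fin.snoc_last]; rfl
    rw [e1, e2]
  rw [key]
  exact ind_param χ p ((key _).1 h0) (fun z hz => (key _).1 (hs z ((key _).2 hz))) x

end ind
end Guaspari

set_option linter.unusedSimpArgs false
namespace Guaspari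
section
variable {M : Type} [PAM M]

theorem ax_S0 (x : M) : opS x ≠ opZ M := by
  have h : M ⊨ (∀' ∼(succT (vT 0) =' zeroT) : Snt) := pam_mem (by simp [PAAx])
  simp only [Sentence.Realize, Formula.Realize, BoundedFormula.realize_all, BoundedFormula.realize_not,
    BoundedFormula.realize_bdEqual, rz_zeroT, rz_succT, rz_vT] at h
  exact h x
theorem ax_SS (x y : M) (e : opS x = opS y) : x = y := by
  have h : M ⊨ (∀' ∀' ((succT (vT 0) =' succT (vT 1)) ⟹ (vT 0 =' vT 1)) : Snt) := pam_mem (by simp [PAAx])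
  simp only [Sentence.Realize, Formula.Realize, BoundedFormula.realize_all, BoundedFormula.realize_imp,
    BoundedFormula.realize_bdEqual, rz_zeroT, rz_succT, rz_vT] at h
  exact h x y e
theorem ax_A0 (x : M) : opA x (opZ M) = x := by
  have h : M ⊨ (∀' (addT (vT 0) zeroT =' vT 0) : Snt) := pam_mem (by simp [PAAx])
  simp only [Sentence.Realize, Formula.Realize, BoundedFormula.realize_all,
    BoundedFormula.realize_bdEqual, rz_zeroT, rz_addT, rz_vT] at h
  exact h x
theorem ax_AS (x y : M) : opA x (opS y) = opS (opA x y) := by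
  have h : M ⊨ (∀' ∀' (addT (vT 0) (succT (vT 1)) =' succT (addT (vT 0) (vT 1))) : Snt) :=
    pam_mem (by simp [PAAx])
  simp only [Sentence.Realize, Formula.Realize, BoundedFormula.realize_all,
    BoundedFormula.realize_bdEqual, rz_succT, rz_addT, rz_vT] at h
  exact h x y
theorem ax_M0 (x : M) : opM x (opZ M) = opZ M := by
  have h : M ⊨ (∀' (mulT (vT 0) zeroT =' zeroT) : Snt) := pam_mem (by simp [PAAx])
  simp only [Sentence.Realize, Formula.Realize, BoundedFormula.realize_all,
    BoundedFormula.realize_bdEqual, rz_zeroT, rz_mulT, rz_vT] at h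
  exact h x
theorem ax_MS (x y : M) : opM x (opS y) = opA (opM x y) x := by
  have h : M ⊨ (∀' ∀' (mulT (vT 0) (succT (vT 1)) =' addT (mulT (vT 0) (vT 1)) (vT 0)) : Snt) :=
    pam_mem (by simp [PAAx])
  simp only [Sentence.Realize, Formula.Realize, BoundedFormula.realize_all,
    BoundedFormula.realize_bdEqual, rz_succT, rz_addT, rz_mulT, rz_vT] at h
  exact h x y
theorem ax_L (x y : M) : opL x y ↔ ∃ z, opA z x = y := by
  have h : M ⊨ (∀' ∀' (leF (vT 0) (vT 1) ⇔ ∃' (addT (vT 2) (vT 0) =' vT 1)) : Snt) :=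
    pam_mem (by simp [PAAx])
  simp only [Sentence.Realize, Formula.Realize, BoundedFormula.realize_all, BoundedFormula.realize_iff,
    BoundedFormula.realize_ex, rz_leF,
    BoundedFormula.realize_bdEqual, rz_succT, rz_addT, rz_mulT, rz_vT] at h
  exact h x y

theorem opZA (x : M) : opA (opZ M) x = x := by
  refine Df.ind (P := fun x => opA (opZ M) x = x) (Df.eq (Tf.opA (Tf.const _) (Tf.var _)) (Tf.var _)) (ax_A0 _) ?_ x
  intro x h; rw [ax_AS, h]
theorem opSA (x y : M) : opA (opS x) y = opS (opA x y) := by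
  refine Df.ind (P := fun y => opA (opS x) y = opS (opA x y))
    (Df.eq (Tf.opA (Tf.const _) (Tf.var _)) (Tf.opS (Tf.opA (Tf.const _) (Tf.var _)))) ?_ ?_ y
  · simp only [ax_A0]
  intro x h; rw [ax_AS, h, ax_AS]
theorem opA_comm (x y : M) : opA x y = opA y x := by
  refine Df.ind (P := fun y => opA x y = opA y x)
    (Df.eq (Tf.opA (Tf.const _) (Tf.var _)) (Tf.opA (Tf.var _) (Tf.const _))) ?_ ?_ y
  · simp only [ax_A0, opZA]
  intro x h; rw [ax_AS, h, opSA]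
theorem opA_assoc (x y z : M) : opA (opA x y) z = opA x (opA y z) := by
  refine Df.ind (P := fun z => opA (opA x y) z = opA x (opA y z))
    (Df.eq (Tf.opA (Tf.const _) (Tf.var _)) (Tf.opA (Tf.const _) (Tf.opA (Tf.const _) (Tf.var _)))) ?_ ?_ z
  · simp only [ax_A0]
  intro x h; rw [ax_AS, h, ax_AS, ax_AS]
theorem opZM (x : M) : opM (opZ M) x = opZ M := by
  refine Df.ind (P := fun x => opM (opZ M) x = opZ M) (Df.eq (Tf.opM (Tf.const _) (Tf.var _)) (Tf.const _)) (ax_M0 _) ?_ x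
  intro x h; rw [ax_MS, h, ax_A0]
theorem opSM (x y : M) : opM (opS x) y = opA (opM x y) y := by
  refine Df.ind (P := fun y => opM (opS x) y = opA (opM x y) y)
    (Df.eq (Tf.opM (Tf.const _) (Tf.var _)) (Tf.opA (Tf.opM (Tf.const _) (Tf.var _)) (Tf.var _))) ?_ ?_ y
  · simp only [ax_M0, ax_A0]
  intro y h; rw [ax_MS, h, ax_MS, opA_assoc, opA_assoc, ax_AS, ax_AS, ax_AS, ax_AS, opA_comm y x]
theorem opM_comm (x y : M) : opM x y = opM y x := by
  refine Df.ind (P := fun y => opM x y = opM y x)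
    (Df.eq (Tf.opM (Tf.const _) (Tf.var _)) (Tf.opM (Tf.var _) (Tf.const _))) ?_ ?_ y
  · simp only [ax_M0, opZM]
  intro x h; rw [ax_MS, h, opSM]
theorem opM_distrib (x y z : M) : opM x (opA y z) = opA (opM x y) (opM x z) := by
  refine Df.ind (P := fun z => opM x (opA y z) = opA (opM x y) (opM x z))
    (Df.eq (Tf.opM (Tf.const _) (Tf.opA (Tf.const _) (Tf.var _)))
      (Tf.opA (Tf.const _) (Tf.opM (Tf.const _) (Tf.var _)))) ?_ ?_ z
  · simp only [ax_A0, ax_M0]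
  intro z h; rw [ax_AS, ax_MS, h, ax_MS, opA_assoc]
theorem opM_assoc (x y z : M) : opM (opM x y) z = opM x (opM y z) := by
  refine Df.ind (P := fun z => opM (opM x y) z = opM x (opM y z))
    (Df.eq (Tf.opM (Tf.const _) (Tf.var _)) (Tf.opM (Tf.const _) (Tf.opM (Tf.const _) (Tf.var _)))) ?_ ?_ z
  · simp only [ax_M0]
  intro z h; rw [ax_MS, h, ax_MS, opM_distrib]
theorem opA_cancel (x y z : M) (h : opA x z = opA y z) : x = y := by
  have := Df.ind (P := fun z => opA x z = opA y z → x = y)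
    (Df.imp (Df.eq (Tf.opA (Tf.const _) (Tf.var _)) (Tf.opA (Tf.const _) (Tf.var _))) (Df.prop _)) ?_ ?_ z
  · exact this h
  · simp only [ax_A0, imp_self]
  · intro z h e; rw [ax_AS, ax_AS] at e; exact h (ax_SS _ _ e)
theorem zero_or_succ (x : M) : x = opZ M ∨ ∃ y, x = opS y := by
  refine Df.ind (P := fun x => x = opZ M ∨ ∃ y, x = opS y)
    (Df.or (Df.eq (Tf.var _) (Tf.const _)) (Df.ex (Df.eq (Tf.var _) (Tf.opS (Tf.var _))))) (Or.inl rfl) ?_ x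
  intro x _; exact Or.inr ⟨x, rfl⟩
theorem opA_zero (x y : M) (h : opA x y = opZ M) : y = opZ M := by
  rcases zero_or_succ y with rfl | ⟨z, rfl⟩
  · rfl
  · rw [ax_AS] at h; exact absurd h (ax_S0 _)
theorem opL_total (x y : M) : opL x y ∨ opL y x := by
  refine Df.ind (P := fun y => opL x y ∨ opL y x)
    (Df.or (Df.opL (Tf.const _) (Tf.var _)) (Df.opL (Tf.var _) (Tf.const _))) ?_ ?_ y
  · right; rw [ax_L]; exact ⟨x, ax_A0 _⟩
  · intro y h
    rcases h with h | h
    · left; rw [ax_L] at *; obtain ⟨z, rfl⟩ := h; exact ⟨opS z, opSA _ _⟩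
    · rw [ax_L] at h
      obtain ⟨z, rfl⟩ := h
      rcases zero_or_succ z with rfl | ⟨z, rfl⟩
      · left; rw [ax_L]; exact ⟨opS (opZ M), by rw [opSA, opZA, opZA]⟩
      · right; rw [ax_L]; exact ⟨z, by rw [ax_AS, opSA]⟩

instance pamSemiring : CommSemiring M where
  add := opA
  add_assoc := opA_assoc
  zero := opZ M
  zero_add := opZA
  add_zero := ax_A0
  add_comm := opA_comm
  nsmul := @nsmulRec M ⟨opZ M⟩ ⟨opA⟩
  mul := opM
  one := opS (opZ M)
  left_distrib := opM_distrib
  right_distrib := fun x y z => by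
    change opM (opA x y) z = opA (opM x z) (opM y z)
    rw [opM_comm, opM_distrib, opM_comm z, opM_comm z]
  zero_mul := opZM
  mul_zero := ax_M0
  mul_assoc := opM_assoc
  one_mul := fun x => by
    change opM (opS (opZ M)) x = x
    rw [opSM, opZM, opZA]
  mul_one := fun x => by
    change opM x (opS (opZ M)) = x
    rw [ax_MS, ax_M0, opZA]
  mul_comm := opM_comm

theorem opS_eq (x : M) : opS x = x + 1 := by
  change _ = opA x (opS (opZ M)); rw [ax_AS, ax_A0]
theorem opA_eq (x y : M) : opA x y = x + y := rfl
theorem opM_eq (x y : M) : opM x y = x * y := rfl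
theorem opZ_eq : opZ M = 0 := rfl

open Classical in
noncomputable instance pamOrder : LinearOrder M where
  le := opL
  le_refl := fun x => by rw [ax_L]; exact ⟨opZ M, opZA _⟩
  le_trans := fun x y z h h' => by
    rw [ax_L] at *; obtain ⟨a, rfl⟩ := h; obtain ⟨b, rfl⟩ := h'; exact ⟨opA b a, opA_assoc _ _ _⟩
  le_antisymm := fun x y h h' => by
    rw [ax_L] at *; obtain ⟨a, rfl⟩ := h; obtain ⟨b, h⟩ := h'
    rw [← opA_assoc] at h
    have : opA (opA b a) x = opA (opZ M) x := by rw [h, opZA]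
    have := opA_zero _ _ (opA_cancel _ _ _ this)
    rw [this, opZA]
  le_total := opL_total
  toDecidableLE := Classical.decRel _

theorem opL_eq (x y : M) : opL x y ↔ x ≤ y := Iff.rfl
theorem le_def (x y : M) : x ≤ y ↔ ∃ z, z + x = y := ax_L x y

instance pamCan : CanonicallyOrderedAdd M where
  exists_add_of_le := fun {a b} h => by
    obtain ⟨z, rfl⟩ := (le_def a b).1 h; exact ⟨z, add_comm _ _⟩
  le_add_self := fun a b => (le_def _ _).2 ⟨b, rfl⟩
  le_self_add := fun a b => (le_def _ _).2 ⟨b, add_comm _ _⟩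

theorem pam_add_le {a b : M} (h : a ≤ b) (c : M) : a + c ≤ b + c := by
  obtain ⟨z, rfl⟩ := (le_def a b).1 h; exact (le_def _ _).2 ⟨z, by ring⟩
theorem pam_cancel {a b c : M} (h : a + c = b + c) : a = b := opA_cancel a b c h
theorem pam_lt {a b : M} : a < b ↔ ∃ z, b = a + z + 1 := by
  rw [lt_iff_le_not_ge]
  constructor
  · rintro ⟨h, h'⟩
    obtain ⟨z, rfl⟩ := (le_def a b).1 h
    rcases zero_or_succ z with rfl | ⟨y, rfl⟩
    · exact absurd ((le_def _ _).2 ⟨0, by rw [opZ_eq]; simp⟩) h'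
    · exact ⟨y, by rw [opS_eq]; ring⟩
  · rintro ⟨z, rfl⟩
    refine ⟨(le_def _ _).2 ⟨z+1, by ring⟩, fun h => ?_⟩
    obtain ⟨y, h⟩ := (le_def _ _).1 h
    have : (y + z + 1) + a = 0 + a := by rw [zero_add]; conv_rhs => rw [← h]
                                         ring
    have := pam_cancel this
    rw [← opS_eq] at this
    exact ax_S0 _ this

instance pamSOR : IsStrictOrderedRing M where
  add_le_add_left := fun a b h c => pam_add_le h c
  le_of_add_le_add_left := fun a b c h => by
    obtain ⟨z, hz⟩ := (le_def _ _).1 h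
    have : (z + b) + a = c + a := by rw [add_comm c, ← hz]; ring
    exact (le_def _ _).2 ⟨z, pam_cancel this⟩
  zero_le_one := (le_def _ _).2 ⟨1, by simp⟩
  exists_pair_ne := ⟨opS 0, 0, ax_S0 _⟩
  mul_lt_mul_of_pos_left := fun a ha b c h => by
    obtain ⟨z, rfl⟩ := pam_lt.1 h
    obtain ⟨y, rfl⟩ := pam_lt.1 ha
    exact pam_lt.2 ⟨(0 + y + 1) * z + y, by ring⟩
  mul_lt_mul_of_pos_right := fun a ha b c h => by
    obtain ⟨z, rfl⟩ := pam_lt.1 h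
    obtain ⟨y, rfl⟩ := pam_lt.1 ha
    exact pam_lt.2 ⟨(0 + y + 1) * z + y, by ring⟩

/-! closure in semiring language -/
variable {n : ℕ}
theorem Tf.zero : Tf (fun _ : Fin n → M => (0 : M)) := Tf.const _
theorem Tf.one : Tf (fun _ : Fin n → M => (1 : M)) := Tf.const _
theorem Tf.add {t u : (Fin n → M) → M} (h : Tf t) (h' : Tf u) : Tf (fun v => t v + u v) := Tf.opA h h'
theorem Tf.mul {t u : (Fin n → M) → M} (h : Tf t) (h' : Tf u) : Tf (fun v => t v * u v) := Tf.opM h h'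
theorem Df.le {t u : (Fin n → M) → M} (h : Tf t) (h' : Tf u) : Df (fun v => t v ≤ u v) := Df.opL h h'
theorem Df.lt {t u : (Fin n → M) → M} (h : Tf t) (h' : Tf u) : Df (fun v => t v < u v) :=
  (Df.not (Df.le h' h)).of_iff (fun _ => by simp)

theorem lt_succ_iff' {x y : M} : x < y + 1 ↔ x ≤ y := by
  constructor
  · intro h; obtain ⟨z, h⟩ := pam_lt.1 h
    have : y = x + z := pam_cancel h
    rw [this]; exact le_self_add
  · intro h; obtain ⟨z, rfl⟩ := exists_add_of_le h
    exact pam_lt.2 ⟨z, rfl⟩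
theorem succ_le_iff' {x y : M} : x + 1 ≤ y ↔ x < y := by
  rw [← not_lt, lt_succ_iff', not_le]

theorem pind {P : M → Prop} (hP : Df (fun v : Fin 1 → M => P (v 0)))
    (h0 : P 0) (hs : ∀ x, P x → P (x + 1)) (x : M) : P x :=
  Df.ind hP h0 (fun x h => by rw [opS_eq]; exact hs x h) x

theorem psind {P : M → Prop} (hP : ∀ n, ∀ t : (Fin n → M) → M, Tf t → Df (fun v => P (t v)))
    (hs : ∀ x, (∀ y < x, P y) → P x) (x : M) : P x := by
  have : ∀ y < x + 1, P y := by
    refine pind (P := fun x => ∀ y < x + 1, P y) ?_ ?_ ?_ x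
    · exact Df.all (Df.imp (Df.lt (Tf.var _) (Tf.add (Tf.var _) Tf.one)) (hP _ _ (Tf.var _)))
    · intro y hy
      apply hs; intro z hz
      have := lt_of_lt_of_le hz (lt_succ_iff'.1 hy)
      exact absurd this (by simp)
    · intro x ih y hy
      rcases (lt_succ_iff'.1 hy).lt_or_eq with h | rfl
      · exact ih y h
      · exact hs _ (fun z hz => ih z hz)
  exact this x (lt_succ_iff'.2 le_rfl)
end
end Guaspari

set_option linter.unusedSimpArgs false
set_option linter.unusedVariables false
namespace Guaspari

/-! ## Families of relations, uniformly definable in models of PA -/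

abbrev Fam (m : ℕ) := ∀ (M : Type) [PAM M], (Fin m → M) → Prop
abbrev TFam (m : ℕ) := ∀ (M : Type) [PAM M], (Fin m → M) → M

def Tm {m : ℕ} (t : TFam m) : Prop :=
  ∃ τ : LA.Term (Empty ⊕ Fin m), ∀ (M : Type) [PAM M] (v : Fin m → M), t M v = τ.realize (Sum.elim default v)
def D0 {m : ℕ} (P : Fam m) : Prop :=
  ∃ φ : LA.BoundedFormula Empty m, IsDelta0 φ ∧
    ∀ (M : Type) [PAM M] (v : Fin m → M), P M v ↔ φ.Realize default v
def Sg (k : ℕ) {m : ℕ} (P : Fam m) : Prop :=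
  ∃ φ : LA.BoundedFormula Empty m, IsSigmaFml k φ ∧
    ∀ (M : Type) [PAM M] (v : Fin m → M), P M v ↔ φ.Realize default v
def Pg (k : ℕ) {m : ℕ} (P : Fam m) : Prop :=
  ∃ φ : LA.BoundedFormula Empty m, IsPiFml k φ ∧
    ∀ (M : Type) [PAM M] (v : Fin m → M), P M v ↔ φ.Realize default v
def FF {m : ℕ} (P : Fam m) : Prop :=
  ∃ φ : LA.BoundedFormula Empty m,
    ∀ (M : Type) [PAM M] (v : Fin m → M), P M v ↔ φ.Realize default v
def fam {m : ℕ} (φ : LA.BoundedFormula Empty m) : Fam m := fun _ _ v => φ.Realize default v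

theorem fam_eq {m : ℕ} {P : Fam m} {φ : LA.BoundedFormula Empty m}
    (h : ∀ (M : Type) [PAM M] (v : Fin m → M), P M v ↔ φ.Realize default v) : P = fam φ := by
  funext M _ v; exact propext (h M v)
theorem famext {m : ℕ} {P Q : Fam m} (h : ∀ (M : Type) [PAM M] (v : Fin m → M), P M v ↔ Q M v) : P = Q := by
  funext M _ v; exact propext (h M v)

variable {m : ℕ}

theorem Tm.var (i : Fin m) : Tm (fun M _ v => v i) := ⟨vT i, fun _ _ _ => rfl⟩
theorem Tm.zero : Tm (m := m) (fun M _ v => (0 : M)) := ⟨zeroT, fun _ _ _ => by simp [opZ_eq]⟩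
theorem Tm.add {t u : TFam m} (h : Tm t) (h' : Tm u) : Tm (fun M _ v => t M v + u M v) := by
  obtain ⟨τ, h⟩ := h; obtain ⟨τ', h'⟩ := h'
  exact ⟨addT τ τ', fun M _ v => by simp [h, h', opA_eq]⟩
theorem Tm.mul {t u : TFam m} (h : Tm t) (h' : Tm u) : Tm (fun M _ v => t M v * u M v) := by
  obtain ⟨τ, h⟩ := h; obtain ⟨τ', h'⟩ := h'
  exact ⟨mulT τ τ', fun M _ v => by simp [h, h', opM_eq]⟩
theorem Tm.one : Tm (m := m) (fun M _ v => (1 : M)) := ⟨succT zeroT, fun _ _ _ => by simp [opZ_eq, opS_eq]⟩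
theorem Tm.cast (c : ℕ) : Tm (m := m) (fun M _ v => (c : M)) := by
  induction c with
  | zero => simpa using Tm.zero
  | succ n ih => simpa using ih.add Tm.one

theorem Tm.subst {k : ℕ} {t : TFam k} (h : Tm t) {ts : Fin k → TFam m} (hs : ∀ i, Tm (ts i)) :
    Tm (fun M _ v => t M (fun i => ts i M v)) := by
  obtain ⟨τ, h⟩ := h
  choose σ hσ using hs
  refine ⟨τ.subst (Sum.elim (fun e => e.elim) σ), fun M _ v => ?_⟩
  beta_reduce
  rw [h, Term.realize_subst]
  congr 1
  funext x
  rcases x with x | x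
  · exact x.elim
  · simp [hσ]

theorem D0.eq {t u : TFam m} (h : Tm t) (h' : Tm u) : D0 (fun M _ v => t M v = u M v) := by
  obtain ⟨τ, h⟩ := h; obtain ⟨τ', h'⟩ := h'
  exact ⟨τ =' τ', .equal _ _, fun M _ v => by simp [h, h']⟩
theorem D0.le {t u : TFam m} (h : Tm t) (h' : Tm u) : D0 (fun M _ v => t M v ≤ u M v) := by
  obtain ⟨τ, h⟩ := h; obtain ⟨τ', h'⟩ := h'
  exact ⟨leF τ τ', .le _ _, fun M _ v => by simp [h, h', opL_eq]⟩
theorem D0.false : D0 (m := m) (fun M _ v => False) := ⟨⊥, .falsum, fun M _ v => by simp⟩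
theorem D0.imp {P Q : Fam m} (h : D0 P) (h' : D0 Q) : D0 (fun M _ v => P M v → Q M v) := by
  obtain ⟨φ, hφ, h⟩ := h; obtain ⟨ψ, hψ, h'⟩ := h'
  exact ⟨φ ⟹ ψ, .imp hφ hψ, fun M _ v => by simp [h, h']⟩
theorem D0.not {P : Fam m} (h : D0 P) : D0 (fun M _ v => ¬ P M v) := h.imp D0.false
theorem D0.of_iff {P Q : Fam m} (h : D0 P) (e : ∀ (M : Type) [PAM M] (v : Fin m → M), Q M v ↔ P M v) :
    D0 Q := by rw [famext e]; exact h
theorem D0.or {P Q : Fam m} (h : D0 P) (h' : D0 Q) : D0 (fun M _ v => P M v ∨ Q M v) :=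
  (h.not.imp h').of_iff fun M _ v => by tauto
theorem D0.and {P Q : Fam m} (h : D0 P) (h' : D0 Q) : D0 (fun M _ v => P M v ∧ Q M v) :=
  (h.imp h'.not).not.of_iff fun M _ v => by tauto
theorem D0.iff {P Q : Fam m} (h : D0 P) (h' : D0 Q) : D0 (fun M _ v => P M v ↔ Q M v) :=
  ((h.imp h').and (h'.imp h)).of_iff fun M _ v => by tauto
theorem D0.lt {t u : TFam m} (h : Tm t) (h' : Tm u) : D0 (fun M _ v => t M v < u M v) :=
  (D0.le h' h).not.of_iff fun M _ v => by simp

theorem realize_weaken {M : Type} [PAM M] (τ : LA.Term (Empty ⊕ Fin m)) (v : Fin m → M) (y : M) :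
    (τ.relabel (Sum.map id Fin.castSucc)).realize (Sum.elim (default : Empty → M) (Fin.snoc v y : Fin (m+1) → M))
      = τ.realize (Sum.elim default v) := by
  rw [Term.realize_relabel]
  congr 1
  funext x
  rcases x with x | x
  · exact x.elim
  · simp

theorem D0.ball {t : TFam m} (ht : Tm t) {P : ∀ (M : Type) [PAM M], (Fin m → M) → M → Prop}
    (h : D0 (m := m+1) (fun M _ w => P M (Fin.init w) (w (Fin.last m)))) :
    D0 (fun M _ v => ∀ y ≤ t M v, P M v y) := by
  obtain ⟨τ, ht⟩ := ht; obtain ⟨φ, hφ, h⟩ := h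
  refine ⟨_, .ball τ hφ, fun M _ v => ?_⟩
  simp only [BoundedFormula.realize_all, BoundedFormula.realize_imp, rz_leF, rz_vT, realize_weaken, ← h,
    ← ht, opL_eq, Fin.init_snoc, Fin.snoc_last]
theorem D0.bex {t : TFam m} (ht : Tm t) {P : ∀ (M : Type) [PAM M], (Fin m → M) → M → Prop}
    (h : D0 (m := m+1) (fun M _ w => P M (Fin.init w) (w (Fin.last m)))) :
    D0 (fun M _ v => ∃ y ≤ t M v, P M v y) :=
  (D0.ball ht (P := fun M _ v y => ¬ P M v y) h.not).not.of_iff fun M _ v => by push Not; rfl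

theorem tmSnoc {k : ℕ} {ts : Fin k → TFam m} (hs : ∀ i, Tm (ts i)) :
    ∀ i, Tm ((Fin.snoc (α := fun _ => TFam (m+1)) (fun i => fun M _ w => ts i M (Fin.init w)) (fun M _ w => w (Fin.last m)) :
      Fin (k+1) → TFam (m+1)) i) := by
  intro i
  refine Fin.lastCases ?_ (fun j => ?_) i
  · simpa using Tm.var _
  · simp only [Fin.snoc_castSucc]; exact (hs j).subst (ts := fun i M _ w => w (i.castSucc)) fun i => Tm.var _

theorem D0.subst {k : ℕ} {P : Fam k} (h : D0 P) {m : ℕ} {ts : Fin k → TFam m} (hs : ∀ i, Tm (ts i)) :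
    D0 (fun M _ v => P M (fun i => ts i M v)) := by
  obtain ⟨φ, hφ, h⟩ := h
  rw [fam_eq h]; clear h P; unfold fam
  induction hφ generalizing m with
  | falsum => exact D0.false
  | equal t u =>
    exact D0.eq (Tm.subst (t := fun M _ v => t.realize (Sum.elim default v)) ⟨t, fun _ _ _ => rfl⟩ hs)
      (Tm.subst (t := fun M _ v => u.realize (Sum.elim default v)) ⟨u, fun _ _ _ => rfl⟩ hs)
  | le t u =>
    refine (D0.le (Tm.subst (t := fun M _ v => t.realize (Sum.elim default v)) ⟨t, fun _ _ _ => rfl⟩ hs)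
      (Tm.subst (t := fun M _ v => u.realize (Sum.elim default v)) ⟨u, fun _ _ _ => rfl⟩ hs)).of_iff ?_
    intro M _ v; rw [rz_leF]; rfl
  | imp _ _ ih1 ih2 => exact (ih1 hs).imp (ih2 hs)
  | @ball k t φ _ ih =>
    have ht := Tm.subst (t := fun M _ v => t.realize (Sum.elim default v)) ⟨t, fun _ _ _ => rfl⟩ hs
    refine (D0.ball ht (P := fun M _ v y => φ.Realize default (Fin.snoc (fun i => ts i M v) y : Fin (k+1) → M)) ?_).of_iff ?_
    · have := ih (ts := Fin.snoc (α := fun _ => TFam (m+1)) (fun i => fun M _ w => ts i M (Fin.init w)) (fun M _ w => w (Fin.last m))) ?_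
      · refine this.of_iff fun M _ w => ?_
        apply iff_of_eq; congr 1; funext i
        refine Fin.lastCases ?_ (fun j => ?_) i <;> simp
      · exact tmSnoc hs
    · intro M _ v
      simp only [BoundedFormula.realize_all, BoundedFormula.realize_imp, rz_leF, rz_vT, realize_weaken,
        opL_eq, Fin.snoc_last]
  | @bex k t φ _ ih =>
    have ht := Tm.subst (t := fun M _ v => t.realize (Sum.elim default v)) ⟨t, fun _ _ _ => rfl⟩ hs
    refine (D0.bex ht (P := fun M _ v y => φ.Realize default (Fin.snoc (fun i => ts i M v) y : Fin (k+1) → M)) ?_).of_iff ?_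
    · have := ih (ts := Fin.snoc (α := fun _ => TFam (m+1)) (fun i => fun M _ w => ts i M (Fin.init w)) (fun M _ w => w (Fin.last m))) ?_
      · refine this.of_iff fun M _ w => ?_
        apply iff_of_eq; congr 1; funext i
        refine Fin.lastCases ?_ (fun j => ?_) i <;> simp
      · exact tmSnoc hs
    · intro M _ v
      simp only [BoundedFormula.realize_ex, BoundedFormula.realize_inf, rz_leF, rz_vT, realize_weaken,
        opL_eq, Fin.snoc_last]

/-! Sigma and Pi -/
theorem Sg.of_iff {k : ℕ} {P Q : Fam m} (h : Sg k P) (e : ∀ (M : Type) [PAM M] (v : Fin m → M), Q M v ↔ P M v) :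
    Sg k Q := by rw [famext e]; exact h
theorem Pg.of_iff {k : ℕ} {P Q : Fam m} (h : Pg k P) (e : ∀ (M : Type) [PAM M] (v : Fin m → M), Q M v ↔ P M v) :
    Pg k Q := by rw [famext e]; exact h
theorem Sg.ofD0 {P : Fam m} (h : D0 P) : Sg 0 P := by
  obtain ⟨φ, hφ, h⟩ := h; exact ⟨φ, .ofDelta0 hφ, h⟩
theorem Pg.ofD0 {P : Fam m} (h : D0 P) : Pg 0 P := by
  obtain ⟨φ, hφ, h⟩ := h; exact ⟨φ, .ofDelta0 hφ, h⟩
theorem Sg.toD0 {P : Fam m} (h : Sg 0 P) : D0 P := by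
  obtain ⟨φ, hφ, h⟩ := h
  cases hφ with
  | ofDelta0 hφ => exact ⟨φ, hφ, h⟩
theorem Pg.toD0 {P : Fam m} (h : Pg 0 P) : D0 P := by
  obtain ⟨φ, hφ, h⟩ := h
  cases hφ with
  | ofDelta0 hφ => exact ⟨φ, hφ, h⟩
theorem Sg.ofPg {k : ℕ} {P : Fam m} (h : Pg k P) : Sg (k+1) P := by
  obtain ⟨φ, hφ, h⟩ := h; exact ⟨φ, .ofPi hφ, h⟩
theorem Pg.ofSg {k : ℕ} {P : Fam m} (h : Sg k P) : Pg (k+1) P := by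
  obtain ⟨φ, hφ, h⟩ := h; exact ⟨φ, .ofSigma hφ, h⟩
theorem Sg.ex {k : ℕ} {P : ∀ (M : Type) [PAM M], (Fin m → M) → M → Prop}
    (h : Sg (k+1) (m := m+1) (fun M _ w => P M (Fin.init w) (w (Fin.last m)))) :
    Sg (k+1) (fun M _ v => ∃ y, P M v y) := by
  obtain ⟨φ, hφ, h⟩ := h
  refine ⟨_, .ex hφ, fun M _ v => ?_⟩
  simp only [BoundedFormula.realize_ex, ← h, Fin.init_snoc, Fin.snoc_last]
theorem Pg.all {k : ℕ} {P : ∀ (M : Type) [PAM M], (Fin m → M) → M → Prop}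
    (h : Pg (k+1) (m := m+1) (fun M _ w => P M (Fin.init w) (w (Fin.last m)))) :
    Pg (k+1) (fun M _ v => ∀ y, P M v y) := by
  obtain ⟨φ, hφ, h⟩ := h
  refine ⟨_, .all hφ, fun M _ v => ?_⟩
  simp only [BoundedFormula.realize_all, ← h, Fin.init_snoc, Fin.snoc_last]

theorem Sg.elim {k : ℕ} {C : ∀ m, Fam m → Prop} (h1 : ∀ m P, Pg k P → C m P)
    (h2 : ∀ m (P : Fam (m+1)), Sg (k+1) P → C (m+1) P → C m (fun M _ v => ∃ y, P M (Fin.snoc v y)))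
    {P : Fam m} (h : Sg (k+1) P) : C m P := by
  obtain ⟨φ, hφ, h⟩ := h
  rw [fam_eq h]; clear h P
  refine IsSigmaFml.rec (motive_1 := fun j m φ _ => j = k+1 → C m (fam φ)) (motive_2 := fun _ _ _ _ => True)
    ?_ ?_ ?_ ?_ ?_ ?_ hφ rfl
  · intro m φ _ e; cases e
  · intro j m φ hφ _ e
    cases e
    exact h1 _ _ ⟨φ, hφ, fun _ _ _ => Iff.rfl⟩
  · intro j m φ hφ ih e
    cases e
    have := h2 _ _ ⟨φ, hφ, fun _ _ _ => Iff.rfl⟩ (ih rfl)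
    convert this using 1
    unfold fam
    simp only [BoundedFormula.realize_ex]
  all_goals intros; trivial
theorem Pg.elim {k : ℕ} {C : ∀ m, Fam m → Prop} (h1 : ∀ m P, Sg k P → C m P)
    (h2 : ∀ m (P : Fam (m+1)), Pg (k+1) P → C (m+1) P → C m (fun M _ v => ∀ y, P M (Fin.snoc v y)))
    {P : Fam m} (h : Pg (k+1) P) : C m P := by
  obtain ⟨φ, hφ, h⟩ := h
  rw [fam_eq h]; clear h P
  refine IsPiFml.rec (motive_2 := fun j m φ _ => j = k+1 → C m (fam φ)) (motive_1 := fun _ _ _ _ => True)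
    ?_ ?_ ?_ ?_ ?_ ?_ hφ rfl
  case refine_4 => intro m φ _ e; cases e
  case refine_5 =>
    intro j m φ hφ _ e
    cases e
    exact h1 _ _ ⟨φ, hφ, fun _ _ _ => Iff.rfl⟩
  case refine_6 =>
    intro j m φ hφ ih e
    cases e
    have := h2 _ _ ⟨φ, hφ, fun _ _ _ => Iff.rfl⟩ (ih rfl)
    convert this using 1
    unfold fam
    simp only [BoundedFormula.realize_all]
  all_goals intros; trivial

theorem dual (k : ℕ) : (∀ m (P : Fam m), Sg k P → Pg k (fun M _ v => ¬ P M v)) ∧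
    (∀ m (P : Fam m), Pg k P → Sg k (fun M _ v => ¬ P M v)) := by
  induction k with
  | zero => exact ⟨fun m P h => Pg.ofD0 h.toD0.not, fun m P h => Sg.ofD0 h.toD0.not⟩
  | succ k ih =>
    constructor
    · intro m P h
      refine Sg.elim (C := fun m P => Pg (k+1) (fun M _ v => ¬ P M v)) ?_ ?_ h
      · intro m P h; exact Pg.ofSg (ih.2 _ _ h)
      · intro m P _ h
        refine (Pg.all (P := fun M _ v y => ¬ P M (Fin.snoc v y)) (h.of_iff ?_)).of_iff ?_
        · intro M _ v; simp
        · intro M _ v; simp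
    · intro m P h
      refine Pg.elim (C := fun m P => Sg (k+1) (fun M _ v => ¬ P M v)) ?_ ?_ h
      · intro m P h; exact Sg.ofPg (ih.1 _ _ h)
      · intro m P _ h
        refine (Sg.ex (P := fun M _ v y => ¬ P M (Fin.snoc v y)) (h.of_iff ?_)).of_iff ?_
        · intro M _ v; simp
        · intro M _ v; simp
theorem Sg.not {k : ℕ} {P : Fam m} (h : Sg k P) : Pg k (fun M _ v => ¬ P M v) := (dual k).1 _ _ h
theorem Pg.not {k : ℕ} {P : Fam m} (h : Pg k P) : Sg k (fun M _ v => ¬ P M v) := (dual k).2 _ _ h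
theorem Pg.ofNot {k : ℕ} {P : Fam m} (h : Sg k (fun M _ v => ¬ P M v)) : Pg k P :=
  h.not.of_iff fun M _ v => by simp
theorem Sg.ofNot {k : ℕ} {P : Fam m} (h : Pg k (fun M _ v => ¬ P M v)) : Sg k P :=
  h.not.of_iff fun M _ v => by simp

theorem D0.sgpg (k : ℕ) {P : Fam m} (h : D0 P) : Sg k P ∧ Pg k P := by
  induction k with
  | zero => exact ⟨Sg.ofD0 h, Pg.ofD0 h⟩
  | succ k ih => exact ⟨Sg.ofPg ih.2, Pg.ofSg ih.1⟩
theorem D0.sg {k : ℕ} {P : Fam m} (h : D0 P) : Sg k P := (h.sgpg k).1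
theorem D0.pg {k : ℕ} {P : Fam m} (h : D0 P) : Pg k P := (h.sgpg k).2
theorem up (k : ℕ) : (∀ m (P : Fam m), Sg k P → Sg (k+1) P) ∧ (∀ m (P : Fam m), Pg k P → Pg (k+1) P) := by
  induction k with
  | zero => exact ⟨fun m P h => h.toD0.sg, fun m P h => h.toD0.pg⟩
  | succ k ih =>
    constructor
    · intro m P h
      refine Sg.elim (C := fun m P => Sg (k+2) P) ?_ ?_ h
      · intro m P h; exact Sg.ofPg (ih.2 _ _ h)
      · intro m P _ h
        exact Sg.ex (P := fun M _ v y => P M (Fin.snoc v y)) (h.of_iff fun M _ v => by simp)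
    · intro m P h
      refine Pg.elim (C := fun m P => Pg (k+2) P) ?_ ?_ h
      · intro m P h; exact Pg.ofSg (ih.1 _ _ h)
      · intro m P _ h
        exact Pg.all (P := fun M _ v y => P M (Fin.snoc v y)) (h.of_iff fun M _ v => by simp)
theorem Sg.up {k : ℕ} {P : Fam m} (h : Sg k P) : Sg (k+1) P := (Guaspari.up k).1 _ _ h
theorem Pg.up {k : ℕ} {P : Fam m} (h : Pg k P) : Pg (k+1) P := (Guaspari.up k).2 _ _ h

theorem Sg.ff {k : ℕ} {P : Fam m} (h : Sg k P) : FF P := by obtain ⟨φ, _, h⟩ := h; exact ⟨φ, h⟩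
theorem Pg.ff {k : ℕ} {P : Fam m} (h : Pg k P) : FF P := by obtain ⟨φ, _, h⟩ := h; exact ⟨φ, h⟩
theorem D0.ff {P : Fam m} (h : D0 P) : FF P := by obtain ⟨φ, _, h⟩ := h; exact ⟨φ, h⟩

theorem substSP (k : ℕ) : (∀ l (P : Fam l), Sg k P → ∀ m (ts : Fin l → TFam m), (∀ i, Tm (ts i)) →
      Sg k (fun M _ v => P M (fun i => ts i M v))) ∧
    (∀ l (P : Fam l), Pg k P → ∀ m (ts : Fin l → TFam m), (∀ i, Tm (ts i)) →
      Pg k (fun M _ v => P M (fun i => ts i M v))) := by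
  induction k with
  | zero => exact ⟨fun l P h m ts hs => (h.toD0.subst hs).sg, fun l P h m ts hs => (h.toD0.subst hs).pg⟩
  | succ k ih =>
    constructor
    · intro l P h
      refine Sg.elim (C := fun l P => ∀ m (ts : Fin l → TFam m), (∀ i, Tm (ts i)) →
        Sg (k+1) (fun M _ v => P M (fun i => ts i M v))) ?_ ?_ h
      · intro l P h m ts hs; exact Sg.ofPg (ih.2 _ _ h _ _ hs)
      · intro l P _ h m ts hs
        refine Sg.ex (P := fun M _ v y => P M (Fin.snoc (fun i => ts i M v) y : Fin (l+1) → M)) ?_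
        refine (h _ _ (tmSnoc hs)).of_iff fun M _ w => ?_
        apply iff_of_eq; congr 1; funext i
        refine Fin.lastCases ?_ (fun j => ?_) i <;> simp
    · intro l P h
      refine Pg.elim (C := fun l P => ∀ m (ts : Fin l → TFam m), (∀ i, Tm (ts i)) →
        Pg (k+1) (fun M _ v => P M (fun i => ts i M v))) ?_ ?_ h
      · intro l P h m ts hs; exact Pg.ofSg (ih.1 _ _ h _ _ hs)
      · intro l P _ h m ts hs
        refine Pg.all (P := fun M _ v y => P M (Fin.snoc (fun i => ts i M v) y : Fin (l+1) → M)) ?_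
        refine (h _ _ (tmSnoc hs)).of_iff fun M _ w => ?_
        apply iff_of_eq; congr 1; funext i
        refine Fin.lastCases ?_ (fun j => ?_) i <;> simp
theorem Sg.subst {k l : ℕ} {P : Fam l} (h : Sg k P) {m : ℕ} {ts : Fin l → TFam m} (hs : ∀ i, Tm (ts i)) :
    Sg k (fun M _ v => P M (fun i => ts i M v)) := (substSP k).1 _ _ h _ _ hs
theorem Pg.subst {k l : ℕ} {P : Fam l} (h : Pg k P) {m : ℕ} {ts : Fin l → TFam m} (hs : ∀ i, Tm (ts i)) :
    Pg k (fun M _ v => P M (fun i => ts i M v)) := (substSP k).2 _ _ h _ _ hs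

/-! from families to definability with parameters -/
theorem term_df {M : Type} [PAM M] {α : Type} {l : ℕ} (val : α → M) (τ : LA.Term (α ⊕ Fin l)) {m : ℕ} {ts : Fin l → (Fin m → M) → M}
    (hs : ∀ i, Tf (ts i)) : Tf (fun v => τ.realize (Sum.elim val (fun i => ts i v))) := by
  choose σ hσ using hs
  refine ⟨τ.subst (Sum.elim (fun e => Term.var (Sum.inl (val e))) σ), fun v => ?_⟩
  beta_reduce
  rw [Term.realize_subst]
  congr 1
  funext x
  rcases x with x | x
  · rfl
  · simp [hσ]

theorem form_df {M : Type} [PAM M] {α : Type} {l : ℕ} (val : α → M) (φ : LA.BoundedFormula α l) {m : ℕ} {ts : Fin l → (Fin m → M) → M}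
    (hs : ∀ i, Tf (ts i)) : Df (fun v => φ.Realize val (fun i => ts i v)) := by
  induction φ generalizing m with
  | falsum => exact ⟨⊥, fun v => Iff.rfl⟩
  | equal t u => exact Df.eq (term_df val t hs) (term_df val u hs)
  | rel R us =>
    have := fun i => term_df val (us i) hs
    choose σ hσ using this
    refine ⟨BoundedFormula.rel R σ, fun v => ?_⟩
    simp only [BoundedFormula.Realize, hσ]
  | imp _ _ ih1 ih2 => exact (ih1 hs).imp (ih2 hs)
  | @all l φ ih =>
    refine Df.all (P := fun v y => φ.Realize val (Fin.snoc (fun i => ts i v) y : Fin (l+1) → M)) ?_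
    refine (ih (ts := Fin.snoc (α := fun _ => (Fin (m+1) → M) → M) (fun i => fun w => ts i (Fin.init w)) (fun w => w (Fin.last m))) ?_).of_iff ?_
    · intro i
      refine Fin.lastCases ?_ (fun j => ?_) i
      · simpa using Tf.var _
      · obtain ⟨τ, hτ⟩ := hs j
        simp only [Fin.snoc_castSucc]
        refine ⟨τ.relabel (Sum.map id Fin.castSucc), fun v => ?_⟩
        beta_reduce
        rw [hτ, Term.realize_relabel]
        congr 1
        funext x
        rcases x with x | x <;> rfl
    · intro w
      apply iff_of_eq; congr 1; funext i
      refine Fin.lastCases ?_ (fun j => ?_) i <;> simp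

theorem FF.df {M : Type} [PAM M] {l : ℕ} {P : Fam l} (h : FF P) {m : ℕ} {ts : Fin l → (Fin m → M) → M}
    (hs : ∀ i, Tf (ts i)) : Df (fun v => P M (fun i => ts i v)) := by
  obtain ⟨φ, h⟩ := h
  rw [fam_eq h]; exact form_df _ φ hs

theorem Df.subst {M : Type} [PAM M] {l : ℕ} {P : (Fin l → M) → Prop} (h : Df P) {m : ℕ}
    {ts : Fin l → (Fin m → M) → M} (hs : ∀ i, Tf (ts i)) : Df (fun v => P (fun i => ts i v)) := by
  obtain ⟨φ, h⟩ := h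
  exact (form_df id φ hs).of_iff fun v => h _

abbrev Df1 {M : Type} [PAM M] (P : M → Prop) : Prop := Df (fun v : Fin 1 → M => P (v 0))
abbrev Df2 {M : Type} [PAM M] (P : M → M → Prop) : Prop := Df (fun v : Fin 2 → M => P (v 0) (v 1))
theorem Df.app1 {M : Type} [PAM M] {P : M → Prop} (h : Df1 P) {m : ℕ} {t : (Fin m → M) → M} (ht : Tf t) :
    Df (fun v => P (t v)) := Df.subst h (ts := fun _ => t) (fun _ => ht)
theorem Df.app2 {M : Type} [PAM M] {P : M → M → Prop} (h : Df2 P) {m : ℕ} {t u : (Fin m → M) → M}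
    (ht : Tf t) (hu : Tf u) : Df (fun v => P (t v) (u v)) :=
  Df.subst h (ts := ![t, u]) (fun i => by fin_cases i <;> assumption)
theorem Df.ball {M : Type} [PAM M] {m : ℕ} {t : (Fin m → M) → M} {P : (Fin m → M) → M → Prop}
    (ht : Tf (fun w : Fin (m+1) → M => t (Fin.init w)))
    (h : Df (fun w : Fin (m+1) → M => P (Fin.init w) (w (Fin.last m)))) : Df (fun v => ∀ y ≤ t v, P v y) :=
  Df.all (Df.imp (Df.le (Tf.var _) ht) h)
theorem Df.bex {M : Type} [PAM M] {m : ℕ} {t : (Fin m → M) → M} {P : (Fin m → M) → M → Prop}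
    (ht : Tf (fun w : Fin (m+1) → M => t (Fin.init w)))
    (h : Df (fun w : Fin (m+1) → M => P (Fin.init w) (w (Fin.last m)))) : Df (fun v => ∃ y ≤ t v, P v y) :=
  Df.ex (Df.and (Df.le (Tf.var _) ht) h)

end Guaspari

set_option linter.unusedSimpArgs false
set_option linter.unusedVariables false
namespace Guaspari

theorem coll {M : Type} [PAM M] {P : M → M → Prop} (hP : Df2 P) (t : M)
    (h : ∀ x ≤ t, ∃ y, P x y) : ∃ z, ∀ x ≤ t, ∃ y ≤ z, P x y := by
  have key := pind (P := fun t => (∀ x ≤ t, ∃ y, P x y) → ∃ z, ∀ x ≤ t, ∃ y ≤ z, P x y) ?_ ?_ ?_ t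
  · exact key h
  · refine Df.imp (Df.ball (Tf.var _) (Df.ex (hP.app2 (Tf.var _) (Tf.var _))))
      (Df.ex (Df.ball (Tf.var _) (Df.bex (Tf.var _) (hP.app2 (Tf.var _) (Tf.var _)))))
  · intro h
    obtain ⟨y, hy⟩ := h 0 le_rfl
    refine ⟨y, fun x hx => ⟨y, le_rfl, ?_⟩⟩
    rw [nonpos_iff_eq_zero.1 hx]; exact hy
  · intro t ih h
    obtain ⟨z, hz⟩ := ih (fun x hx => h x (hx.trans le_self_add))
    obtain ⟨y, hy⟩ := h (t+1) le_rfl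
    refine ⟨z + y, fun x hx => ?_⟩
    rcases hx.lt_or_eq with h1 | rfl
    · obtain ⟨y', h1, h2⟩ := hz x (lt_succ_iff'.1 h1)
      exact ⟨y', h1.trans le_self_add, h2⟩
    · exact ⟨y, le_add_self, hy⟩

variable {m : ℕ}

/-- data for bounded closure at level `k` -/
structure Clo (k : ℕ) : Prop where
  and : ∀ {m : ℕ} {P Q : Fam m}, Sg k P → Sg k Q → Sg k (fun M _ v => P M v ∧ Q M v)
  or : ∀ {m : ℕ} {P Q : Fam m}, Sg k P → Sg k Q → Sg k (fun M _ v => P M v ∨ Q M v)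
  ball : ∀ {m : ℕ} {t : TFam m} (_ : Tm t) {P : ∀ (M : Type) [PAM M], (Fin m → M) → M → Prop}
    (_ : Sg k (m := m+1) (fun M _ w => P M (Fin.init w) (w (Fin.last m)))),
    Sg k (fun M _ v => ∀ y ≤ t M v, P M v y)
  bex : ∀ {m : ℕ} {t : TFam m} (_ : Tm t) {P : ∀ (M : Type) [PAM M], (Fin m → M) → M → Prop}
    (_ : Sg k (m := m+1) (fun M _ w => P M (Fin.init w) (w (Fin.last m)))),
    Sg k (fun M _ v => ∃ y ≤ t M v, P M v y)

theorem Clo.pand {k : ℕ} (c : Clo k) {P Q : Fam m} (h : Pg k P) (h' : Pg k Q) :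
    Pg k (fun M _ v => P M v ∧ Q M v) :=
  Pg.ofNot ((c.or h.not h'.not).of_iff fun M _ v => by tauto)
theorem Clo.por {k : ℕ} (c : Clo k) {P Q : Fam m} (h : Pg k P) (h' : Pg k Q) :
    Pg k (fun M _ v => P M v ∨ Q M v) :=
  Pg.ofNot ((c.and h.not h'.not).of_iff fun M _ v => by tauto)
theorem Clo.pball {k : ℕ} (c : Clo k) {t : TFam m} (ht : Tm t)
    {P : ∀ (M : Type) [PAM M], (Fin m → M) → M → Prop}
    (h : Pg k (m := m+1) (fun M _ w => P M (Fin.init w) (w (Fin.last m)))) :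
    Pg k (fun M _ v => ∀ y ≤ t M v, P M v y) :=
  Pg.ofNot ((c.bex ht (P := fun M _ v y => ¬ P M v y) h.not).of_iff fun M _ v => by push Not; rfl)
theorem Clo.pbex {k : ℕ} (c : Clo k) {t : TFam m} (ht : Tm t)
    {P : ∀ (M : Type) [PAM M], (Fin m → M) → M → Prop}
    (h : Pg k (m := m+1) (fun M _ w => P M (Fin.init w) (w (Fin.last m)))) :
    Pg k (fun M _ v => ∃ y ≤ t M v, P M v y) :=
  Pg.ofNot ((c.ball ht (P := fun M _ v y => ¬ P M v y) h.not).of_iff fun M _ v => by push Not; rfl)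

theorem nf_of_clo {k : ℕ} (c : Clo k) {m : ℕ} {P : Fam m} (h : Sg (k+1) P) :
    ∃ Q : Fam (m+1), Pg k Q ∧ ∀ (M : Type) [PAM M] (v : Fin m → M), P M v ↔ ∃ y, Q M (Fin.snoc v y) := by
  refine Sg.elim (C := fun m P => ∃ Q : Fam (m+1), Pg k Q ∧
    ∀ (M : Type) [PAM M] (v : Fin m → M), P M v ↔ ∃ y, Q M (Fin.snoc v y)) ?_ ?_ h
  · intro m P h
    refine ⟨fun M _ w => P M (fun i => w i.castSucc), h.subst (ts := fun i M _ w => w i.castSucc) fun i => Tm.var _, ?_⟩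
    intro M _ v
    simp
  · rintro m P _ ⟨Q, hQ, h⟩
    -- P v y ↔ ∃ z, Q (v,y,z)
    refine ⟨fun M _ w => ∃ y ≤ w (Fin.last m), ∃ z ≤ w (Fin.last m), Q M (Fin.snoc (Fin.snoc (Fin.init w) y : Fin (m+1) → M) z),
      ?_, ?_⟩
    · refine c.pbex (t := fun M _ w => w (Fin.last m)) (Tm.var _) (P := fun M _ w y => ∃ z ≤ w (Fin.last m), Q M (Fin.snoc (Fin.snoc (Fin.init w) y : Fin (m+1) → M) z)) ?_
      refine c.pbex (t := fun M _ w => w (Fin.last m).castSucc) (Tm.var _) (P := fun M _ w z => Q M (Fin.snoc (Fin.snoc (Fin.init (Fin.init w)) (w (Fin.last (m+1))) : Fin (m+1) → M) z)) ?_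
      refine (hQ.subst (m := m+3) (ts := Fin.snoc (α := fun _ => TFam (m+3)) (Fin.snoc (α := fun _ => TFam (m+3))
        (fun i M _ w => w i.castSucc.castSucc.castSucc) (fun M _ w => w (Fin.last (m+1)).castSucc)) (fun M _ w => w (Fin.last (m+2)))) ?_).of_iff ?_
      · intro i
        refine Fin.lastCases ?_ (fun j => ?_) i
        · simp only [Fin.snoc_last]; exact Tm.var _
        · refine Fin.lastCases ?_ (fun j => ?_) j
          · simp only [Fin.snoc_castSucc, Fin.snoc_last]; exact Tm.var _
          · simp only [Fin.snoc_castSucc]; exact Tm.var _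
      · intro M _ w
        apply iff_of_eq; congr 1; funext i
        refine Fin.lastCases ?_ (fun j => ?_) i
        · simp
        · refine Fin.lastCases ?_ (fun j => ?_) j
          · simp [Fin.init]
          · simp [Fin.init]
    · intro M _ v
      simp only [h, Fin.snoc_last, Fin.init_snoc]
      constructor
      · rintro ⟨y, z, hq⟩
        exact ⟨y + z, y, le_self_add, z, le_add_self, hq⟩
      · rintro ⟨_, y, _, z, _, hq⟩
        exact ⟨y, z, hq⟩

theorem clo (k : ℕ) : Clo k := by
  induction k with
  | zero =>
    exact ⟨fun h h' => (h.toD0.and h'.toD0).sg, fun h h' => (h.toD0.or h'.toD0).sg,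
      fun ht _ h => (D0.ball ht h.toD0).sg, fun ht _ h => (D0.bex ht h.toD0).sg⟩
  | succ k c =>
    have wk : ∀ {m : ℕ} {Q : Fam (m+1)}, Pg k Q →
        Pg k (fun M _ (w : Fin (m+2) → M) => Q M (Fin.snoc (Fin.init (Fin.init w)) (w (Fin.last m).castSucc))) := by
      intro m Q hQ
      refine (hQ.subst (ts := Fin.snoc (α := fun _ => TFam (m+2)) 
        (fun i M _ w => w i.castSucc.castSucc) (fun M _ w => w (Fin.last m).castSucc)) ?_).of_iff ?_
      · intro i
        refine Fin.lastCases ?_ (fun j => ?_) i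
        · simp only [Fin.snoc_last]; exact Tm.var _
        · simp only [Fin.snoc_castSucc]; exact Tm.var _
      · intro M _ w
        apply iff_of_eq; congr 1; funext i
        refine Fin.lastCases ?_ (fun j => ?_) i
        · simp
        · simp [Fin.init]
    have wk2 : ∀ {m : ℕ} {Q : Fam (m+1)}, Pg k Q →
        Pg k (fun M _ (w : Fin (m+2) → M) => Q M (Fin.snoc (Fin.init (Fin.init w)) (w (Fin.last (m+1))))) := by
      intro m Q hQ
      refine (hQ.subst (ts := Fin.snoc (α := fun _ => TFam (m+2)) 
        (fun i M _ w => w i.castSucc.castSucc) (fun M _ w => w (Fin.last (m+1)))) ?_).of_iff ?_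
      · intro i
        refine Fin.lastCases ?_ (fun j => ?_) i
        · simp only [Fin.snoc_last]; exact Tm.var _
        · simp only [Fin.snoc_castSucc]; exact Tm.var _
      · intro M _ w
        apply iff_of_eq; congr 1; funext i
        refine Fin.lastCases ?_ (fun j => ?_) i
        · simp
        · simp [Fin.init]
    have hand : ∀ {m : ℕ} {P Q : Fam m}, Sg (k+1) P → Sg (k+1) Q → Sg (k+1) (fun M _ v => P M v ∧ Q M v) := by
      intro m P Q hP hQ
      obtain ⟨P', hP', eP⟩ := nf_of_clo c hP
      obtain ⟨Q', hQ', eQ⟩ := nf_of_clo c hQ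
      refine (Sg.ex (P := fun M _ v y => ∃ z, P' M (Fin.snoc v y) ∧ Q' M (Fin.snoc v z)) ?_).of_iff ?_
      · refine Sg.ex (P := fun M _ w z => P' M (Fin.snoc (Fin.init w) (w (Fin.last m))) ∧ Q' M (Fin.snoc (Fin.init w) z)) ?_
        exact Sg.ofPg (c.pand (wk hP') (wk2 hQ'))
      · intro M _ v
        rw [eP, eQ]
        constructor
        · rintro ⟨⟨y, hy⟩, z, hz⟩; exact ⟨y, z, hy, hz⟩
        · rintro ⟨y, z, hy, hz⟩; exact ⟨⟨y, hy⟩, z, hz⟩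
    have hball : ∀ {m : ℕ} {t : TFam m} (_ : Tm t) {P : ∀ (M : Type) [PAM M], (Fin m → M) → M → Prop}
        (_ : Sg (k+1) (m := m+1) (fun M _ w => P M (Fin.init w) (w (Fin.last m)))),
        Sg (k+1) (fun M _ v => ∀ y ≤ t M v, P M v y) := by
      intro m t ht P h
      obtain ⟨Q, hQ, e⟩ := nf_of_clo c h
      refine (Sg.ex (P := fun M _ v z => ∀ x ≤ t M v, ∃ y ≤ z, Q M (Fin.snoc (Fin.snoc v x : Fin (m+1) → M) y)) ?_).of_iff ?_
      · apply Sg.ofPg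
        refine c.pball (t := fun M _ w => t M (Fin.init w)) (ht.subst (ts := fun i M _ w => w i.castSucc) fun i => Tm.var _) (P := fun M _ w x => ∃ y ≤ w (Fin.last m), Q M (Fin.snoc (Fin.snoc (Fin.init w) x : Fin (m+1) → M) y)) ?_
        refine c.pbex (t := fun M _ w => w (Fin.last m).castSucc) (Tm.var _) (P := fun M _ w y => Q M (Fin.snoc (Fin.snoc (Fin.init (Fin.init w)) (w (Fin.last (m+1))) : Fin (m+1) → M) y)) ?_
        refine (hQ.subst (m := m+3) (ts := Fin.snoc (α := fun _ => TFam (m+3)) (Fin.snoc (α := fun _ => TFam (m+3))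
          (fun i M _ w => w i.castSucc.castSucc.castSucc) (fun M _ w => w (Fin.last (m+1)).castSucc)) (fun M _ w => w (Fin.last (m+2)))) ?_).of_iff ?_
        · intro i
          refine Fin.lastCases ?_ (fun j => ?_) i
          · simp only [Fin.snoc_last]; exact Tm.var _
          · refine Fin.lastCases ?_ (fun j => ?_) j
            · simp only [Fin.snoc_castSucc, Fin.snoc_last]; exact Tm.var _
            · simp only [Fin.snoc_castSucc]; exact Tm.var _
        · intro M _ w
          apply iff_of_eq; congr 1; funext i
          refine Fin.lastCases ?_ (fun j => ?_) i
          · simp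
          · refine Fin.lastCases ?_ (fun j => ?_) j
            · simp [Fin.init]
            · simp [Fin.init]
      · intro M _ v
        have e' : ∀ x, P M v x ↔ ∃ y, Q M (Fin.snoc (Fin.snoc v x : Fin (m+1) → M) y) := by
          intro x
          rw [← e]; simp
        constructor
        · intro h
          refine coll (P := fun x y => Q M (Fin.snoc (Fin.snoc v x : Fin (m+1) → M) y)) ?_ _ (fun x hx => (e' x).1 (h x hx))
          refine (hQ.ff.df (ts := Fin.snoc (α := fun _ => (Fin 2 → M) → M) (Fin.snoc (α := fun _ => (Fin 2 → M) → M)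
            (fun i _ => v i) (fun w => w 0)) (fun w => w 1)) ?_).of_iff ?_
          · intro i
            refine Fin.lastCases ?_ (fun j => ?_) i
            · simp only [Fin.snoc_last]; exact Tf.var _
            · refine Fin.lastCases ?_ (fun j => ?_) j
              · simp only [Fin.snoc_castSucc, Fin.snoc_last]; exact Tf.var _
              · simp only [Fin.snoc_castSucc]; exact Tf.const _
          · intro w
            beta_reduce
            apply iff_of_eq; congr 1; funext i
            refine Fin.lastCases ?_ (fun j => ?_) i
            · simp
            · refine Fin.lastCases ?_ (fun j => ?_) j
              · simp
              · simp
        · rintro ⟨z, hz⟩ x hx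
          obtain ⟨y, _, h⟩ := hz x hx
          exact (e' x).2 ⟨y, h⟩
    refine ⟨hand, ?_, hball, ?_⟩
    · intro m P Q hP hQ
      obtain ⟨P', hP', eP⟩ := nf_of_clo c hP
      obtain ⟨Q', hQ', eQ⟩ := nf_of_clo c hQ
      refine (Sg.ex (P := fun M _ v y => P' M (Fin.snoc v y) ∨ Q' M (Fin.snoc v y)) ?_).of_iff ?_
      · simp only [Fin.snoc_init_self]
        exact Sg.ofPg (c.por hP' hQ')
      · intro M _ v
        rw [eP, eQ, exists_or]
    · intro m t ht P h
      refine Sg.ex (P := fun M _ v y => y ≤ t M v ∧ P M v y) ?_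
      refine hand (D0.le (Tm.var _) ?_).sg h
      exact ht.subst (ts := fun i M _ w => w i.castSucc) fun i => Tm.var _

theorem Sg.and {k : ℕ} {P Q : Fam m} (h : Sg k P) (h' : Sg k Q) : Sg k (fun M _ v => P M v ∧ Q M v) :=
  (clo k).and h h'
theorem Sg.or {k : ℕ} {P Q : Fam m} (h : Sg k P) (h' : Sg k Q) : Sg k (fun M _ v => P M v ∨ Q M v) :=
  (clo k).or h h'
theorem Pg.and {k : ℕ} {P Q : Fam m} (h : Pg k P) (h' : Pg k Q) : Pg k (fun M _ v => P M v ∧ Q M v) :=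
  (clo k).pand h h'
theorem Pg.or {k : ℕ} {P Q : Fam m} (h : Pg k P) (h' : Pg k Q) : Pg k (fun M _ v => P M v ∨ Q M v) :=
  (clo k).por h h'
theorem Sg.ball {k : ℕ} {t : TFam m} (ht : Tm t)
    {P : ∀ (M : Type) [PAM M], (Fin m → M) → M → Prop}
    (h : Sg k (m := m+1) (fun M _ w => P M (Fin.init w) (w (Fin.last m)))) :
    Sg k (fun M _ v => ∀ y ≤ t M v, P M v y) := (clo k).ball ht h
theorem Sg.bex {k : ℕ} {t : TFam m} (ht : Tm t)
    {P : ∀ (M : Type) [PAM M], (Fin m → M) → M → Prop}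
    (h : Sg k (m := m+1) (fun M _ w => P M (Fin.init w) (w (Fin.last m)))) :
    Sg k (fun M _ v => ∃ y ≤ t M v, P M v y) := (clo k).bex ht h
theorem Sg.nf {k : ℕ} {P : Fam m} (h : Sg (k+1) P) :
    ∃ Q : Fam (m+1), Pg k Q ∧ ∀ (M : Type) [PAM M] (v : Fin m → M), P M v ↔ ∃ y, Q M (Fin.snoc v y) :=
  nf_of_clo (clo k) h

end Guaspari

set_option linter.unusedSimpArgs false
set_option linter.unusedVariables false
namespace Guaspari

/-! ## The standard model -/
structure NS : Type where
  mk ::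
  val : ℕ

instance : LA.Structure NS where
  funMap := fun {n} f v => match n, f, v with
    | 0, _, _ => NS.mk 0
    | 1, _, v => NS.mk (NS.val (v 0) + 1)
    | 2, false, v => NS.mk (NS.val (v 0) + NS.val (v 1))
    | 2, true, v => NS.mk (NS.val (v 0) * NS.val (v 1))
    | (_ + 3), f, _ => nomatch f
  RelMap := fun {n} R v => match n, R, v with
    | 2, _, v => NS.val (v 0) ≤ NS.val (v 1)
    | 0, R, _ => nomatch R
    | 1, R, _ => nomatch R
    | (_ + 3), R, _ => nomatch R

theorem ns_Z : opZ NS = NS.mk 0 := rfl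
theorem ns_S (x : NS) : opS x = NS.mk (x.val + 1) := rfl
theorem ns_A (x y : NS) : opA x y = NS.mk (x.val + y.val) := rfl
theorem ns_M (x y : NS) : opM x y = NS.mk (x.val * y.val) := rfl
theorem ns_L (x y : NS) : opL x y ↔ x.val ≤ y.val := Iff.rfl

instance nsPAM : PAM NS where
  models := by
    refine ⟨fun φ hφ => ?_⟩
    rcases hφ with hφ | ⟨k, ψ, rfl⟩
    · simp only [Set.mem_insert_iff, Set.mem_singleton_iff] at hφ
      rcases hφ with rfl | rfl | rfl | rfl | rfl | rfl | rfl <;>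
        simp only [Sentence.Realize, Formula.Realize, BoundedFormula.realize_all, BoundedFormula.realize_iff,
          BoundedFormula.realize_ex, rz_leF, BoundedFormula.realize_not, BoundedFormula.realize_imp,
          BoundedFormula.realize_bdEqual, rz_succT, rz_addT, rz_mulT, rz_vT, rz_zeroT]
      · intro x h; exact Nat.succ_ne_zero _ (congrArg NS.val h)
      · intro x y h; exact congrArg NS.mk (Nat.succ_injective (congrArg NS.val h))
      · intro x; rfl
      · intro x y; rfl
      · intro x; rfl
      · intro x y; rfl
      · intro x y
        rw [ns_L]
        constructor
        · intro h
          exact ⟨NS.mk (NS.val y - NS.val x), congrArg NS.mk (Nat.sub_add_cancel h)⟩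
        · rintro ⟨z, hz⟩
          have : (NS.val z) + NS.val x = NS.val y := congrArg NS.val hz
          exact this ▸ Nat.le_add_left _ _
    · unfold indAxiom
      simp only [Sentence.Realize, BoundedFormula.realize_alls]
      intro p
      simp only [BoundedFormula.realize_imp, BoundedFormula.realize_inf, BoundedFormula.realize_all,
        BoundedFormula.realize_bdEqual, rz_zeroT, rz_succT, rz_vT]
      rintro ⟨h0, hs⟩ x
      have : ∀ n : ℕ, ψ.Realize default (Fin.snoc p (NS.mk n) : Fin (k+1) → NS) := by
        intro n
        induction n with
        | zero => exact h0 _ (by simp; rfl)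
        | succ n ih =>
          have := hs _ ih (NS.mk (n+1)) (by simp only [Fin.snoc_last, Fin.snoc_castSucc]; rfl)
          rw [BoundedFormula.realize_liftAt_one (by omega)] at this
          convert this using 1
          funext i
          refine Fin.lastCases ?_ (fun j => ?_) i
          · simp [Fin.snoc]
          · simp [Fin.snoc]
      exact this x.val

theorem ns_cast (n : ℕ) : (n : NS) = NS.mk n := by
  induction n with
  | zero => rw [Nat.cast_zero]; rfl
  | succ n ih => rw [Nat.cast_succ, ih]; rfl
theorem ns_surj (x : NS) : x = ((NS.val x : ℕ) : NS) := by rw [ns_cast]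

/-! ## Initial segment -/
section
variable {M : Type} [PAM M]

theorem cast_seg {n : ℕ} {x : M} (h : x ≤ (n : M)) : ∃ k ≤ n, x = (k : M) := by
  induction n with
  | zero => exact ⟨0, le_rfl, by simpa using h⟩
  | succ n ih =>
    rcases h.lt_or_eq with h | rfl
    · rw [Nat.cast_succ, lt_succ_iff'] at h
      obtain ⟨k, hk, e⟩ := ih h
      exact ⟨k, by omega, e⟩
    · exact ⟨n+1, le_rfl, rfl⟩

end

theorem term_abs {m : ℕ} (τ : LA.Term (Empty ⊕ Fin m)) (v : Fin m → ℕ) :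
    ∃ k : ℕ, ∀ (M : Type) [PAM M], τ.realize (Sum.elim (default : Empty → M) (fun i => (v i : M))) = (k : M) := by
  induction τ with
  | var x =>
    rcases x with x | x
    · exact x.elim
    · exact ⟨v x, fun M _ => rfl⟩
  | @func l f ts ih =>
    choose k hk using ih
    match l, f, ts, k, hk with
    | 0, f, ts, k, hk =>
      refine ⟨0, fun M _ => ?_⟩
      rw [Nat.cast_zero]
      exact congrArg (Structure.funMap (L := LA) f) (Subsingleton.elim _ _)
    | 1, f, ts, k, hk =>
      refine ⟨k 0 + 1, fun M _ => ?_⟩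
      rw [Nat.cast_succ, ← hk 0 M, ← opS_eq]
      refine congrArg (Structure.funMap (L := LA) f) ?_
      funext i; fin_cases i; rfl
    | 2, false, ts, k, hk =>
      refine ⟨k 0 + k 1, fun M _ => ?_⟩
      rw [Nat.cast_add, ← hk 0 M, ← hk 1 M]
      refine congrArg (Structure.funMap (L := LA) (n := 2) false) ?_
      funext i; fin_cases i <;> rfl
    | 2, true, ts, k, hk =>
      refine ⟨k 0 * k 1, fun M _ => ?_⟩
      rw [Nat.cast_mul, ← hk 0 M, ← hk 1 M]
      refine congrArg (Structure.funMap (L := LA) (n := 2) true) ?_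
      funext i; fin_cases i <;> rfl
    | (_ + 3), f, _, _, _ => exact nomatch f

theorem snoc_cast {m : ℕ} {M : Type} [PAM M] (v : Fin m → ℕ) (j : ℕ) :
    (Fin.snoc (fun i => (v i : M)) (j : M) : Fin (m+1) → M) = fun i => ((Fin.snoc v j : Fin (m+1) → ℕ) i : M) := by
  funext i
  refine Fin.lastCases ?_ (fun j => ?_) i <;> simp

theorem D0.abs {m : ℕ} {P : Fam m} (h : D0 P) (v : Fin m → ℕ) :
    ∃ b : Prop, ∀ (M : Type) [PAM M], P M (fun i => (v i : M)) ↔ b := by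
  obtain ⟨φ, hφ, h⟩ := h
  rw [fam_eq h]; clear h P; unfold fam
  induction hφ with
  | falsum => exact ⟨False, fun M _ => Iff.rfl⟩
  | equal t u =>
    obtain ⟨k, hk⟩ := term_abs t v
    obtain ⟨l, hl⟩ := term_abs u v
    refine ⟨k = l, fun M _ => ?_⟩
    rw [BoundedFormula.realize_bdEqual, hk, hl]
    exact Nat.cast_inj (R := M)
  | le t u =>
    obtain ⟨k, hk⟩ := term_abs t v
    obtain ⟨l, hl⟩ := term_abs u v
    refine ⟨k ≤ l, fun M _ => ?_⟩
    rw [rz_leF, hk, hl, opL_eq]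
    exact Nat.cast_le (α := M)
  | imp _ _ ih1 ih2 =>
    obtain ⟨b, hb⟩ := ih1 v
    obtain ⟨c, hc⟩ := ih2 v
    exact ⟨b → c, fun M _ => by rw [BoundedFormula.realize_imp, hb, hc]⟩
  | ball t _ ih =>
    obtain ⟨k, hk⟩ := term_abs t v
    choose b hb using fun j => ih (Fin.snoc v j)
    refine ⟨∀ j ≤ k, b j, fun M _ => ?_⟩
    simp only [BoundedFormula.realize_all, BoundedFormula.realize_imp, rz_leF, rz_vT, realize_weaken,
        opL_eq, Fin.snoc_last, hk]
    constructor
    · intro h j hj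
      rw [← hb j M, ← snoc_cast]
      exact h j (Nat.cast_le.2 hj)
    · intro h x hx
      obtain ⟨j, hj, rfl⟩ := cast_seg hx
      rw [snoc_cast, hb j M]
      exact h j hj
  | bex t _ ih =>
    obtain ⟨k, hk⟩ := term_abs t v
    choose b hb using fun j => ih (Fin.snoc v j)
    refine ⟨∃ j ≤ k, b j, fun M _ => ?_⟩
    simp only [BoundedFormula.realize_ex, BoundedFormula.realize_inf, rz_leF, rz_vT, realize_weaken,
        opL_eq, Fin.snoc_last, hk]
    constructor
    · rintro ⟨x, hx, h⟩
      obtain ⟨j, hj, rfl⟩ := cast_seg hx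
      rw [snoc_cast, hb j M] at h
      exact ⟨j, hj, h⟩
    · rintro ⟨j, hj, h⟩
      refine ⟨j, Nat.cast_le.2 hj, ?_⟩
      rwa [snoc_cast, hb j M]

theorem D0.absNS {m : ℕ} {P : Fam m} (h : D0 P) (v : Fin m → ℕ) (M : Type) [PAM M] :
    P M (fun i => (v i : M)) ↔ P NS (fun i => (v i : NS)) := by
  obtain ⟨b, hb⟩ := h.abs v
  rw [hb, hb]

/-! ## Pairing -/
def pr {R : Type} [CommSemiring R] (x y : R) : R := (x + y) * (x + y) + x
theorem cast_pr {R : Type} [CommSemiring R] (a b : ℕ) : ((pr a b : ℕ) : R) = pr (a : R) (b : R) := by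
  simp [pr]

section
variable {M : Type} [PAM M]
theorem le_sq (x : M) : x ≤ x * x := by
  rcases zero_or_succ x with rfl | ⟨y, rfl⟩
  · rw [opZ_eq]; simp
  · rw [opS_eq]
    have : (y+1)*(y+1) = (y+1) + y*(y+1) := by ring
    rw [this]; exact le_self_add
theorem le_pr_left (x y : M) : x ≤ pr x y := le_add_self
theorem le_pr_right (x y : M) : y ≤ pr x y :=
  (le_add_self.trans (le_sq (x + y))).trans le_self_add
theorem pr_mono {x y x' y' : M} (h : x ≤ x') (h' : y ≤ y') : pr x y ≤ pr x' y' := by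
  unfold pr; gcongr
theorem pr_aux {x y x' y' : M} (h : pr x y = pr x' y') : ¬ x + y < x' + y' := by
  intro hl
  have h1 := succ_le_iff'.2 hl
  have h2 : (x + y + 1) * (x + y + 1) ≤ (x' + y') * (x' + y') := by gcongr
  have h3 : (x' + y') * (x' + y') ≤ pr x' y' := le_self_add
  have h4 : pr x y + 1 ≤ (x + y + 1) * (x + y + 1) := by
    have : (x + y + 1) * (x + y + 1) = pr x y + 1 + (x + y + y) := by unfold pr; ring
    rw [this]; exact le_self_add
  have := succ_le_iff'.1 ((h4.trans h2).trans h3)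
  rw [h] at this; exact lt_irrefl _ this
theorem pr_inj {x y x' y' : M} (h : pr x y = pr x' y') : x = x' ∧ y = y' := by
  have e : x + y = x' + y' := le_antisymm (not_lt.1 (pr_aux h.symm)) (not_lt.1 (pr_aux h))
  have e1 : x = x' := by
    unfold pr at h; rw [e] at h; exact add_left_cancel h
  subst e1
  exact ⟨rfl, add_left_cancel e⟩
@[simp] theorem pr_iff {x y x' y' : M} : pr x y = pr x' y' ↔ x = x' ∧ y = y' :=
  ⟨pr_inj, fun h => by rw [h.1, h.2]⟩
theorem Tf.pr {n : ℕ} {t u : (Fin n → M) → M} (h : Tf t) (h' : Tf u) : Tf (fun v => pr (t v) (u v)) :=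
  ((h.add h').mul (h.add h')).add h
end
theorem Tm.pr {m : ℕ} {t u : TFam m} (h : Tm t) (h' : Tm u) : Tm (fun M _ v => pr (t M v) (u M v)) :=
  ((h.add h').mul (h.add h')).add h

/-! ## Coded sets -/
section
variable {M : Type} [PAM M]

def qq (b z : M) : M := 1 + (z + 1) * b
def El (a b N z : M) : Prop := z ≤ N ∧ ∃ c ≤ a, a = qq b z * c

theorem dvd_cancel {q a c : M} (h : q ∣ a + c) (h' : q ∣ a) : q ∣ c := by
  obtain ⟨u, rfl⟩ := h'
  obtain ⟨v, hv⟩ := h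
  rcases le_total u v with h | h
  · obtain ⟨z, rfl⟩ := exists_add_of_le h
    rw [mul_add] at hv
    exact ⟨z, add_left_cancel hv⟩
  · obtain ⟨z, rfl⟩ := exists_add_of_le h
    have : q * z + c = 0 := by
      apply add_left_cancel (a := q * v)
      calc q*v+(q*z+c) = q*(v+z)+c := by ring
        _ = q*v + 0 := by rw [hv, add_zero]
    rw [add_eq_zero] at this
    rw [this.2]; exact dvd_zero _

theorem cop_qq {b x i w d : M} (hd : x = i + d ∨ i = x + d) (hb : d ∣ b) (h : qq b x ∣ qq b i * w) :
    qq b x ∣ w := by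
  have h1 : qq b x ∣ d * w := by
    rcases hd with rfl | rfl
    · refine dvd_cancel (a := qq b (i + d) * ((i + 1) * w)) ?_ (dvd_mul_right _ _)
      have : qq b (i+d) * ((i+1)*w) + d * w = qq b i * w * (i + d + 1) := by unfold qq; ring
      rw [this]; exact h.mul_right _
    · refine dvd_cancel (a := qq b (x + d) * w * (x + 1)) ?_ (h.mul_right _)
      have : qq b (x+d) * w * (x+1) + d * w = qq b x * (w * (x + d + 1)) := by unfold qq; ring
      rw [this]; exact dvd_mul_right _ _
  obtain ⟨e, rfl⟩ := hb
  refine dvd_cancel (a := (d * w) * (e * (x + 1))) ?_ (h1.mul_right _)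
  have : d * w * (e * (x+1)) + w = qq (d * e) x * w := by unfold qq; ring
  rw [this]; exact dvd_mul_right _ _

theorem Df.dvd {n : ℕ} {t u : (Fin n → M) → M} (h : Tf (fun w : Fin (n+1) → M => t (Fin.init w))) (h' : Tf (fun w : Fin (n+1) → M => u (Fin.init w))) :
    Df (fun v => t v ∣ u v) :=
  Df.ex (P := fun v c => u v = t v * c) (Df.eq h' (h.mul (Tf.var _)))

theorem exists_lcm (N : M) : ∃ b : M, b ≠ 0 ∧ ∀ d ≤ N, d ≠ 0 → d ∣ b := by
  refine pind (P := fun N => ∃ b : M, b ≠ 0 ∧ ∀ d ≤ N, d ≠ 0 → d ∣ b) ?_ ?_ ?_ N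
  · exact Df.ex (Df.and (Df.not (Df.eq (Tf.var _) Tf.zero)) (Df.ball (Tf.var _)
      (Df.imp (Df.not (Df.eq (Tf.var _) Tf.zero)) (Df.dvd (Tf.var _) (Tf.var _)))))
  · exact ⟨1, one_ne_zero, fun d hd h => absurd (nonpos_iff_eq_zero.1 hd) h⟩
  · rintro N ⟨b, hb, h⟩
    refine ⟨b * (N + 1), mul_ne_zero hb (by simp), fun d hd h0 => ?_⟩
    rcases hd.lt_or_eq with h1 | rfl
    · exact (h d (lt_succ_iff'.1 h1) h0).mul_right _
    · exact dvd_mul_left _ _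

theorem set_exists {A : M → Prop} (hA : Df1 A) (N : M) : ∃ a b, ∀ z, El a b N z ↔ z ≤ N ∧ A z := by
  obtain ⟨b, hb, hd⟩ := exists_lcm N
  have key := pind (P := fun i => ∃ a : M, ∀ x ≤ N, (qq b x ∣ a ↔ A x ∧ x < i)) ?_ ?_ ?_ (N + 1)
  · obtain ⟨a, ha⟩ := key
    refine ⟨a, b, fun z => ?_⟩
    unfold El
    refine and_congr_right fun hz => ?_
    have h1 := ha z hz
    have h2 : z < N + 1 := lt_succ_iff'.2 hz
    simp only [h2, and_true] at h1
    rw [← h1]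
    constructor
    · rintro ⟨c, _, h⟩; exact ⟨c, h⟩
    · rintro ⟨c, h⟩
      refine ⟨c, ?_, h⟩
      have : a = c + (z + 1) * b * c := by rw [h]; unfold qq; ring
      rw [this]; exact le_self_add
  · exact Df.ex (Df.ball (Tf.const _) (Df.iff (Df.dvd (t := fun w => qq b (w _)) (Tf.one.add (((Tf.var _).add Tf.one).mul (Tf.const _))) (Tf.var _))
      (Df.and (hA.app1 (Tf.var _)) (Df.lt (Tf.var _) (Tf.var _)))))
  · refine ⟨1, fun x hx => ?_⟩
    simp only [not_lt_zero, and_false, iff_false]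
    rintro ⟨c, hc⟩
    have h1 : c ≠ 0 := by rintro rfl; simp at hc
    have h2 : (c = 1 ∧ b = 0) ∨ True := Or.inr trivial
    have h3 : 1 ≤ c := by rw [← not_lt, ← zero_add (1:M), lt_succ_iff', nonpos_iff_eq_zero]; exact h1
    have h4 : (1:M) ≤ b := by rw [← not_lt, ← zero_add (1:M), lt_succ_iff', nonpos_iff_eq_zero]; exact hb
    obtain ⟨c', rfl⟩ := exists_add_of_le h3
    obtain ⟨b', rfl⟩ := exists_add_of_le h4
    have : (1:M) < qq (1 + b') x * (1 + c') := by
      refine pam_lt.2 ⟨qq (1+b') x * c' + (b' + x * (1+b')), ?_⟩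
      unfold qq; ring
    rw [← hc] at this; exact lt_irrefl _ this
  · rintro i ⟨a, ha⟩
    by_cases hi : A i ∧ i ≤ N
    · refine ⟨qq b i * a, fun x hx => ?_⟩
      by_cases e : x = i
      · subst e
        simp only [dvd_mul_right, hi.1, true_and, true_iff, lt_succ_iff', le_refl]
      · have h1 : qq b x ∣ qq b i * a ↔ qq b x ∣ a := by
          refine ⟨fun h => ?_, fun h => h.mul_left _⟩
          rcases le_total i x with h' | h'
          · obtain ⟨d, rfl⟩ := exists_add_of_le h'
            refine cop_qq (d := d) (Or.inl rfl) (hd d (le_add_self.trans hx) ?_) h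
            rintro rfl; exact e (add_zero _)
          · obtain ⟨d, rfl⟩ := exists_add_of_le h'
            refine cop_qq (d := d) (Or.inr rfl) (hd d (le_add_self.trans hi.2) ?_) h
            rintro rfl; exact e (add_zero _).symm
        rw [h1, ha x hx, lt_succ_iff', le_iff_lt_or_eq]
        simp [e]
    · refine ⟨a, fun x hx => ?_⟩
      rw [ha x hx, lt_succ_iff', le_iff_lt_or_eq]
      constructor
      · rintro ⟨h, h'⟩; exact ⟨h, Or.inl h'⟩
      · rintro ⟨h, h' | rfl⟩
        · exact ⟨h, h'⟩
        · exact absurd ⟨h, hx⟩ hi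

theorem Df.el {n : ℕ} {t u w z : (Fin n → M) → M} (ht : Tf t) (hu : Tf u) (hw : Tf w) (hz : Tf z) :
    Df (fun v => El (t v) (u v) (w v) (z v)) := by
  have h : Df (fun v : Fin 4 → M => El (v 0) (v 1) (v 2) (v 3)) := by
    unfold El qq
    exact Df.and (Df.le (Tf.var _) (Tf.var _)) (Df.bex (Tf.var _)
      (Df.eq (Tf.var _) ((Tf.one.add (((Tf.var _).add Tf.one).mul (Tf.var _))).mul (Tf.var _))))
  exact Df.subst h (ts := ![t, u, w, z]) (fun i => by fin_cases i <;> assumption)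

/-- functional definable relations are bounded on bounded sets -/
theorem bddfun {P : M → M → Prop} (hP : Df2 P) (hf : ∀ x y y', P x y → P x y' → y = y') (t : M) :
    ∃ z, ∀ x ≤ t, ∀ y, P x y → y ≤ z := by
  have key := coll (P := fun x y => P x y ∨ ((∀ y', ¬ P x y') ∧ y = 0)) ?_ t ?_
  · obtain ⟨z, hz⟩ := key
    refine ⟨z, fun x hx y hy => ?_⟩
    obtain ⟨y', h1, h2 | ⟨h2, _⟩⟩ := hz x hx
    · rw [hf x y y' hy h2]; exact h1
    · exact absurd hy (h2 y)
  · exact Df.or (hP.app2 (Tf.var _) (Tf.var _)) (Df.and (Df.all (Df.not (hP.app2 (Tf.var _) (Tf.var _)))) (Df.eq (Tf.var _) Tf.zero))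
  · intro x _
    by_cases h : ∃ y, P x y
    · obtain ⟨y, hy⟩ := h; exact ⟨y, Or.inl hy⟩
    · push Not at h; exact ⟨0, Or.inr ⟨h, rfl⟩⟩
end

theorem D0.el {m : ℕ} {t u w z : TFam m} (ht : Tm t) (hu : Tm u) (hw : Tm w) (hz : Tm z) :
    D0 (fun M _ v => El (t M v) (u M v) (w M v) (z M v)) := by
  have h : D0 (m := 4) (fun M _ v => El (v 0) (v 1) (v 2) (v 3)) := by
    unfold El qq
    exact D0.and (D0.le (Tm.var _) (Tm.var _)) (D0.bex (Tm.var _)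
      (D0.eq (Tm.var _) ((Tm.one.add (((Tm.var _).add Tm.one).mul (Tm.var _))).mul (Tm.var _))))
  exact D0.subst h (ts := ![t, u, w, z]) (fun i => by fin_cases i <;> assumption)

end Guaspari

set_option linter.unusedSimpArgs false
set_option linter.unusedVariables false
namespace Guaspari

/-! ## Programs and the universal formula -/
inductive Prog : Type
  | id : Prog
  | ball (p q : Prog) : Prog
  | bin (j : ℕ) (p q : Prog) : Prog

def Prog.code : Prog → ℕ
  | .id => 0
  | .ball p q => pr 1 (pr p.code q.code)
  | .bin j p q => pr (j + 1 + 1) (pr p.code q.code)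

section
variable {M : Type} [PAM M]

def Op (j u v y : M) : Prop :=
  (j = ((0:ℕ):M) ∧ y = u + 1) ∨ (j = ((1:ℕ):M) ∧ y = u + v) ∨ (j = ((2:ℕ):M) ∧ y = u * v) ∨
  (j = ((3:ℕ):M) ∧ ((u ≤ v ∧ y = 1) ∨ (¬ u ≤ v ∧ y = 0))) ∨
  (j = ((4:ℕ):M) ∧ ∃ z ≤ u, u = pr y z) ∨ (j = ((5:ℕ):M) ∧ ∃ z ≤ u, u = pr z y) ∨ (j = ((6:ℕ):M) ∧ y = 0)

theorem Op.fn {j : ℕ} {u v y y' : M} (h : Op (j:M) u v y) (h' : Op (j:M) u v y') : y = y' := by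
  unfold Op at h h'
  simp only [Nat.cast_inj] at h h'
  rcases h with ⟨h, e⟩ | ⟨h, e⟩ | ⟨h, e⟩ | ⟨h, e⟩ | ⟨h, e⟩ | ⟨h, e⟩ | ⟨h, e⟩ <;> subst h <;> simp at h'
  · rw [e, h']
  · rw [e, h']
  · rw [e, h']
  · by_cases huv : u ≤ v
    · simp [huv, not_lt.2 huv] at e h'; rw [e, h']
    · have := not_le.1 huv
      simp [huv, this] at e h'; rw [e, h']
  · obtain ⟨z, _, e⟩ := e; obtain ⟨z', _, e'⟩ := h'
    rw [e] at e'; exact (pr_inj e').1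
  · obtain ⟨z, _, e⟩ := e; obtain ⟨z', _, e'⟩ := h'
    rw [e] at e'; exact (pr_inj e').2
  · rw [e, h']

def Ev : Prog → M → M → Prop
  | .id, x, y => y = x
  | .ball p q, x, y => ∃ b, Ev p x b ∧ ((y = 1 ∧ ∀ z ≤ b, Ev q (pr z x) 1) ∨ (y = 0 ∧ ∃ z ≤ b, Ev q (pr z x) 0))
  | .bin j p q, x, y => ∃ u v, Ev p x u ∧ Ev q x v ∧ Op (j : M) u v y

theorem Ev.fn (p : Prog) : ∀ {x y y' : M}, Ev p x y → Ev p x y' → y = y' := by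
  induction p with
  | id => intro x y y' h h'; exact h.trans h'.symm
  | ball p q ihp ihq =>
    rintro x y y' ⟨b, hb, h⟩ ⟨b', hb', h'⟩
    obtain rfl := ihp hb hb'
    rcases h with ⟨rfl, h⟩ | ⟨rfl, z, hz, h⟩ <;> rcases h' with ⟨rfl, h'⟩ | ⟨rfl, z', hz', h'⟩
    · rfl
    · exact ihq (h _ hz') h'
    · exact ihq h (h' _ hz)
    · rfl
  | bin j p q ihp ihq =>
    rintro x y y' ⟨u, v, hu, hv, h⟩ ⟨u', v', hu', hv', h'⟩
    obtain rfl := ihp hu hu'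
    obtain rfl := ihq hv hv'
    exact h.fn h'

end

theorem D0.op {m : ℕ} {t u w z : TFam m} (ht : Tm t) (hu : Tm u) (hw : Tm w) (hz : Tm z) :
    D0 (fun M _ v => Op (t M v) (u M v) (w M v) (z M v)) := by
  have h : D0 (m := 4) (fun M _ v => Op (v 0) (v 1) (v 2) (v 3)) := by
    unfold Op
    exact ((D0.eq (Tm.var _) (Tm.cast _)).and (D0.eq (Tm.var _) ((Tm.var _).add Tm.one))).or
      (((D0.eq (Tm.var _) (Tm.cast _)).and (D0.eq (Tm.var _) ((Tm.var _).add (Tm.var _)))).or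
      (((D0.eq (Tm.var _) (Tm.cast _)).and (D0.eq (Tm.var _) ((Tm.var _).mul (Tm.var _)))).or
      (((D0.eq (Tm.var _) (Tm.cast _)).and (((D0.le (Tm.var _) (Tm.var _)).and (D0.eq (Tm.var _) Tm.one)).or ((D0.le (Tm.var _) (Tm.var _)).not.and (D0.eq (Tm.var _) Tm.zero)))).or
      (((D0.eq (Tm.var _) (Tm.cast _)).and (D0.bex (Tm.var _) (D0.eq (Tm.var _) (Tm.pr (Tm.var _) (Tm.var _))))).or
      (((D0.eq (Tm.var _) (Tm.cast _)).and (D0.bex (Tm.var _) (D0.eq (Tm.var _) (Tm.pr (Tm.var _) (Tm.var _))))).or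
      ((D0.eq (Tm.var _) (Tm.cast _)).and (D0.eq (Tm.var _) Tm.zero)))))))
  exact D0.subst h (ts := ![t, u, w, z]) (fun i => by fin_cases i <;> assumption)

theorem FF.op : FF (m := 4) (fun M _ v => Op (v 0) (v 1) (v 2) (v 3)) :=
  (D0.op (Tm.var _) (Tm.var _) (Tm.var _) (Tm.var _)).ff

section
variable {M : Type} [PAM M]

theorem Df.op {n : ℕ} {t u w z : (Fin n → M) → M} (ht : Tf t) (hu : Tf u) (hw : Tf w) (hz : Tf z) :
    Df (fun v => Op (t v) (u v) (w v) (z v)) :=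
  FF.df FF.op (ts := ![t, u, w, z]) (fun i => by fin_cases i <;> assumption)

theorem Ev.df (p : Prog) : Df2 (fun x y : M => Ev p x y) := by
  induction p with
  | id => exact Df.eq (Tf.var _) (Tf.var _)
  | ball p q ihp ihq =>
    exact Df.ex (Df.and (ihp.app2 (Tf.var _) (Tf.var _)) (Df.or
      (Df.and (Df.eq (Tf.var _) Tf.one) (Df.ball (Tf.var _) (ihq.app2 (Tf.pr (Tf.var _) (Tf.var _)) Tf.one)))
      (Df.and (Df.eq (Tf.var _) Tf.zero) (Df.bex (Tf.var _) (ihq.app2 (Tf.pr (Tf.var _) (Tf.var _)) Tf.zero)))))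
  | bin j p q ihp ihq =>
    exact Df.ex (Df.ex (Df.and (ihp.app2 (Tf.var _) (Tf.var _)) (Df.and (ihq.app2 (Tf.var _) (Tf.var _))
      (Df.op (Tf.const _) (Tf.var _) (Tf.var _) (Tf.var _)))))

def itm (c x y : M) : M := pr c (pr x y)
theorem itm_inj {c x y c' x' y' : M} (h : itm c x y = itm c' x' y') : c = c' ∧ x = x' ∧ y = y' :=
  ⟨(pr_inj h).1, pr_inj (pr_inj h).2⟩
theorem itm1 (c x y : M) : c ≤ itm c x y := le_pr_left _ _
theorem itm2 (c x y : M) : x ≤ itm c x y := (le_pr_left _ _).trans (le_pr_right _ _)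
theorem itm3 (c x y : M) : y ≤ itm c x y := (le_pr_right _ _).trans (le_pr_right _ _)
theorem Tf.itm {n : ℕ} {t u w : (Fin n → M) → M} (ht : Tf t) (hu : Tf u) (hw : Tf w) :
    Tf (fun v => itm (t v) (u v) (w v)) := ht.pr (hu.pr hw)

def Just (A : M → Prop) (N c x y : M) : Prop :=
  (c = 0 ∧ y = x) ∨
  (∃ p ≤ N, ∃ q ≤ N, ∃ b ≤ N, c = pr 1 (pr p q) ∧ A (itm p x b) ∧
    ((y = 1 ∧ ∀ z ≤ b, A (itm q (pr z x) 1)) ∨ (y = 0 ∧ ∃ z ≤ b, A (itm q (pr z x) 0)))) ∨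
  (∃ j ≤ N, ∃ p ≤ N, ∃ q ≤ N, ∃ u ≤ N, ∃ v ≤ N, c = pr (j + 1 + 1) (pr p q) ∧ A (itm p x u) ∧ A (itm q x v) ∧ Op j u v y)

def LC (A : M → Prop) (N : M) : Prop := ∀ c ≤ N, ∀ x ≤ N, ∀ y ≤ N, A (itm c x y) → Just A N c x y

theorem Just.mono {A A' : M → Prop} {N N' c x y : M} (h : Just A N c x y) (hA : ∀ z, A z → A' z) (hN : N ≤ N') :
    Just A' N' c x y := by
  rcases h with h | ⟨p, hp, q, hq, b, hb, e, h1, h2⟩ | ⟨j, hj, p, hp, q, hq, u, hu, v, hv, e, h1, h2, h3⟩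
  · exact Or.inl h
  · refine Or.inr (Or.inl ⟨p, hp.trans hN, q, hq.trans hN, b, hb.trans hN, e, hA _ h1, ?_⟩)
    rcases h2 with ⟨e, h⟩ | ⟨e, z, hz, h⟩
    · exact Or.inl ⟨e, fun z hz => hA _ (h z hz)⟩
    · exact Or.inr ⟨e, z, hz, hA _ h⟩
  · exact Or.inr (Or.inr ⟨j, hj.trans hN, p, hp.trans hN, q, hq.trans hN, u, hu.trans hN, v, hv.trans hN, e, hA _ h1, hA _ h2, h3⟩)

theorem pr_ne_zero {x y : M} (h : pr (x + 1) y = 0) : False := by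
  have : x + 1 ≤ 0 := h ▸ le_pr_left (x+1) y
  exact absurd (nonpos_iff_eq_zero.1 this) (by simp)

theorem Ev.sound {A : M → Prop} {N : M} (hA : ∀ z, A z → z ≤ N) (h : LC A N) (p : Prog) :
    ∀ {x y : M}, A (itm (p.code : M) x y) → Ev p x y := by
  have key : ∀ {c x y : M}, A (itm c x y) → Just A N c x y := fun {c x y} hc =>
    h c ((itm1 _ _ _).trans (hA _ hc)) x ((itm2 _ _ _).trans (hA _ hc)) y ((itm3 _ _ _).trans (hA _ hc)) hc
  clear h
  induction p with
  | id =>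
    intro x y hxy
    rcases key hxy with h | ⟨p, hp, q, hq, b, hb, e, h1, h2⟩ | ⟨j, hj, p, hp, q, hq, u, hu, v, hv, e, h1, h2, h3⟩
    · exact h.2
    · simp only [Prog.code, Nat.cast_zero] at e
      rw [← zero_add (1:M)] at e; exact (pr_ne_zero e.symm).elim
    · simp only [Prog.code, Nat.cast_zero] at e
      exact (pr_ne_zero e.symm).elim
  | ball p' q' ihp ihq =>
    intro x y hxy
    rcases key hxy with ⟨e, _⟩ | ⟨p, hp, q, hq, b, hb, e, h1, h2⟩ | ⟨j, hj, p, hp, q, hq, u, hu, v, hv, e, h1, h2, h3⟩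
    · simp only [Prog.code, cast_pr, Nat.cast_one] at e
      rw [← zero_add (1:M)] at e; exact (pr_ne_zero e).elim
    · simp only [Prog.code, cast_pr, Nat.cast_one, pr_iff, true_and] at e
      obtain ⟨rfl, rfl⟩ := e
      refine ⟨b, ihp h1, ?_⟩
      rcases h2 with ⟨e, h⟩ | ⟨e, z, hz, h⟩
      · exact Or.inl ⟨e, fun z hz => ihq (h z hz)⟩
      · exact Or.inr ⟨e, z, hz, ihq h⟩
    · simp only [Prog.code, cast_pr, Nat.cast_one, pr_iff] at e
      have := e.1
      simp at this
  | bin j' p' q' ihp ihq =>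
    intro x y hxy
    rcases key hxy with ⟨e, _⟩ | ⟨p, hp, q, hq, b, hb, e, h1, h2⟩ | ⟨j, hj, p, hp, q, hq, u, hu, v, hv, e, h1, h2, h3⟩
    · simp only [Prog.code, cast_pr, Nat.cast_add, Nat.cast_one] at e
      exact (pr_ne_zero e).elim
    · simp only [Prog.code, cast_pr, Nat.cast_add, Nat.cast_one, pr_iff] at e
      have := e.1
      simp at this
    · simp only [Prog.code, cast_pr, Nat.cast_add, Nat.cast_one, pr_iff, add_left_inj] at e
      obtain ⟨rfl, rfl, rfl⟩ := e
      exact ⟨u, v, ihp h1, ihq h2, h3⟩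

theorem Ev.complete (p : Prog) : ∀ B : M, ∃ (A : M → Prop) (N : M), Df1 A ∧ (∀ z, A z → z ≤ N) ∧ LC A N ∧
    ∀ x ≤ B, ∀ y, Ev p x y → A (itm (p.code : M) x y) := by
  induction p with
  | id =>
    intro B
    refine ⟨fun z => ∃ x ≤ B, z = itm 0 x x, itm 0 B B, ?_, ?_, ?_, ?_⟩
    · exact Df.bex (Tf.const _) (Df.eq (Tf.var _) (Tf.itm Tf.zero (Tf.var _) (Tf.var _)))
    · rintro z ⟨x, hx, rfl⟩; exact pr_mono le_rfl (pr_mono hx hx)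
    · rintro c _ x _ y _ ⟨x', hx, h⟩
      obtain ⟨rfl, rfl, rfl⟩ := itm_inj h
      exact Or.inl ⟨rfl, rfl⟩
    · rintro x hx y rfl
      exact ⟨_, hx, by simp [Prog.code]⟩
  | ball p q ihp ihq =>
    intro B
    obtain ⟨A1, N1, d1, b1, l1, e1⟩ := ihp B
    obtain ⟨Z, hZ⟩ := bddfun (Ev.df p) (fun x y y' h h' => Ev.fn p h h') B
    obtain ⟨A2, N2, d2, b2, l2, e2⟩ := ihq (pr Z B)
    refine ⟨fun z => A1 z ∨ A2 z ∨ ∃ x ≤ B, ∃ y ≤ 1, z = itm ((Prog.ball p q).code : M) x y ∧ Ev (.ball p q) x y,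
      N1 + N2 + itm ((Prog.ball p q).code : M) B 1, ?_, ?_, ?_, ?_⟩
    · exact Df.or (d1.app1 (Tf.var _)) (Df.or (d2.app1 (Tf.var _)) (Df.bex (Tf.const _) (Df.bex Tf.one (Df.and
        (Df.eq (Tf.var _) (Tf.itm (Tf.const _) (Tf.var _) (Tf.var _))) ((Ev.df (.ball p q)).app2 (Tf.var _) (Tf.var _))))))
    · rintro z (h | h | ⟨x, hx, y, hy, rfl, _⟩)
      · exact (b1 z h).trans (le_self_add.trans le_self_add)
      · exact (b2 z h).trans (le_add_self.trans le_self_add)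
      · exact (pr_mono le_rfl (pr_mono hx hy)).trans le_add_self
    · rintro c _ x _ y _ (h | h | ⟨x', hx, y', hy, e, h⟩)
      · refine (l1 _ ((itm1 _ _ _).trans (b1 _ h)) _ ((itm2 _ _ _).trans (b1 _ h)) _ ((itm3 _ _ _).trans (b1 _ h)) h).mono (fun z => Or.inl) (le_self_add.trans le_self_add)
      · refine (l2 _ ((itm1 _ _ _).trans (b2 _ h)) _ ((itm2 _ _ _).trans (b2 _ h)) _ ((itm3 _ _ _).trans (b2 _ h)) h).mono (fun z h => Or.inr (Or.inl h)) (le_add_self.trans le_self_add)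
      · obtain ⟨rfl, rfl, rfl⟩ := itm_inj e
        obtain ⟨b, hb, h⟩ := h
        have hbN := b1 _ (e1 x hx b hb)
        have hc : ((Prog.ball p q).code : M) = pr 1 (pr (p.code : M) (q.code : M)) := by simp [Prog.code, cast_pr]
        refine Or.inr (Or.inl ⟨p.code, ?_, q.code, ?_, b, ?_, hc, Or.inl (e1 x hx b hb), ?_⟩)
        · exact (((le_pr_left _ _).trans (le_pr_right _ _)).trans (hc.symm.le.trans (itm1 _ _ _))).trans le_add_self
        · exact (((le_pr_right _ _).trans (le_pr_right _ _)).trans (hc.symm.le.trans (itm1 _ _ _))).trans le_add_self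
        · exact ((itm3 _ _ _).trans hbN).trans (le_self_add.trans le_self_add)
        · have hb' := hZ x hx b hb
          rcases h with ⟨e, h⟩ | ⟨e, z, hz, h⟩
          · exact Or.inl ⟨e, fun z hz => Or.inr (Or.inl (e2 _ (pr_mono (hz.trans hb') hx) _ (h z hz)))⟩
          · exact Or.inr ⟨e, z, hz, Or.inr (Or.inl (e2 _ (pr_mono (hz.trans hb') hx) _ h))⟩
    · intro x hx y hy
      refine Or.inr (Or.inr ⟨x, hx, y, ?_, rfl, hy⟩)
      obtain ⟨_, _, ⟨rfl, _⟩ | ⟨rfl, _⟩⟩ := hy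
      · exact le_rfl
      · exact zero_le
  | bin j p q ihp ihq =>
    intro B
    obtain ⟨A1, N1, d1, b1, l1, e1⟩ := ihp B
    obtain ⟨Z, hZ⟩ := bddfun (Ev.df (.bin j p q)) (fun x y y' h h' => Ev.fn _ h h') B
    obtain ⟨A2, N2, d2, b2, l2, e2⟩ := ihq B
    refine ⟨fun z => A1 z ∨ A2 z ∨ ∃ x ≤ B, ∃ y, z = itm ((Prog.bin j p q).code : M) x y ∧ Ev (.bin j p q) x y,
      N1 + N2 + itm ((Prog.bin j p q).code : M) B Z, ?_, ?_, ?_, ?_⟩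
    · exact Df.or (d1.app1 (Tf.var _)) (Df.or (d2.app1 (Tf.var _)) (Df.bex (Tf.const _) (Df.ex (Df.and
        (Df.eq (Tf.var _) (Tf.itm (Tf.const _) (Tf.var _) (Tf.var _))) ((Ev.df (.bin j p q)).app2 (Tf.var _) (Tf.var _))))))
    · rintro z (h | h | ⟨x, hx, y, rfl, hy⟩)
      · exact (b1 z h).trans (le_self_add.trans le_self_add)
      · exact (b2 z h).trans (le_add_self.trans le_self_add)
      · exact (pr_mono le_rfl (pr_mono hx (hZ _ hx _ hy))).trans le_add_self
    · rintro c _ x _ y _ (h | h | ⟨x', hx, y', e, h⟩)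
      · refine (l1 _ ((itm1 _ _ _).trans (b1 _ h)) _ ((itm2 _ _ _).trans (b1 _ h)) _ ((itm3 _ _ _).trans (b1 _ h)) h).mono (fun z => Or.inl) (le_self_add.trans le_self_add)
      · refine (l2 _ ((itm1 _ _ _).trans (b2 _ h)) _ ((itm2 _ _ _).trans (b2 _ h)) _ ((itm3 _ _ _).trans (b2 _ h)) h).mono (fun z h => Or.inr (Or.inl h)) (le_add_self.trans le_self_add)
      · obtain ⟨rfl, rfl, rfl⟩ := itm_inj e
        obtain ⟨u, v, hu, hv, h⟩ := h
        have hbN := b1 _ (e1 x hx u hu)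
        have hbN2 := b2 _ (e2 x hx v hv)
        have hc : ((Prog.bin j p q).code : M) = pr ((j:M)+1+1) (pr (p.code : M) (q.code : M)) := by simp [Prog.code, cast_pr]
        refine Or.inr (Or.inr ⟨j, ?_, p.code, ?_, q.code, ?_, u, ?_, v, ?_, hc, Or.inl (e1 x hx u hu), Or.inr (Or.inl (e2 x hx v hv)), h⟩)
        · exact (((le_self_add.trans le_self_add).trans (le_pr_left _ _)).trans (hc.symm.le.trans (itm1 _ _ _))).trans le_add_self
        · exact (((le_pr_left _ _).trans (le_pr_right _ _)).trans (hc.symm.le.trans (itm1 _ _ _))).trans le_add_self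
        · exact (((le_pr_right _ _).trans (le_pr_right _ _)).trans (hc.symm.le.trans (itm1 _ _ _))).trans le_add_self
        · exact ((itm3 _ _ _).trans hbN).trans (le_self_add.trans le_self_add)
        · exact ((itm3 _ _ _).trans hbN2).trans (le_add_self.trans le_self_add)
    · intro x hx y hy
      exact Or.inr (Or.inr ⟨x, hx, y, rfl, hy⟩)

def T0 (c x : M) : Prop := ∃ a b N : M, LC (fun z => El a b N z) N ∧ El a b N (itm c x 1)

theorem T0_iff (p : Prog) (x : M) : T0 (p.code : M) x ↔ Ev p x 1 := by
  constructor
  · rintro ⟨a, b, N, h, h'⟩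
    exact Ev.sound (A := fun z => El a b N z) (fun z hz => hz.1) h p h'
  · intro h
    obtain ⟨A, N, d, bd, l, e⟩ := Ev.complete p x
    obtain ⟨a, b, hab⟩ := set_exists d N
    have : (fun z => El a b N z) = A := by
      funext z; rw [hab]; exact propext ⟨fun h => h.2, fun h => ⟨bd z h, h⟩⟩
    refine ⟨a, b, N, ?_, ?_⟩
    · rw [this]; exact l
    · exact (congrFun this _).mpr (e x le_rfl _ h)

def env : ∀ {m : ℕ}, (Fin m → M) → M
  | 0, _ => 0
  | m+1, v => pr (v (Fin.last m)) (env (Fin.init v))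

theorem env_snoc {m : ℕ} (v : Fin m → M) (y : M) : env (Fin.snoc v y : Fin (m+1) → M) = pr y (env v) := by
  simp [env]
end

theorem env_tm {m : ℕ} : Tm (m := m) (fun M _ v => env v) := by
  induction m with
  | zero => exact Tm.zero
  | succ m ih => exact Tm.pr (Tm.var _) (Tm.subst ih (ts := fun i M _ v => v i.castSucc) (fun i => Tm.var _))

theorem Tm.itm {m : ℕ} {t u w : TFam m} (ht : Tm t) (hu : Tm u) (hw : Tm w) :
    Tm (fun M _ v => itm (t M v) (u M v) (w M v)) := ht.pr (hu.pr hw)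

theorem D0.LC : D0 (m := 3) (fun M _ v => LC (fun z => El (v 0) (v 1) (v 2) z) (v 2)) := by
  unfold Guaspari.LC Just
  have V := fun {m : ℕ} (i : Fin m) => Tm.var i
  refine D0.ball (V _) (D0.ball (V _) (D0.ball (V _) (D0.imp (D0.el (V _) (V _) (V _) (Tm.itm (V _) (V _) (V _)))
    (D0.or (D0.and (D0.eq (V _) Tm.zero) (D0.eq (V _) (V _))) (D0.or ?_ ?_)))))
  · exact D0.bex (V _) (D0.bex (V _) (D0.bex (V _) (D0.and (D0.eq (V _) (Tm.pr Tm.one (Tm.pr (V _) (V _))))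
      (D0.and (D0.el (V _) (V _) (V _) (Tm.itm (V _) (V _) (V _)))
      (D0.or (D0.and (D0.eq (V _) Tm.one) (D0.ball (V _) (D0.el (V _) (V _) (V _) (Tm.itm (V _) (Tm.pr (V _) (V _)) Tm.one))))
        (D0.and (D0.eq (V _) Tm.zero) (D0.bex (V _) (D0.el (V _) (V _) (V _) (Tm.itm (V _) (Tm.pr (V _) (V _)) Tm.zero)))))))))
  · exact D0.bex (V _) (D0.bex (V _) (D0.bex (V _) (D0.bex (V _) (D0.bex (V _) (D0.and
      (D0.eq (V _) (Tm.pr (((V _).add Tm.one).add Tm.one) (Tm.pr (V _) (V _))))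
      (D0.and (D0.el (V _) (V _) (V _) (Tm.itm (V _) (V _) (V _))) (D0.and (D0.el (V _) (V _) (V _) (Tm.itm (V _) (V _) (V _)))
        (D0.op (V _) (V _) (V _) (V _)))))))))

theorem Sg.T0 {m : ℕ} {t u : TFam m} (ht : Tm t) (hu : Tm u) : Sg 1 (fun M _ v => T0 (t M v) (u M v)) := by
  have h : Sg 1 (m := 2) (fun M _ v => Guaspari.T0 (v 0) (v 1)) := by
    unfold Guaspari.T0
    refine Sg.ex (Sg.ex (Sg.ex (Sg.and ?_ ?_)))
    · exact (D0.LC.subst (ts := ![fun M _ w => w 2, fun M _ w => w 3, fun M _ w => w 4])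
        (fun i => by fin_cases i <;> exact Tm.var _)).sg
    · exact (D0.el (Tm.var _) (Tm.var _) (Tm.var _) (Tm.itm (Tm.var _) (Tm.var _) Tm.one)).sg
  exact h.subst (ts := ![t, u]) (fun i => by fin_cases i <;> assumption)

/-! compilation -/
theorem var_prog : ∀ (m : ℕ) (i : Fin m) (r : Prog), ∃ p : Prog, ∀ (M : Type) [PAM M] (v : Fin m → M) (x : M),
    Ev r x (env v) → Ev p x (v i) := by
  intro m
  induction m with
  | zero => intro i; exact i.elim0
  | succ m ih =>
    intro i r
    refine Fin.lastCases ?_ (fun j => ?_) i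
    · refine ⟨.bin 4 r r, fun M _ v x h => ⟨_, _, h, h, ?_⟩⟩
      simp only [Op, Nat.cast_inj]
      simp only [Nat.reduceEqDiff, false_and, true_and, false_or, or_false, OfNat.ofNat_ne_zero, OfNat.ofNat_ne_one]
      exact ⟨_, le_pr_right _ _, rfl⟩
    · obtain ⟨p, hp⟩ := ih j (.bin 5 r r)
      refine ⟨p, fun M _ v x h => hp M (Fin.init v) x ⟨_, _, h, h, ?_⟩⟩
      simp only [Op, Nat.cast_inj]
      simp only [Nat.reduceEqDiff, false_and, true_and, false_or, or_false, OfNat.ofNat_ne_zero, OfNat.ofNat_ne_one]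
      exact ⟨_, le_pr_left _ _, rfl⟩

theorem term_prog {m : ℕ} (τ : LA.Term (Empty ⊕ Fin m)) : ∃ p : Prog, ∀ (M : Type) [PAM M] (v : Fin m → M),
    Ev p (env v) (τ.realize (Sum.elim (default : Empty → M) v)) := by
  induction τ with
  | var x =>
    rcases x with x | x
    · exact x.elim
    · obtain ⟨p, hp⟩ := var_prog m x .id
      exact ⟨p, fun M _ v => hp M v _ rfl⟩
  | @func l f ts ih =>
    choose k hk using ih
    match l, f, ts, k, hk with
    | 0, f, ts, k, hk =>
      refine ⟨.bin 6 .id .id, fun M _ v => ⟨_, _, rfl, rfl, ?_⟩⟩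
      have : (Term.func f ts).realize (Sum.elim (default : Empty → M) v) = opZ M :=
        congrArg (Structure.funMap (L := LA) f) (Subsingleton.elim _ _)
      rw [this]; simp [Op, opZ_eq]
    | 1, f, ts, k, hk =>
      refine ⟨.bin 0 (k 0) (k 0), fun M _ v => ⟨_, _, hk 0 M v, hk 0 M v, ?_⟩⟩
      have : (Term.func f ts).realize (Sum.elim (default : Empty → M) v) = opS ((ts 0).realize (Sum.elim (default : Empty → M) v)) := by
        refine congrArg (Structure.funMap (L := LA) f) ?_
        funext i; fin_cases i; rfl
      rw [this]; simp [Op, opS_eq]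
    | 2, false, ts, k, hk =>
      refine ⟨.bin 1 (k 0) (k 1), fun M _ v => ⟨_, _, hk 0 M v, hk 1 M v, ?_⟩⟩
      have : (Term.func (L := LA) (l := 2) false ts).realize (Sum.elim (default : Empty → M) v) = opA ((ts 0).realize (Sum.elim (default : Empty → M) v)) ((ts 1).realize (Sum.elim (default : Empty → M) v)) := by
        refine congrArg (Structure.funMap (L := LA) (n := 2) false) ?_
        funext i; fin_cases i <;> rfl
      rw [this]; simp [Op, opA_eq]
    | 2, true, ts, k, hk =>
      refine ⟨.bin 2 (k 0) (k 1), fun M _ v => ⟨_, _, hk 0 M v, hk 1 M v, ?_⟩⟩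
      have : (Term.func (L := LA) (l := 2) true ts).realize (Sum.elim (default : Empty → M) v) = opM ((ts 0).realize (Sum.elim (default : Empty → M) v)) ((ts 1).realize (Sum.elim (default : Empty → M) v)) := by
        refine congrArg (Structure.funMap (L := LA) (n := 2) true) ?_
        funext i; fin_cases i <;> rfl
      rw [this]; simp [Op, opM_eq]
    | (_ + 3), f, _, _, _ => exact nomatch f

def Cmp {m : ℕ} (P : Fam m) (p : Prog) : Prop := ∀ (M : Type) [PAM M] (v : Fin m → M),
  (P M v → Ev p (env v) 1) ∧ (¬ P M v → Ev p (env v) 0)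

theorem op_le {M : Type} [PAM M] {u v y : M} (h : (u ≤ v ∧ y = 1) ∨ (¬ u ≤ v ∧ y = 0)) : Op ((3:ℕ):M) u v y := by
  unfold Op; exact Or.inr (Or.inr (Or.inr (Or.inl ⟨rfl, h⟩)))

theorem Cmp.imp {m : ℕ} {P Q : Fam m} {p q : Prog} (h : Cmp P p) (h' : Cmp Q q) :
    Cmp (fun M _ v => P M v → Q M v) (.bin 3 p q) := by
  intro M _ v
  by_cases hP : P M v <;> by_cases hQ : Q M v <;> simp only [hP, hQ, true_imp_iff, false_imp_iff, not_true, not_false_iff, imp_self, true_and, and_true]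
  · exact ⟨_, _, (h M v).1 hP, (h' M v).1 hQ, op_le (Or.inl ⟨le_rfl, rfl⟩)⟩
  · exact ⟨_, _, (h M v).1 hP, (h' M v).2 hQ, op_le (Or.inr ⟨by simp, rfl⟩)⟩
  · exact ⟨_, _, (h M v).2 hP, (h' M v).1 hQ, op_le (Or.inl ⟨zero_le, rfl⟩)⟩
  · exact ⟨_, _, (h M v).2 hP, (h' M v).2 hQ, op_le (Or.inl ⟨le_rfl, rfl⟩)⟩

theorem Cmp.false {m : ℕ} : Cmp (m := m) (fun M _ v => False) (.bin 6 .id .id) := by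
  intro M _ v
  refine ⟨False.elim, fun _ => ⟨_, _, rfl, rfl, ?_⟩⟩
  unfold Op; tauto

theorem Cmp.ball {m : ℕ} {τ : LA.Term (Empty ⊕ Fin m)} {pt : Prog}
    (ht : ∀ (M : Type) [PAM M] (v : Fin m → M), Ev pt (env v) (τ.realize (Sum.elim (default : Empty → M) v)))
    {P : Fam (m+1)} {p : Prog} (h : Cmp P p) :
    Cmp (fun M _ v => ∀ y ≤ τ.realize (Sum.elim (default : Empty → M) v), P M (Fin.snoc v y)) (.ball pt p) := by
  intro M _ v
  constructor
  · intro hv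
    refine ⟨_, ht M v, Or.inl ⟨rfl, fun z hz => ?_⟩⟩
    rw [← env_snoc]; exact (h M _).1 (hv z hz)
  · intro hv
    push Not at hv
    obtain ⟨z, hz, hv⟩ := hv
    refine ⟨_, ht M v, Or.inr ⟨rfl, z, hz, ?_⟩⟩
    rw [← env_snoc]; exact (h M _).2 hv

theorem Cmp.of_iff {m : ℕ} {P Q : Fam m} {p : Prog} (h : Cmp P p) (e : ∀ (M : Type) [PAM M] (v : Fin m → M), Q M v ↔ P M v) : Cmp Q p := by
  rw [famext e]; exact h

theorem D0.prog {m : ℕ} {P : Fam m} (h : D0 P) : ∃ p, Cmp P p := by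
  obtain ⟨φ, hφ, h⟩ := h
  rw [fam_eq h]; clear h P; unfold fam
  induction hφ with
  | falsum => exact ⟨_, Cmp.false⟩
  | equal t u =>
    obtain ⟨p, hp⟩ := term_prog t
    obtain ⟨q, hq⟩ := term_prog u
    refine ⟨.bin 2 (.bin 3 p q) (.bin 3 q p), fun M _ v => ?_⟩
    beta_reduce
    rw [BoundedFormula.realize_bdEqual]
    have h1 := hp M v
    have h2 := hq M v
    generalize t.realize (Sum.elim (default : Empty → M) v) = a at *
    generalize u.realize (Sum.elim (default : Empty → M) v) = b at *
    have hm : ∀ x y : M, Op ((2:ℕ):M) x y (x*y) := by intro x y; unfold Op; tauto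
    constructor
    · rintro rfl
      refine ⟨1, 1, ⟨_, _, h1, h2, op_le (Or.inl ⟨le_rfl, rfl⟩)⟩, ⟨_, _, h2, h1, op_le (Or.inl ⟨le_rfl, rfl⟩)⟩, ?_⟩
      have := hm 1 1; rwa [one_mul] at this
    · intro hne
      rcases lt_or_gt_of_ne hne with hl | hl
      · refine ⟨1, 0, ⟨_, _, h1, h2, op_le (Or.inl ⟨hl.le, rfl⟩)⟩, ⟨_, _, h2, h1, op_le (Or.inr ⟨not_le.2 hl, rfl⟩)⟩, ?_⟩
        have := hm 1 0; rwa [one_mul] at this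
      · refine ⟨0, 1, ⟨_, _, h1, h2, op_le (Or.inr ⟨not_le.2 hl, rfl⟩)⟩, ⟨_, _, h2, h1, op_le (Or.inl ⟨hl.le, rfl⟩)⟩, ?_⟩
        have := hm 0 1; rwa [mul_one] at this
  | le t u =>
    obtain ⟨p, hp⟩ := term_prog t
    obtain ⟨q, hq⟩ := term_prog u
    refine ⟨.bin 3 p q, fun M _ v => ?_⟩
    beta_reduce
    rw [rz_leF, opL_eq]
    exact ⟨fun h => ⟨_, _, hp M v, hq M v, op_le (Or.inl ⟨h, rfl⟩)⟩, fun h => ⟨_, _, hp M v, hq M v, op_le (Or.inr ⟨h, rfl⟩)⟩⟩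
  | imp _ _ ih1 ih2 =>
    obtain ⟨p, hp⟩ := ih1
    obtain ⟨q, hq⟩ := ih2
    exact ⟨_, hp.imp hq⟩
  | ball t _ ih =>
    obtain ⟨k, hk⟩ := term_prog t
    obtain ⟨p, hp⟩ := ih
    refine ⟨_, (Cmp.ball hk hp).of_iff fun M _ v => ?_⟩
    simp only [BoundedFormula.realize_all, BoundedFormula.realize_imp, rz_leF, rz_vT, realize_weaken,
        opL_eq, Fin.snoc_last]
  | bex t _ ih =>
    obtain ⟨k, hk⟩ := term_prog t
    obtain ⟨p, hp⟩ := ih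
    refine ⟨_, ((Cmp.ball hk (hp.imp Cmp.false)).imp Cmp.false).of_iff fun M _ v => ?_⟩
    simp only [BoundedFormula.realize_ex, BoundedFormula.realize_inf, rz_leF, rz_vT, realize_weaken,
        opL_eq, Fin.snoc_last]
    simp

/-- the universal `Σ_{k+1}` predicate -/
def TS {M : Type} [PAM M] : ℕ → M → M → Prop
  | 0, c, s => ∃ y, T0 c (pr y s)
  | k+1, c, s => ∃ y, ¬ TS k c (pr y s)

theorem Sg.TS (k : ℕ) {m : ℕ} {t u : TFam m} (ht : Tm t) (hu : Tm u) : Sg (k+1) (fun M _ v => TS k (t M v) (u M v)) := by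
  have h : Sg (k+1) (m := 2) (fun M _ v => Guaspari.TS k (v 0) (v 1)) := by
    clear ht hu t u
    induction k with
    | zero => exact Sg.ex (Sg.T0 (Tm.var _) (Tm.pr (Tm.var _) (Tm.var _)))
    | succ k ih =>
      refine Sg.ex (Sg.ofPg (Sg.not ?_))
      exact ih.subst (ts := ![fun M _ w => w 0, fun M _ w => pr (w 2) (w 1)]) (fun i => by
        fin_cases i
        · exact Tm.var _
        · exact Tm.pr (Tm.var _) (Tm.var _))
  exact h.subst (ts := ![t, u]) (fun i => by fin_cases i <;> assumption)

theorem Sg.index (k : ℕ) : ∀ {m : ℕ} {P : Fam m}, Sg (k+1) P → ∃ e : ℕ, ∀ (M : Type) [PAM M] (v : Fin m → M),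
    P M v ↔ Guaspari.TS k (e : M) (env v) := by
  induction k with
  | zero =>
    intro m P h
    obtain ⟨Q, hQ, h⟩ := h.nf
    obtain ⟨p, hp⟩ := hQ.toD0.prog
    refine ⟨p.code, fun M _ v => ?_⟩
    rw [h]
    refine exists_congr fun y => ?_
    rw [T0_iff, ← env_snoc]
    refine ⟨(hp M _).1, fun h1 => ?_⟩
    by_contra h2
    have := Ev.fn p h1 ((hp M _).2 h2)
    exact one_ne_zero this
  | succ k ih =>
    intro m P h
    obtain ⟨Q, hQ, h⟩ := h.nf
    obtain ⟨e, he⟩ := ih hQ.not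
    refine ⟨e, fun M _ v => ?_⟩
    rw [h]
    refine exists_congr fun y => ?_
    rw [← env_snoc, ← he, not_not]

end Guaspari

set_option linter.unusedSimpArgs false
set_option linter.unusedVariables false
namespace Guaspari

/-! ## Recursively enumerable relations are `Σ_1` in the standard model -/
theorem ns_ext {x y : NS} : x = y ↔ x.val = y.val := ⟨congrArg _, fun h => by cases x; cases y; exact congrArg _ h⟩
theorem ns_val0 : (0 : NS).val = 0 := by rw [← opZ_eq]; rfl
theorem ns_valadd (x y : NS) : (x + y).val = x.val + y.val := rfl
theorem ns_valmul (x y : NS) : (x * y).val = x.val * y.val := rfl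
theorem ns_val1 : (1 : NS).val = 1 := by
  have : (1 : NS) = opS (opZ NS) := by rw [opS_eq, opZ_eq, zero_add]
  rw [this]; rfl
theorem ns_le {x y : NS} : x ≤ y ↔ x.val ≤ y.val := by rw [← opL_eq]; rfl
theorem ns_lt {x y : NS} : x < y ↔ x.val < y.val := by rw [← not_le, ns_le, not_le]
theorem ns_castval (n : ℕ) : ((n : ℕ) : NS).val = n := by rw [ns_cast]

def PairF {M : Type} [PAM M] (a b z : M) : Prop := (a < b ∧ z = b * b + a) ∨ (¬ a < b ∧ z = a * a + a + b)
theorem D0.pairF {m : ℕ} {t u w : TFam m} (ht : Tm t) (hu : Tm u) (hw : Tm w) :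
    D0 (fun M _ v => PairF (t M v) (u M v) (w M v)) :=
  ((D0.lt ht hu).and (D0.eq hw ((hu.mul hu).add ht))).or ((D0.lt ht hu).not.and (D0.eq hw (((ht.mul ht).add ht).add hu)))
theorem ns_pairF (a b z : NS) : PairF a b z ↔ z = NS.mk (Nat.pair a.val b.val) := by
  unfold PairF Nat.pair
  rw [ns_lt, ns_ext, ns_ext, ns_ext, ns_valadd, ns_valadd, ns_valadd, ns_valmul, ns_valmul]
  split_ifs with h <;> simp [h]

def RecF (f : ℕ →. ℕ) (F : Fam 2) : Prop := Sg 1 F ∧ ∀ v : Fin 2 → NS, F NS v ↔ (v 1).val ∈ f (v 0).val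

theorem finset_df {M : Type} [PAM M] (l : List M) : Df1 (fun x => x ∈ l) := by
  induction l with
  | nil => simpa using Df.prop False
  | cons a l ih => 
    refine (Df.or (Df.eq (Tf.var 0) (Tf.const a)) ih).of_iff fun v => ?_
    simp
theorem list_bdd {M : Type} [PAM M] (l : List M) : ∃ N, ∀ x ∈ l, x ≤ N := by
  induction l with
  | nil => exact ⟨0, by simp⟩
  | cons a l ih =>
    obtain ⟨N, h⟩ := ih
    refine ⟨a + N, fun x hx => ?_⟩
    rcases List.mem_cons.1 hx with rfl | hx
    · exact le_self_add
    · exact (h x hx).trans le_add_self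

def JR {M : Type} [PAM M] (F G : Fam 2) (a : M) (A : M → Prop) (k i : M) : Prop :=
  (k = 0 ∧ F M ![a, i]) ∨ ∃ k' i', k = k' + 1 ∧ A (pr k' i') ∧ ∃ z, PairF k' i' z ∧ ∃ w, PairF a z w ∧ G M ![w, i]
def PR {M : Type} [PAM M] (F G : Fam 2) (a n y : M) : Prop :=
  ∃ s t N, (∀ k ≤ N, ∀ i ≤ N, El s t N (pr k i) → JR F G a (fun z => El s t N z) k i) ∧ El s t N (pr n y)

theorem Sg.PR {F G : Fam 2} (hF : Sg 1 F) (hG : Sg 1 G) : Sg 1 (m := 3) (fun M _ v => PR F G (v 0) (v 1) (v 2)) := by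
  have V := fun {m : ℕ} (i : Fin m) => Tm.var i
  unfold Guaspari.PR JR
  refine Sg.ex (Sg.ex (Sg.ex (Sg.and (Sg.ball (V _) (Sg.ball (V _) ?_)) (D0.el (V _) (V _) (V _) (Tm.pr (V _) (V _))).sg)))
  refine (Sg.or (D0.el (V 3) (V 4) (V 5) (Tm.pr (V 6) (V 7))).not.sg (Sg.or (P := fun M _ v => v 6 = 0 ∧ F M ![v 0, v 7]) (Sg.and (D0.eq (V _) Tm.zero).sg ?_)
    (Q := fun M _ v => ∃ k' i', v 6 = k' + 1 ∧ El (v 3) (v 4) (v 5) (pr k' i') ∧ ∃ z, PairF k' i' z ∧ ∃ w, PairF (v 0) z w ∧ G M ![w, v 7]) (Sg.ex (Sg.ex (Sg.and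
    (D0.eq (V _) ((V _).add Tm.one)).sg (Sg.and (D0.el (V _) (V _) (V _) (Tm.pr (V _) (V _))).sg (Sg.ex (Sg.and (D0.pairF (V _) (V _) (V _)).sg
      (Sg.ex (Sg.and (D0.pairF (V _) (V _) (V _)).sg ?_)))))))))).of_iff ?_
  · refine (hF.subst (ts := ![fun M _ w => w 0, fun M _ w => w 7]) (fun i => by fin_cases i <;> exact Tm.var _)).of_iff fun M _ v => ?_
    apply iff_of_eq; congr 1; funext i; fin_cases i <;> rfl
  · refine (hG.subst (ts := ![fun M _ w => w 11, fun M _ w => w 7]) (fun i => by fin_cases i <;> exact Tm.var _)).of_iff fun M _ v => ?_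
    apply iff_of_eq; congr 1; funext i; fin_cases i <;> rfl
  · intro M _ v
    exact imp_iff_not_or

theorem JR.mono {M : Type} [PAM M] {F G : Fam 2} {a : M} {A A' : M → Prop} {k i : M} (h : JR F G a A k i)
    (hA : ∀ z, A z → A' z) : JR F G a A' k i := by
  rcases h with h | ⟨k', i', e, h1, h2⟩
  · exact Or.inl h
  · exact Or.inr ⟨k', i', e, hA _ h1, h2⟩

abbrev precf (f g : ℕ →. ℕ) (a n : ℕ) : Part ℕ :=
  n.rec (f a) fun y IH => do { let i ← IH; g (Nat.pair a (Nat.pair y i)) }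

theorem PR_iff {f g : ℕ →. ℕ} {F G : Fam 2} (hF : RecF f F) (hG : RecF g G) (a n y : NS) :
    PR F G a n y ↔ y.val ∈ precf f g a.val n.val := by
  constructor
  · rintro ⟨s, t, N, h, h'⟩
    have key : ∀ (k : ℕ) (i : NS), El s t N (pr (NS.mk k) i) → i.val ∈ precf f g a.val k := by
      intro k
      induction k with
      | zero =>
        intro i hi
        rcases h _ ((le_pr_left _ _).trans hi.1) _ ((le_pr_right _ _).trans hi.1) hi with ⟨_, h1⟩ | ⟨k', i', e, _⟩
        · exact (hF.2 _).1 h1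
        · exfalso
          rw [ns_ext, ns_valadd, ns_val1] at e
          exact absurd e (by simp)
      | succ k ih =>
        intro i hi
        rcases h _ ((le_pr_left _ _).trans hi.1) _ ((le_pr_right _ _).trans hi.1) hi with ⟨e, h1⟩ | ⟨k', i', e, h1, z, hz, w, hw, h2⟩
        · exfalso
          rw [ns_ext, ns_val0] at e
          exact absurd e (by simp)
        · rw [ns_ext, ns_valadd, ns_val1] at e
          have e' : k' = NS.mk k := by rw [ns_ext]; simpa using e.symm
          subst e'
          rw [ns_pairF] at hz hw
          have h3 := (hG.2 _).1 h2
          refine Part.mem_bind_iff.2 ⟨i'.val, ih _ h1, ?_⟩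
          subst hz; subst hw; exact h3
    exact key _ _ h'
  · have key : ∀ (k : ℕ) (i : ℕ), i ∈ precf f g a.val k → ∃ l : List NS, pr (NS.mk k) (NS.mk i) ∈ l ∧
        ∀ k i : NS, pr k i ∈ l → JR F G a (fun z => z ∈ l) k i := by
      intro k
      induction k with
      | zero =>
        intro i hi
        refine ⟨[pr (NS.mk 0) (NS.mk i)], by simp, fun k i' h => ?_⟩
        obtain ⟨rfl, rfl⟩ := pr_inj (List.mem_singleton.1 h)
        exact Or.inl ⟨by rw [ns_ext, ns_val0], (hF.2 _).2 hi⟩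
      | succ k ih =>
        intro i hi
        obtain ⟨i', h1, h2⟩ := Part.mem_bind_iff.1 hi
        obtain ⟨l, hl, h⟩ := ih i' h1
        refine ⟨pr (NS.mk (k+1)) (NS.mk i) :: l, by simp, fun k' i'' h' => ?_⟩
        rcases List.mem_cons.1 h' with h' | h'
        · obtain ⟨rfl, rfl⟩ := pr_inj h'
          refine Or.inr ⟨NS.mk k, NS.mk i', ?_, List.mem_cons_of_mem _ hl, _, (ns_pairF _ _ _).2 rfl, _, (ns_pairF _ _ _).2 rfl, (hG.2 _).2 h2⟩
          rw [ns_ext, ns_valadd, ns_val1]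
        · exact (h _ _ h').mono fun z => List.mem_cons_of_mem _
    intro h
    obtain ⟨l, hl, h⟩ := key _ _ h
    obtain ⟨N, hN⟩ := list_bdd l
    obtain ⟨s, t, hst⟩ := set_exists (finset_df l) N
    have : (fun z => El s t N z) = fun z => z ∈ l := by
      funext z; rw [hst]; exact propext ⟨fun h => h.2, fun h => ⟨hN z h, h⟩⟩
    refine ⟨s, t, N, ?_, ?_⟩
    · rw [this]; intro k _ i _ hki
      exact h k i ((congrFun this _).mp hki)
    · exact (congrFun this _).mpr hl

theorem recF_exists {f : ℕ →. ℕ} (h : Nat.Partrec f) : ∃ F, RecF f F := by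
  have V := fun {m : ℕ} (i : Fin m) => Tm.var i
  have sub : ∀ {F : Fam 2}, Sg 1 F → ∀ {m : ℕ} {t u : TFam m}, Tm t → Tm u → Sg 1 (fun M _ v => F M ![t M v, u M v]) := by
    intro F hF m t u ht hu
    refine (hF.subst (ts := ![t, u]) (fun i => by fin_cases i <;> assumption)).of_iff fun M _ v => ?_
    apply iff_of_eq; congr 1; funext i; fin_cases i <;> rfl
  induction h with
  | zero =>
    refine ⟨fun M _ v => v 1 = 0, (D0.eq (V _) Tm.zero).sg, fun v => ?_⟩
    show v 1 = 0 ↔ (v 1).val ∈ Part.some 0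
    rw [ns_ext, ns_val0, Part.mem_some_iff]
  | succ =>
    refine ⟨fun M _ v => v 1 = v 0 + 1, (D0.eq (V _) ((V _).add Tm.one)).sg, fun v => ?_⟩
    show v 1 = v 0 + 1 ↔ (v 1).val ∈ Part.some ((v 0).val + 1)
    rw [ns_ext, ns_valadd, ns_val1, Part.mem_some_iff]
  | left =>
    refine ⟨fun M _ v => ∃ z, PairF (v 1) z (v 0), Sg.ex (D0.pairF (V _) (V _) (V _)).sg, fun v => ?_⟩
    simp only [ns_pairF]
    constructor
    · rintro ⟨z, h⟩; rw [h]; simp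
    · intro h
      refine ⟨NS.mk (Nat.unpair (v 0).val).2, ?_⟩
      rw [ns_ext]
      have h : (v 1).val = (Nat.unpair (v 0).val).1 := by simpa using h
      rw [h]; simp
  | right =>
    refine ⟨fun M _ v => ∃ z, PairF z (v 1) (v 0), Sg.ex (D0.pairF (V _) (V _) (V _)).sg, fun v => ?_⟩
    simp only [ns_pairF]
    constructor
    · rintro ⟨z, h⟩; rw [h]; simp
    · intro h
      refine ⟨NS.mk (Nat.unpair (v 0).val).1, ?_⟩
      rw [ns_ext]
      have h : (v 1).val = (Nat.unpair (v 0).val).2 := by simpa using h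
      rw [h]; simp
  | pair _ _ ihf ihg =>
    obtain ⟨F, hF, hF'⟩ := ihf
    obtain ⟨G, hG, hG'⟩ := ihg
    refine ⟨fun M _ v => ∃ a b, F M ![v 0, a] ∧ G M ![v 0, b] ∧ PairF a b (v 1), 
      Sg.ex (Sg.ex (Sg.and (sub hF (V _) (V _)) (Sg.and (sub hG (V _) (V _)) (D0.pairF (V _) (V _) (V _)).sg))), fun v => ?_⟩
    simp only [ns_pairF, hF', hG']
    simp only [Seq.seq, Part.mem_bind_iff, Part.map_eq_map, Part.mem_map_iff]
    simp
    constructor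
    · rintro ⟨a, ha, b, hb, e⟩
      exact ⟨_, ha, _, hb, by rw [e]⟩
    · rintro ⟨a, ha, b, hb, e⟩
      exact ⟨NS.mk a, ha, NS.mk b, hb, by rw [ns_ext, ← e]⟩
  | comp _ _ ihf ihg =>
    obtain ⟨F, hF, hF'⟩ := ihf
    obtain ⟨G, hG, hG'⟩ := ihg
    refine ⟨fun M _ v => ∃ a, G M ![v 0, a] ∧ F M ![a, v 1], 
      Sg.ex (Sg.and (sub hG (V _) (V _)) (sub hF (V _) (V _))), fun v => ?_⟩
    simp only [hF', hG']
    refine Iff.trans ?_ Part.mem_bind_iff.symm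
    constructor
    · rintro ⟨a, ha, hb⟩
      exact ⟨_, ha, hb⟩
    · rintro ⟨a, ha, hb⟩
      exact ⟨NS.mk a, ha, hb⟩
  | prec _ _ ihf ihg =>
    obtain ⟨F, hF⟩ := ihf
    obtain ⟨G, hG⟩ := ihg
    refine ⟨fun M _ v => ∃ a n, PairF a n (v 0) ∧ PR F G a n (v 1), 
      Sg.ex (Sg.ex (Sg.and (D0.pairF (V _) (V _) (V _)).sg ((Sg.PR hF.1 hG.1).subst (ts := ![fun M _ w => w 2, fun M _ w => w 3, fun M _ w => w 1])
        (fun i => by fin_cases i <;> exact V _)))), fun v => ?_⟩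
    simp only [ns_pairF, PR_iff hF hG]
    constructor
    · rintro ⟨a, n, e, h⟩
      show (v 1).val ∈ precf _ _ (Nat.unpair (v 0).val).1 (Nat.unpair (v 0).val).2
      rw [e, Nat.unpair_pair]; exact h
    · intro h
      refine ⟨NS.mk (Nat.unpair (v 0).val).1, NS.mk (Nat.unpair (v 0).val).2, ?_, ?_⟩
      · rw [ns_ext]; simp
      · exact h
  | rfind _ ihf =>
    obtain ⟨F, hF, hF'⟩ := ihf
    refine ⟨fun M _ v => (∃ z, PairF (v 0) (v 1) z ∧ F M ![z, 0]) ∧ ∀ m ≤ v 1, m = v 1 ∨ ∃ z, PairF (v 0) m z ∧ ∃ u, ¬ u = 0 ∧ F M ![z, u],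
      Sg.and (Sg.ex (Sg.and (D0.pairF (V _) (V _) (V _)).sg (sub hF (V _) Tm.zero)))
        (Sg.ball (V _) (Sg.or (D0.eq (V _) (V _)).sg (Sg.ex (Sg.and (D0.pairF (V _) (V _) (V _)).sg (Sg.ex (Sg.and (D0.eq (V _) Tm.zero).not.sg (sub hF (V _) (V _)))))))), fun v => ?_⟩
    simp only [ns_pairF, hF']
    refine Iff.trans ?_ Nat.mem_rfind.symm
    simp [ns_val0]
    intro _
    constructor
    · intro h m hm
      rcases h (NS.mk m) (ns_le.2 hm.le) with e | ⟨u, hu, h⟩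
      · rw [ns_ext] at e; exact absurd e hm.ne
      · exact ⟨_, h, fun h => hu (by rw [ns_ext, h, ns_val0])⟩
    · intro h m hm
      by_cases e : m = v 1
      · exact Or.inl e
      · right
        obtain ⟨u, hu, h⟩ := @h m.val (ns_lt.1 (lt_of_le_of_ne hm e))
        exact ⟨NS.mk u, by rw [ns_ext, ns_val0]; exact h, hu⟩

theorem re_D0 {p : ℕ → Prop} (h : REPred p) : ∃ Q : Fam 2, D0 Q ∧ ∀ x : ℕ, p x ↔ ∃ s : ℕ, Q NS ![(x : NS), (s : NS)] := by
  obtain ⟨F, hF, hF'⟩ := recF_exists h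
  have h1 : Sg 1 (m := 1) (fun M _ v => F M ![v 0, 0]) := by
    refine (hF.subst (ts := ![fun M _ v => v 0, fun M _ _ => 0]) (fun i => by fin_cases i <;> [exact Tm.var _; exact Tm.zero])).of_iff fun M _ v => ?_
    apply iff_of_eq; congr 1; funext i; fin_cases i <;> rfl
  obtain ⟨Q, hQ, hQ'⟩ := h1.nf
  refine ⟨Q, hQ.toD0, fun x => ?_⟩
  have h2 := hQ' NS ![(x : NS)]
  rw [hF'] at h2
  have h3 : (∃ y : NS, Q NS (Fin.snoc ![(x:NS)] y)) ↔ ∃ s : ℕ, Q NS ![(x : NS), (s : NS)] := by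
    have e : ∀ y : NS, (Fin.snoc ![(x:NS)] y : Fin 2 → NS) = ![(x:NS), y] := by
      intro y; funext i; fin_cases i <;> rfl
    simp only [e]
    constructor
    · rintro ⟨y, hy⟩
      obtain ⟨k, rfl⟩ : ∃ k : ℕ, y = (k : NS) := ⟨_, ns_surj y⟩
      exact ⟨k, hy⟩
    · rintro ⟨y, hy⟩; exact ⟨_, hy⟩
  refine Iff.trans ?_ (h2.trans h3)
  simp [ns_val0, ns_castval]
  exact fun _ => ⟨(), rfl⟩

def un (n : ℕ) : ℕ × ℕ := (n - n.sqrt * n.sqrt, n.sqrt - (n - n.sqrt * n.sqrt))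
theorem un_pr (x y : ℕ) : un (pr x y) = (x, y) := by
  have : Nat.sqrt (pr x y) = x + y := by
    unfold pr; exact Nat.sqrt_add_eq _ (by omega)
  unfold un; rw [this]; unfold pr
  ext <;> simp
theorem un_prim : Primrec un := by
  have h1 : Primrec (fun n : ℕ => n - n.sqrt * n.sqrt) :=
    Primrec.nat_sub.comp Primrec.id (Primrec.nat_mul.comp Primrec.nat_sqrt Primrec.nat_sqrt)
  exact Primrec.pair h1 (Primrec.nat_sub.comp Primrec.nat_sqrt h1)

end Guaspari

set_option linter.unusedSimpArgs false
set_option linter.unusedVariables false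
namespace Guaspari

/-! ## Inductive definitions are `Σ_1` -/
def AS {M : Type} [PAM M] (s t N r y : M) : Prop := ∃ r' ≤ N, r' < r ∧ El s t N (pr r' y)

theorem Sg.AS {m : ℕ} {s t N r y : TFam m} (hs : Tm s) (ht : Tm t) (hN : Tm N) (hr : Tm r) (hy : Tm y) :
    Sg 1 (fun M _ v => AS (s M v) (t M v) (N M v) (r M v) (y M v)) := by
  have h : D0 (m := 5) (fun M _ v => Guaspari.AS (v 0) (v 1) (v 2) (v 3) (v 4)) := by
    unfold Guaspari.AS
    exact D0.bex (Tm.var _) (D0.and (D0.lt (Tm.var _) (Tm.var _)) (D0.el (Tm.var _) (Tm.var _) (Tm.var _) (Tm.pr (Tm.var _) (Tm.var _))))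
  exact (h.subst (ts := ![s, t, N, r, y]) (fun i => by fin_cases i <;> assumption)).sg

structure Ind (J : ∀ (M : Type) [PAM M], (M → Prop) → M → Prop) : Prop where
  mono : ∀ (A A' : NS → Prop) x, (∀ z, A z → A' z) → J NS A x → J NS A' x
  fin : ∀ (A : NS → Prop) x, J NS A x → ∃ l : List NS, (∀ z ∈ l, A z) ∧ J NS (fun z => z ∈ l) x
  sg : Sg 1 (m := 5) (fun M _ v => J M (fun y => AS (v 0) (v 1) (v 2) (v 3) y) (v 4))

def LF (J : ∀ (M : Type) [PAM M], (M → Prop) → M → Prop) (M : Type) [PAM M] (x : M) : Prop :=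
  ∃ s t N r : M, (∀ r ≤ N, ∀ y ≤ N, El s t N (pr r y) → J M (fun y => AS s t N r y) y) ∧ El s t N (pr r x)

section
variable {J : ∀ (M : Type) [PAM M], (M → Prop) → M → Prop}

theorem Sg.LF (hJ : Ind J) {m : ℕ} {t : TFam m} (ht : Tm t) : Sg 1 (fun M _ v => LF J M (t M v)) := by
  have V := fun {m : ℕ} (i : Fin m) => Tm.var i
  have h : Sg 1 (m := 1) (fun M _ v => Guaspari.LF J M (v 0)) := by
    unfold Guaspari.LF
    refine Sg.ex (Sg.ex (Sg.ex (Sg.ex (Sg.and (Sg.ball (V _) (Sg.ball (V _) ?_)) (D0.el (V _) (V _) (V _) (Tm.pr (V _) (V _))).sg))))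
    refine (Sg.or (D0.el (V 1) (V 2) (V 3) (Tm.pr (V 5) (V 6))).not.sg (hJ.sg.subst (ts := ![fun M _ w => w 1, fun M _ w => w 2, fun M _ w => w 3, fun M _ w => w 5, fun M _ w => w 6])
      (fun i => by fin_cases i <;> exact V _))).of_iff fun M _ v => ?_
    exact imp_iff_not_or
  exact h.subst (ts := fun _ => t) (fun _ => ht)

def GoodL (J : ∀ (M : Type) [PAM M], (M → Prop) → M → Prop) (l : List NS) : Prop :=
  ∀ r y : NS, pr r y ∈ l → J NS (fun y' => ∃ r' < r, pr r' y' ∈ l) y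

theorem LF_iff (hJ : Ind J) (x : NS) : LF J NS x ↔ ∃ l r, GoodL J l ∧ pr r x ∈ l := by
  constructor
  · rintro ⟨s, t, N, r, h, h'⟩
    -- elements bounded by N form a finite list
    classical
    let l : List NS := ((List.range (N.val + 1)).map NS.mk).filter (fun z => decide (El s t N z))
    have hl : ∀ z, z ∈ l ↔ El s t N z := by
      intro z
      simp only [l, List.mem_filter, List.mem_map, List.mem_range, decide_eq_true_eq]
      refine ⟨fun h => h.2, fun h => ⟨⟨z.val, ?_, rfl⟩, h⟩⟩
      have := ns_le.1 h.1
      omega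
    refine ⟨l, r, ?_, (hl _).2 h'⟩
    intro r y hy
    rw [hl] at hy
    refine hJ.mono _ _ _ ?_ (h r ((le_pr_left _ _).trans hy.1) y ((le_pr_right _ _).trans hy.1) hy)
    rintro z ⟨r', _, h1, h2⟩
    exact ⟨r', h1, (hl _).2 h2⟩
  · rintro ⟨l, r, h, h'⟩
    obtain ⟨N, hN⟩ := list_bdd l
    obtain ⟨s, t, hst⟩ := set_exists (finset_df l) N
    have hl : ∀ z, El s t N z ↔ z ∈ l := by
      intro z; rw [hst]; exact ⟨fun h => h.2, fun h => ⟨hN z h, h⟩⟩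
    refine ⟨s, t, N, r, ?_, (hl _).2 h'⟩
    intro r _ y _ hy
    rw [hl] at hy
    refine hJ.mono _ _ _ ?_ (h r y hy)
    rintro z ⟨r', h1, h2⟩
    exact ⟨r', (le_pr_left _ _).trans (hN _ h2), h1, (hl _).2 h2⟩

theorem LF_ind (hJ : Ind J) {A : NS → Prop} (hA : ∀ x, J NS A x → A x) {x : NS} (hx : LF J NS x) : A x := by
  obtain ⟨l, r, h, h'⟩ := (LF_iff hJ x).1 hx
  have key : ∀ (k : ℕ) (r : NS), r.val = k → ∀ y, pr r y ∈ l → A y := by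
    intro k
    induction k using Nat.strong_induction_on with
    | _ k ih =>
      rintro r rfl y hy
      refine hA _ (hJ.mono _ _ _ ?_ (h r y hy))
      rintro z ⟨r', h1, h2⟩
      exact ih _ (ns_lt.1 h1) r' rfl z h2
  exact key _ r rfl x h'

theorem GoodL.append (hJ : Ind J) {l l' : List NS} (h : GoodL J l) (h' : GoodL J l') : GoodL J (l ++ l') := by
  intro r y hy
  rcases List.mem_append.1 hy with hy | hy
  · refine hJ.mono _ _ _ ?_ (h r y hy)
    rintro z ⟨r', h1, h2⟩; exact ⟨r', h1, List.mem_append_left _ h2⟩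
  · refine hJ.mono _ _ _ ?_ (h' r y hy)
    rintro z ⟨r', h1, h2⟩; exact ⟨r', h1, List.mem_append_right _ h2⟩

theorem LF_intro (hJ : Ind J) {x : NS} (hx : J NS (fun y => LF J NS y) x) : LF J NS x := by
  obtain ⟨l0, h0, hx⟩ := hJ.fin _ _ hx
  have key : ∃ (L : List NS) (R : NS), GoodL J L ∧ ∀ y ∈ l0, ∃ r < R, pr r y ∈ L := by
    clear hx
    induction l0 with
    | nil => exact ⟨[], 0, fun r y h => by simp at h, by simp⟩
    | cons a l ih =>
      obtain ⟨L, R, h1, h2⟩ := ih (fun z hz => h0 z (List.mem_cons_of_mem _ hz))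
      obtain ⟨L', r', h3, h4⟩ := (LF_iff hJ a).1 (h0 a (by simp))
      refine ⟨L ++ L', R + (r' + 1), h1.append hJ h3, fun y hy => ?_⟩
      rcases List.mem_cons.1 hy with rfl | hy
      · exact ⟨r', lt_of_lt_of_le (lt_succ_iff'.2 le_rfl) le_add_self, List.mem_append_right _ h4⟩
      · obtain ⟨r, h5, h6⟩ := h2 y hy
        exact ⟨r, lt_of_lt_of_le h5 le_self_add, List.mem_append_left _ h6⟩
  obtain ⟨L, R, h1, h2⟩ := key
  refine (LF_iff hJ x).2 ⟨pr R x :: L, R, ?_, by simp⟩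
  intro r y hy
  rcases List.mem_cons.1 hy with e | hy
  · obtain ⟨rfl, rfl⟩ := pr_inj e
    refine hJ.mono _ _ _ ?_ hx
    intro z hz
    obtain ⟨r', h3, h4⟩ := h2 z hz
    exact ⟨r', h3, List.mem_cons_of_mem _ h4⟩
  · refine hJ.mono _ _ _ ?_ (h1 r y hy)
    rintro z ⟨r', h3, h4⟩; exact ⟨r', h3, List.mem_cons_of_mem _ h4⟩
end

end Guaspari

set_option linter.unusedSimpArgs false
set_option linter.unusedVariables false
namespace Guaspari

/-! ## Combinators for inductive definitions -/
abbrev IFam (m : ℕ) := ∀ (M : Type) [PAM M], (M → Prop) → (Fin m → M) → Prop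

structure IP {m : ℕ} (P : IFam m) : Prop where
  mono : ∀ (A A' : NS → Prop) v, (∀ z, A z → A' z) → P NS A v → P NS A' v
  fin : ∀ (A : NS → Prop) v, P NS A v → ∃ l : List NS, (∀ z ∈ l, A z) ∧ P NS (fun z => z ∈ l) v
  sg : ∀ (s t N r : TFam m), Tm s → Tm t → Tm N → Tm r →
    Sg 1 (fun M _ v => P M (fun y => AS (s M v) (t M v) (N M v) (r M v) y) v)

section
variable {m : ℕ}
theorem IP.call {t : TFam m} (ht : Tm t) : IP (fun M _ A v => A (t M v)) :=
  ⟨fun A A' v h h' => h _ h', fun A v h => ⟨[t NS v], by simpa using h, by simp⟩,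
    fun s t N r h1 h2 h3 h4 => Sg.AS h1 h2 h3 h4 ht⟩
theorem IP.side {P : Fam m} (h : Sg 1 P) : IP (fun M _ A v => P M v) :=
  ⟨fun A A' v h h' => h', fun A v h => ⟨[], by simp, h⟩, fun s t N r h1 h2 h3 h4 => h⟩
theorem IP.eq {t u : TFam m} (ht : Tm t) (hu : Tm u) : IP (fun M _ A v => t M v = u M v) :=
  IP.side (D0.eq ht hu).sg
theorem IP.and {P Q : IFam m} (h : IP P) (h' : IP Q) : IP (fun M _ A v => P M A v ∧ Q M A v) :=
  ⟨fun A A' v hA hv => ⟨h.mono _ _ _ hA hv.1, h'.mono _ _ _ hA hv.2⟩, fun A v hv => by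
    obtain ⟨l, hl, e⟩ := h.fin A v hv.1
    obtain ⟨l', hl', e'⟩ := h'.fin A v hv.2
    refine ⟨l ++ l', fun z hz => ?_, h.mono _ _ _ (fun z hz => List.mem_append_left _ hz) e, 
      h'.mono _ _ _ (fun z hz => List.mem_append_right _ hz) e'⟩
    rcases List.mem_append.1 hz with hz | hz
    · exact hl z hz
    · exact hl' z hz, fun s t N r h1 h2 h3 h4 => (h.sg s t N r h1 h2 h3 h4).and (h'.sg s t N r h1 h2 h3 h4)⟩
theorem IP.or {P Q : IFam m} (h : IP P) (h' : IP Q) : IP (fun M _ A v => P M A v ∨ Q M A v) :=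
  ⟨fun A A' v hA hv => hv.imp (h.mono _ _ _ hA) (h'.mono _ _ _ hA), fun A v hv => by
    rcases hv with hv | hv
    · obtain ⟨l, hl, e⟩ := h.fin A v hv
      exact ⟨l, hl, Or.inl e⟩
    · obtain ⟨l, hl, e⟩ := h'.fin A v hv
      exact ⟨l, hl, Or.inr e⟩, fun s t N r h1 h2 h3 h4 => (h.sg s t N r h1 h2 h3 h4).or (h'.sg s t N r h1 h2 h3 h4)⟩
theorem IP.ex {P : ∀ (M : Type) [PAM M], (M → Prop) → (Fin m → M) → M → Prop}
    (h : IP (m := m+1) (fun M _ A w => P M A (Fin.init w) (w (Fin.last m)))) : IP (fun M _ A v => ∃ y, P M A v y) := by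
  refine ⟨fun A A' v hA => ?_, fun A v => ?_, fun s t N r h1 h2 h3 h4 => ?_⟩
  · rintro ⟨y, hy⟩
    have := h.mono A A' (Fin.snoc v y) hA
    simp only [Fin.init_snoc, Fin.snoc_last] at this
    exact ⟨y, this hy⟩
  · rintro ⟨y, hy⟩
    have := h.fin A (Fin.snoc v y)
    simp only [Fin.init_snoc, Fin.snoc_last] at this
    obtain ⟨l, hl, e⟩ := this hy
    exact ⟨l, hl, y, e⟩
  · refine Sg.ex (h.sg (fun M _ w => s M (Fin.init w)) (fun M _ w => t M (Fin.init w)) (fun M _ w => N M (Fin.init w)) (fun M _ w => r M (Fin.init w)) ?_ ?_ ?_ ?_)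
    · exact Tm.subst h1 (ts := fun i M _ v => v i.castSucc) (fun i => Tm.var _)
    · exact Tm.subst h2 (ts := fun i M _ v => v i.castSucc) (fun i => Tm.var _)
    · exact Tm.subst h3 (ts := fun i M _ v => v i.castSucc) (fun i => Tm.var _)
    · exact Tm.subst h4 (ts := fun i M _ v => v i.castSucc) (fun i => Tm.var _)
end

theorem Ind.of {J : ∀ (M : Type) [PAM M], (M → Prop) → M → Prop} (h : IP (m := 5) (fun M _ A v => J M A (v 4))) : Ind J :=
  ⟨fun A A' x => h.mono A A' (fun _ => x), fun A x => h.fin A (fun _ => x), 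
    h.sg _ _ _ _ (Tm.var 0) (Tm.var 1) (Tm.var 2) (Tm.var 3)⟩

/-! ## Codes -/
section
variable {M : Type} [CommSemiring M]
def tg (n : ℕ) (x : M) : M := pr (n : M) x
def tvarC (j : M) : M := tg 0 j
def tzeroC : M := tg 1 (((0:ℕ) : M))
def tsuccC (a : M) : M := tg 2 a
def taddC (a b : M) : M := tg 3 (pr a b)
def tmulC (a b : M) : M := tg 4 (pr a b)
def ffalC : M := tg 0 (((0:ℕ) : M))
def feqC (a b : M) : M := tg 1 (pr a b)
def fleC (a b : M) : M := tg 2 (pr a b)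
def fimpC (a b : M) : M := tg 3 (pr a b)
def fallC (a : M) : M := tg 4 a
end

section
variable {m : ℕ} {t u : TFam m}
theorem Tm.tg (n : ℕ) (ht : Tm t) : Tm (fun M _ v => tg n (t M v)) := Tm.pr (Tm.cast n) ht
theorem Tm.tvarC (ht : Tm t) : Tm (fun M _ v => tvarC (t M v)) := Tm.tg _ ht
theorem Tm.tzeroC : Tm (fun M _ (v : Fin m → M) => (tzeroC : M)) := Tm.tg _ (Tm.cast _)
theorem Tm.tsuccC (ht : Tm t) : Tm (fun M _ v => tsuccC (t M v)) := Tm.tg _ ht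
theorem Tm.taddC (ht : Tm t) (hu : Tm u) : Tm (fun M _ v => taddC (t M v) (u M v)) := Tm.tg _ (Tm.pr ht hu)
theorem Tm.tmulC (ht : Tm t) (hu : Tm u) : Tm (fun M _ v => tmulC (t M v) (u M v)) := Tm.tg _ (Tm.pr ht hu)
theorem Tm.ffalC : Tm (fun M _ (v : Fin m → M) => (ffalC : M)) := Tm.tg _ (Tm.cast _)
theorem Tm.feqC (ht : Tm t) (hu : Tm u) : Tm (fun M _ v => feqC (t M v) (u M v)) := Tm.tg _ (Tm.pr ht hu)
theorem Tm.fleC (ht : Tm t) (hu : Tm u) : Tm (fun M _ v => fleC (t M v) (u M v)) := Tm.tg _ (Tm.pr ht hu)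
theorem Tm.fimpC (ht : Tm t) (hu : Tm u) : Tm (fun M _ v => fimpC (t M v) (u M v)) := Tm.tg _ (Tm.pr ht hu)
theorem Tm.fallC (ht : Tm t) : Tm (fun M _ v => fallC (t M v)) := Tm.tg _ ht
end

def tc {k : ℕ} : LA.Term (Empty ⊕ Fin k) → NS
  | .var (.inl e) => e.elim
  | .var (.inr i) => tvarC ((k - 1 - i : ℕ) : NS)
  | .func (l := 0) f ts => tzeroC
  | .func (l := 1) f ts => tsuccC (tc (ts 0))
  | .func (l := 2) f ts => cond (show Bool from f) (tmulC (tc (ts 0)) (tc (ts 1))) (taddC (tc (ts 0)) (tc (ts 1)))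
  | .func (l := _ + 3) f ts => (show Empty from f).elim

def fc : ∀ {k : ℕ}, LA.BoundedFormula Empty k → NS
  | _, .falsum => ffalC
  | _, .equal t u => feqC (tc t) (tc u)
  | _, .rel (l := 0) R ts => (show Empty from R).elim
  | _, .rel (l := 1) R ts => (show Empty from R).elim
  | _, .rel (l := 2) R ts => fleC (tc (ts 0)) (tc (ts 1))
  | _, .rel (l := _ + 3) R ts => (show Empty from R).elim
  | _, .imp a b => fimpC (fc a) (fc b)
  | _, .all a => fallC (fc a)

theorem tc_var {k : ℕ} (i : Fin k) : tc (vT i) = tvarC ((k - 1 - i : ℕ) : NS) := rfl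
theorem tc_zero {k : ℕ} : tc (zeroT : LA.Term (Empty ⊕ Fin k)) = tzeroC := rfl
theorem tc_succ {k : ℕ} (t : LA.Term (Empty ⊕ Fin k)) : tc (succT t) = tsuccC (tc t) := rfl
theorem tc_add {k : ℕ} (t u : LA.Term (Empty ⊕ Fin k)) : tc (addT t u) = taddC (tc t) (tc u) := rfl
theorem tc_mul {k : ℕ} (t u : LA.Term (Empty ⊕ Fin k)) : tc (mulT t u) = tmulC (tc t) (tc u) := rfl
theorem fc_fal {k : ℕ} : fc (.falsum : LA.BoundedFormula Empty k) = ffalC := rfl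
theorem fc_eq {k : ℕ} (t u : LA.Term (Empty ⊕ Fin k)) : fc (.equal t u) = feqC (tc t) (tc u) := rfl
theorem fc_le {k : ℕ} (t u : LA.Term (Empty ⊕ Fin k)) : fc (leF t u) = fleC (tc t) (tc u) := rfl
theorem fc_imp {k : ℕ} (a b : LA.BoundedFormula Empty k) : fc (.imp a b) = fimpC (fc a) (fc b) := rfl
theorem fc_all {k : ℕ} (a : LA.BoundedFormula Empty (k+1)) : fc (.all a) = fallC (fc a) := rfl

theorem tm_ind {k : ℕ} {P : LA.Term (Empty ⊕ Fin k) → Prop} (hv : ∀ i, P (vT i)) (hz : P zeroT)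
    (hs : ∀ t, P t → P (succT t)) (ha : ∀ t u, P t → P u → P (addT t u)) (hm : ∀ t u, P t → P u → P (mulT t u)) :
    ∀ t, P t := by
  intro t
  induction t with
  | var x =>
    rcases x with x | x
    · exact x.elim
    · exact hv x
  | @func l f ts ih =>
    match l, f, ts, ih with
    | 0, f, ts, ih =>
      have : (Term.func f ts) = (zeroT : LA.Term (Empty ⊕ Fin k)) := congrArg (Term.func f) (Subsingleton.elim _ _)
      rw [this]; exact hz
    | 1, f, ts, ih =>
      have : (Term.func f ts) = succT (ts 0) := by
        refine congrArg (Term.func f) ?_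
        funext i; fin_cases i; rfl
      rw [this]; exact hs _ (ih 0)
    | 2, false, ts, ih =>
      have : (Term.func (L := LA) (l := 2) false ts) = addT (ts 0) (ts 1) := by
        refine congrArg (Term.func (L := LA) (l := 2) false) ?_
        funext i; fin_cases i <;> rfl
      exact this ▸ ha _ _ (ih 0) (ih 1)
    | 2, true, ts, ih =>
      have : (Term.func (L := LA) (l := 2) true ts) = mulT (ts 0) (ts 1) := by
        refine congrArg (Term.func (L := LA) (l := 2) true) ?_
        funext i; fin_cases i <;> rfl
      exact this ▸ hm _ _ (ih 0) (ih 1)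
    | _ + 3, f, ts, ih => exact (show Empty from f).elim

theorem fm_ind {P : ∀ {k : ℕ}, LA.BoundedFormula Empty k → Prop} (hf : ∀ k, P (.falsum : LA.BoundedFormula Empty k))
    (he : ∀ k (t u : LA.Term (Empty ⊕ Fin k)), P (.equal t u)) (hl : ∀ k (t u : LA.Term (Empty ⊕ Fin k)), P (leF t u))
    (hi : ∀ k (a b : LA.BoundedFormula Empty k), P a → P b → P (.imp a b))
    (ha : ∀ k (a : LA.BoundedFormula Empty (k+1)), P a → P (.all a)) : ∀ {k : ℕ} (φ : LA.BoundedFormula Empty k), P φ := by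
  intro k φ
  induction φ with
  | falsum => exact hf _
  | equal t u => exact he _ t u
  | @rel n l R ts =>
    match l, R, ts with
    | 0, R, ts => exact (show Empty from R).elim
    | 1, R, ts => exact (show Empty from R).elim
    | 2, R, ts =>
      have : (BoundedFormula.rel R ts) = leF (ts 0) (ts 1) := by
        refine congrArg (BoundedFormula.rel R) ?_
        funext i; fin_cases i <;> rfl
      rw [this]; exact hl _ _ _
    | _ + 3, R, ts => exact (show Empty from R).elim
  | imp a b ih1 ih2 => exact hi _ a b ih1 ih2
  | all a ih => exact ha _ a ih

end Guaspari

set_option linter.unusedSimpArgs false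
set_option linter.unusedVariables false
namespace Guaspari

/-! ## Relating codes with the numbering of formulas -/
def CC {M : Type} [PAM M] (x r g : M) : Prop := ∃ z, PairF x r z ∧ g = z + 1
theorem Sg.CC {m : ℕ} {x r g : TFam m} (hx : Tm x) (hr : Tm r) (hg : Tm g) : Sg 1 (fun M _ v => CC (x M v) (r M v) (g M v)) := by
  have V := fun {m : ℕ} (i : Fin m) => Tm.var i
  have h : Sg 1 (m := 3) (fun M _ v => Guaspari.CC (v 0) (v 1) (v 2)) := by
    unfold Guaspari.CC
    exact Sg.ex (Sg.and (D0.pairF (V _) (V _) (V _)).sg (D0.eq (V _) ((V _).add Tm.one)).sg)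
  exact h.subst (ts := ![x, r, g]) (fun i => by fin_cases i <;> assumption)
theorem ns_CC (x r g : NS) : CC x r g ↔ g.val = Nat.pair x.val r.val + 1 := by
  unfold CC
  simp only [ns_pairF]
  simp [ns_ext, ns_valadd, ns_val1]
theorem IP.CC {m : ℕ} {x r g : TFam m} (hx : Tm x) (hr : Tm r) (hg : Tm g) : IP (fun M _ A v => CC (x M v) (r M v) (g M v)) :=
  IP.side (Sg.CC hx hr hg)

/-- concatenation of list codes -/
def cat {α : Type} [Encodable α] (l : List α) (r : ℕ) : ℕ := l.foldr (fun a s => Nat.pair (Encodable.encode a) s + 1) r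
theorem cat_nil {α : Type} [Encodable α] (r : ℕ) : cat ([] : List α) r = r := rfl
theorem cat_cons {α : Type} [Encodable α] (a : α) (l : List α) (r : ℕ) : cat (a :: l) r = Nat.pair (Encodable.encode a) (cat l r) + 1 := rfl
theorem cat_append {α : Type} [Encodable α] (l l' : List α) (r : ℕ) : cat (l ++ l') r = cat l (cat l' r) := by
  unfold cat; rw [List.foldr_append]
theorem cat_encode {α : Type} [Encodable α] (l : List α) : Encodable.encode l = cat l 0 := by
  induction l with
  | nil => rfl
  | cons a l ih => rw [Encodable.encode_list_cons, cat_cons, ih]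

def q4 {M : Type} [CommSemiring M] (k e r g : M) : M := pr k (pr e (pr r g))
theorem Tm.q4 {m : ℕ} {a b c d : TFam m} (ha : Tm a) (hb : Tm b) (hc : Tm c) (hd : Tm d) :
    Tm (fun M _ v => q4 (a M v) (b M v) (c M v) (d M v)) := Tm.pr ha (Tm.pr hb (Tm.pr hc hd))
theorem q4_inj {a b c d a' b' c' d' : NS} (h : q4 a b c d = q4 a' b' c' d') : a = a' ∧ b = b' ∧ c = c' ∧ d = d' := by
  simpa [q4] using h

def JT (M : Type) [PAM M] (A : M → Prop) (x : M) : Prop :=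
  ∃ k e r g, x = q4 k e r g ∧ (
    (∃ i j, k = i + j + 1 ∧ e = tvarC j ∧ CC (((2:ℕ):M) * (((2:ℕ):M) * i + 1)) r g) ∨
    (e = tzeroC ∧ CC ((1:ℕ):M) r g) ∨
    (∃ a g', e = tsuccC a ∧ A (q4 k a r g') ∧ CC ((5:ℕ):M) g' g) ∨
    (∃ a b g' g'', A (q4 k b r g') ∧ A (q4 k a g' g'') ∧
      ((e = taddC a b ∧ CC ((13:ℕ):M) g'' g) ∨ (e = tmulC a b ∧ CC ((15:ℕ):M) g'' g))))

theorem JT_ind : Ind JT := by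
  apply Ind.of
  unfold JT
  repeat' first | with_reducible apply IP.CC | with_reducible apply IP.ex | with_reducible apply IP.and | with_reducible apply IP.or | with_reducible apply IP.eq | with_reducible apply IP.call | with_reducible apply Tm.q4 | with_reducible apply Tm.tvarC | with_reducible apply Tm.tzeroC | with_reducible apply Tm.tsuccC | with_reducible apply Tm.taddC | with_reducible apply Tm.tmulC | with_reducible apply Tm.cast | with_reducible apply Tm.one | with_reducible apply Tm.add | with_reducible apply Tm.mul | exact Tm.var _

theorem enc_var {k : ℕ} (i : Fin k) : Encodable.encode (Sum.inl (Sum.inr i) : (Empty ⊕ Fin k) ⊕ (Σ i, LA.Functions i)) = 2 * (2 * i + 1) := rfl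
theorem enc_zero {k : ℕ} : Encodable.encode (Sum.inr ⟨0, Unit.unit⟩ : (Empty ⊕ Fin k) ⊕ (Σ i, LA.Functions i)) = 1 := rfl
theorem enc_succ {k : ℕ} : Encodable.encode (Sum.inr ⟨1, Unit.unit⟩ : (Empty ⊕ Fin k) ⊕ (Σ i, LA.Functions i)) = 5 := rfl
theorem enc_add {k : ℕ} : Encodable.encode (Sum.inr ⟨2, false⟩ : (Empty ⊕ Fin k) ⊕ (Σ i, LA.Functions i)) = 13 := rfl
theorem enc_mul {k : ℕ} : Encodable.encode (Sum.inr ⟨2, true⟩ : (Empty ⊕ Fin k) ⊕ (Σ i, LA.Functions i)) = 15 := rfl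

section
variable {k : ℕ}
theorem cat_vT (i : Fin k) (r : ℕ) : cat (vT i).listEncode r = Nat.pair (2 * (2 * i + 1)) r + 1 := by
  rw [← enc_var i]; rfl
theorem cat_zeroT (r : ℕ) : cat (zeroT : LA.Term (Empty ⊕ Fin k)).listEncode r = Nat.pair 1 r + 1 := by
  rw [← enc_zero (k := k)]; rfl
theorem cat_succT (t : LA.Term (Empty ⊕ Fin k)) (r : ℕ) : cat (succT t).listEncode r = Nat.pair 5 (cat t.listEncode r) + 1 := by
  have : (succT t).listEncode = Sum.inr ⟨1, Unit.unit⟩ :: (t.listEncode ++ []) := rfl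
  rw [this, cat_cons, List.append_nil, enc_succ]
theorem cat_addT (t u : LA.Term (Empty ⊕ Fin k)) (r : ℕ) : cat (addT t u).listEncode r = Nat.pair 13 (cat t.listEncode (cat u.listEncode r)) + 1 := by
  have : (addT t u).listEncode = Sum.inr ⟨2, false⟩ :: (t.listEncode ++ (u.listEncode ++ [])) := rfl
  rw [this, cat_cons, List.append_nil, cat_append, enc_add]
theorem cat_mulT (t u : LA.Term (Empty ⊕ Fin k)) (r : ℕ) : cat (mulT t u).listEncode r = Nat.pair 15 (cat t.listEncode (cat u.listEncode r)) + 1 := by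
  have : (mulT t u).listEncode = Sum.inr ⟨2, true⟩ :: (t.listEncode ++ (u.listEncode ++ [])) := rfl
  rw [this, cat_cons, List.append_nil, cat_append, enc_mul]
end

theorem GT_complete {k : ℕ} (t : LA.Term (Empty ⊕ Fin k)) : ∀ r : ℕ, 
    LF JT NS (q4 (k : NS) (tc t) (r : NS) ((cat t.listEncode r : ℕ) : NS)) := by
  refine tm_ind (P := fun t => ∀ r : ℕ, LF JT NS (q4 (k : NS) (tc t) (r : NS) ((cat t.listEncode r : ℕ) : NS))) ?_ ?_ ?_ ?_ ?_ t
  · intro i r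
    refine LF_intro JT_ind ⟨_, _, _, _, rfl, Or.inl ⟨((i : ℕ) : NS), ((k - 1 - i : ℕ) : NS), ?_, tc_var i, ?_⟩⟩
    · rw [← Nat.cast_add, ← Nat.cast_succ]; congr 1; have := i.2; omega
    · rw [ns_CC, cat_vT]; simp only [ns_castval, ns_valmul, ns_valadd, ns_val1]
  · intro r
    refine LF_intro JT_ind ⟨_, _, _, _, rfl, Or.inr (Or.inl ⟨tc_zero, ?_⟩)⟩
    rw [ns_CC, cat_zeroT, ns_castval, ns_castval, ns_castval]
  · intro t ih r
    refine LF_intro JT_ind ⟨_, _, _, _, rfl, Or.inr (Or.inr (Or.inl ⟨_, _, tc_succ t, ih r, ?_⟩))⟩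
    rw [ns_CC, cat_succT, ns_castval, ns_castval, ns_castval]
  · intro t u iht ihu r
    refine LF_intro JT_ind ⟨_, _, _, _, rfl, Or.inr (Or.inr (Or.inr ⟨_, _, _, _, ihu r, iht _, Or.inl ⟨tc_add t u, ?_⟩⟩))⟩
    rw [ns_CC, cat_addT, ns_castval, ns_castval, ns_castval]
  · intro t u iht ihu r
    refine LF_intro JT_ind ⟨_, _, _, _, rfl, Or.inr (Or.inr (Or.inr ⟨_, _, _, _, ihu r, iht _, Or.inr ⟨tc_mul t u, ?_⟩⟩))⟩
    rw [ns_CC, cat_mulT, ns_castval, ns_castval, ns_castval]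

theorem GT_sound (k : ℕ) (e r g : NS) (h : LF JT NS (q4 (k : NS) e r g)) :
    ∃ t : LA.Term (Empty ⊕ Fin k), e = tc t ∧ g.val = cat t.listEncode r.val := by
  have key := LF_ind JT_ind (A := fun x => ∀ (k : ℕ) e r g, x = q4 (k:NS) e r g → 
    ∃ t : LA.Term (Empty ⊕ Fin k), e = tc t ∧ g.val = cat t.listEncode r.val) ?_ h
  · exact key k e r g rfl
  · rintro x ⟨k', e, r, g, rfl, hx⟩ k e' r' g' hq
    obtain ⟨rfl, rfl, rfl, rfl⟩ := q4_inj hq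
    rcases hx with ⟨i, j, h1, rfl, h2⟩ | ⟨rfl, h2⟩ | ⟨a, g1, rfl, h1, h2⟩ | ⟨a, b, g1, g2, h1, h2, h3⟩
    · have hk : k = i.val + j.val + 1 := by
        rw [ns_ext, ns_castval, ns_valadd, ns_valadd, ns_val1] at h1; exact h1
      refine ⟨vT ⟨i.val, by omega⟩, ?_, ?_⟩
      · rw [tc_var]; congr 1; rw [ns_ext, ns_castval]; simp; omega
      · rw [ns_CC] at h2; rw [cat_vT, h2]; simp only [ns_castval, ns_valmul, ns_valadd, ns_val1]
    · refine ⟨zeroT, rfl, ?_⟩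
      rw [ns_CC, ns_castval] at h2; rw [cat_zeroT, h2]
    · obtain ⟨t, rfl, h3⟩ := h1 _ _ _ _ rfl
      refine ⟨succT t, rfl, ?_⟩
      rw [ns_CC, ns_castval] at h2; rw [cat_succT, h2, h3]
    · obtain ⟨u, rfl, h4⟩ := h1 _ _ _ _ rfl
      obtain ⟨t, rfl, h5⟩ := h2 _ _ _ _ rfl
      rcases h3 with ⟨rfl, h3⟩ | ⟨rfl, h3⟩
      · refine ⟨addT t u, rfl, ?_⟩
        rw [ns_CC, ns_castval] at h3; rw [cat_addT, h3, h5, h4]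
      · refine ⟨mulT t u, rfl, ?_⟩
        rw [ns_CC, ns_castval] at h3; rw [cat_mulT, h3, h5, h4]

/-! formulas -/
/-- code of the symbol attached to a term -/
def TI {M : Type} [PAM M] (k a x : M) : Prop := ∃ g z, LF JT M (q4 k a ((0:ℕ):M) g) ∧ PairF k g z ∧ x = ((2:ℕ):M) * z
theorem Sg.TI {m : ℕ} {x r g : TFam m} (hx : Tm x) (hr : Tm r) (hg : Tm g) : Sg 1 (fun M _ v => TI (x M v) (r M v) (g M v)) := by
  have V := fun {m : ℕ} (i : Fin m) => Tm.var i
  have h : Sg 1 (m := 3) (fun M _ v => Guaspari.TI (v 0) (v 1) (v 2)) := by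
    unfold Guaspari.TI
    exact Sg.ex (Sg.ex (Sg.and (Sg.LF JT_ind (Tm.q4 (V _) (V _) (Tm.cast _) (V _))) 
      (Sg.and (D0.pairF (V _) (V _) (V _)).sg (D0.eq (V _) ((Tm.cast _).mul (V _))).sg)))
  exact h.subst (ts := ![x, r, g]) (fun i => by fin_cases i <;> assumption)
theorem IP.TI {m : ℕ} {x r g : TFam m} (hx : Tm x) (hr : Tm r) (hg : Tm g) : IP (fun M _ A v => TI (x M v) (r M v) (g M v)) :=
  IP.side (Sg.TI hx hr hg)

abbrev Sym := (Σ k, LA.Term (Empty ⊕ Fin k)) ⊕ ((Σ n, LA.Relations n) ⊕ ℕ)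

theorem enc_term {k : ℕ} (t : LA.Term (Empty ⊕ Fin k)) : Encodable.encode (Sum.inl ⟨k, t⟩ : Sym) = 2 * Nat.pair k (cat t.listEncode 0) := by
  rw [← cat_encode]; rfl

theorem ns_TI (k : ℕ) (a x : NS) : TI (k:NS) a x ↔ ∃ t : LA.Term (Empty ⊕ Fin k), a = tc t ∧ x.val = Encodable.encode (Sum.inl ⟨k, t⟩ : Sym) := by
  constructor
  · rintro ⟨g, z, h1, h2, rfl⟩
    obtain ⟨t, rfl, h⟩ := GT_sound _ _ _ _ h1
    refine ⟨t, rfl, ?_⟩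
    rw [ns_pairF] at h2
    rw [enc_term, h2, ns_valmul, ns_castval, h, ns_castval, ns_castval]
  · rintro ⟨t, rfl, h⟩
    refine ⟨_, _, GT_complete t 0, (ns_pairF _ _ _).2 rfl, ?_⟩
    rw [ns_ext, h, enc_term, ns_valmul, ns_castval, ns_castval, ns_castval]

def JF (M : Type) [PAM M] (A : M → Prop) (x : M) : Prop :=
  ∃ k e r g, x = q4 k e r g ∧ (
    (e = ffalC ∧ CC (((2:ℕ):M) * (((2:ℕ):M) * (k + ((2:ℕ):M)) + 1) + 1) r g) ∨
    (∃ a b x y g' g'', TI k a x ∧ TI k b y ∧ CC y r g' ∧ CC x g' g'' ∧ ((e = feqC a b ∧ g = g'') ∨ 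
      (e = fleC a b ∧ ∃ gx3, CC (((2:ℕ):M) * (((2:ℕ):M) * k + 1) + 1) g'' gx3 ∧ CC ((25:ℕ):M) gx3 g))) ∨
    (∃ a b g' g'', A (q4 k b r g') ∧ A (q4 k a g' g'') ∧ e = fimpC a b ∧ CC ((3:ℕ):M) g'' g) ∨
    (∃ a g', e = fallC a ∧ A (q4 (k+1) a r g') ∧ CC ((7:ℕ):M) g' g))

theorem JF_ind : Ind JF := by
  apply Ind.of
  unfold JF
  repeat' first | with_reducible apply IP.CC | with_reducible apply IP.TI | with_reducible apply IP.ex | with_reducible apply IP.and | with_reducible apply IP.or | with_reducible apply IP.eq | with_reducible apply IP.call | with_reducible apply Tm.q4 | with_reducible apply Tm.ffalC | with_reducible apply Tm.feqC | with_reducible apply Tm.fleC | with_reducible apply Tm.fimpC | with_reducible apply Tm.fallC | with_reducible apply Tm.cast | with_reducible apply Tm.one | with_reducible apply Tm.add | with_reducible apply Tm.mul | exact Tm.var _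

section
variable {k : ℕ}
theorem cat_fal (r : ℕ) : cat (BoundedFormula.listEncode (.falsum : LA.BoundedFormula Empty k)) r = Nat.pair (2 * (2 * (k+2) + 1) + 1) r + 1 := by
  show Nat.pair (Encodable.encode (Sum.inr (Sum.inr (k+2)) : Sym)) r + 1 = _
  simp
theorem cat_eq (t u : LA.Term (Empty ⊕ Fin k)) (r : ℕ) : cat (BoundedFormula.listEncode (.equal t u)) r =
    Nat.pair (Encodable.encode (Sum.inl ⟨k, t⟩ : Sym)) (Nat.pair (Encodable.encode (Sum.inl ⟨k, u⟩ : Sym)) r + 1) + 1 := rfl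
theorem cat_le (t u : LA.Term (Empty ⊕ Fin k)) (r : ℕ) : cat (BoundedFormula.listEncode (leF t u)) r = Nat.pair 25 (Nat.pair (2 * (2 * k + 1) + 1)
    (Nat.pair (Encodable.encode (Sum.inl ⟨k, t⟩ : Sym)) (Nat.pair (Encodable.encode (Sum.inl ⟨k, u⟩ : Sym)) r + 1) + 1) + 1) + 1 := by
  have e1 : Encodable.encode (Sum.inr (Sum.inl ⟨2, Unit.unit⟩) : Sym) = 25 := rfl
  have e2 : Encodable.encode (Sum.inr (Sum.inr k) : Sym) = 2 * (2 * k + 1) + 1 := by simp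
  rw [← e1, ← e2]
  rfl
theorem cat_imp (a b : LA.BoundedFormula Empty k) (r : ℕ) : cat (BoundedFormula.listEncode (.imp a b)) r = 
    Nat.pair 3 (cat a.listEncode (cat b.listEncode r)) + 1 := by
  show cat ((Sum.inr (Sum.inr 0)::a.listEncode) ++ b.listEncode : List Sym) r = _
  have e1 : Encodable.encode (Sum.inr (Sum.inr 0) : Sym) = 3 := by simp
  rw [cat_append, cat_cons, e1]
theorem cat_all (a : LA.BoundedFormula Empty (k+1)) (r : ℕ) : cat (BoundedFormula.listEncode (.all a)) r = Nat.pair 7 (cat a.listEncode r) + 1 := by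
  show cat ((Sum.inr (Sum.inr 1)::a.listEncode) : List Sym) r = _
  have e1 : Encodable.encode (Sum.inr (Sum.inr 1) : Sym) = 7 := by simp
  rw [cat_cons, e1]
end

theorem GF_complete {k : ℕ} (φ : LA.BoundedFormula Empty k) : ∀ r : ℕ, 
    LF JF NS (q4 (k : NS) (fc φ) (r : NS) ((cat φ.listEncode r : ℕ) : NS)) := by
  refine fm_ind (P := fun {k} φ => ∀ r : ℕ, LF JF NS (q4 (k : NS) (fc φ) (r : NS) ((cat φ.listEncode r : ℕ) : NS))) ?_ ?_ ?_ ?_ ?_ φ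
  · intro k r
    refine LF_intro JF_ind ⟨_, _, _, _, rfl, Or.inl ⟨rfl, ?_⟩⟩
    rw [ns_CC, cat_fal]; simp only [ns_castval, ns_valmul, ns_valadd, ns_val1]
  · intro k t u r
    refine LF_intro JF_ind ⟨_, _, _, _, rfl, Or.inr (Or.inl ⟨tc t, tc u, _, _, _, _, (ns_TI _ _ (NS.mk _)).2 ⟨t, rfl, rfl⟩, 
      (ns_TI _ _ (NS.mk _)).2 ⟨u, rfl, rfl⟩, (ns_CC _ _ (NS.mk _)).2 rfl, (ns_CC _ _ (NS.mk _)).2 rfl, Or.inl ⟨rfl, ?_⟩⟩)⟩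
    rw [ns_ext, cat_eq, ns_castval, ns_castval]
  · intro k t u r
    refine LF_intro JF_ind ⟨_, _, _, _, rfl, Or.inr (Or.inl ⟨tc t, tc u, _, _, _, _, (ns_TI _ _ (NS.mk _)).2 ⟨t, rfl, rfl⟩, 
      (ns_TI _ _ (NS.mk _)).2 ⟨u, rfl, rfl⟩, (ns_CC _ _ (NS.mk _)).2 rfl, (ns_CC _ _ (NS.mk _)).2 rfl, Or.inr ⟨rfl, _, (ns_CC _ _ (NS.mk _)).2 rfl, ?_⟩⟩)⟩
    rw [ns_CC, cat_le, ns_castval, ns_castval, ns_castval]; simp only [ns_castval, ns_valmul, ns_valadd, ns_val1]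
  · intro k a b iha ihb r
    refine LF_intro JF_ind ⟨_, _, _, _, rfl, Or.inr (Or.inr (Or.inl ⟨_, _, _, _, ihb r, iha _, rfl, ?_⟩))⟩
    rw [ns_CC, cat_imp, ns_castval, ns_castval, ns_castval]
  · intro k a ih r
    refine LF_intro JF_ind ⟨_, _, _, _, rfl, Or.inr (Or.inr (Or.inr ⟨_, ((cat a.listEncode r : ℕ) : NS), rfl, ?_, ?_⟩))⟩
    · have := ih r; rwa [Nat.cast_succ] at this
    · rw [ns_CC, cat_all, ns_castval, ns_castval, ns_castval]

theorem GF_sound (k : ℕ) (e r g : NS) (h : LF JF NS (q4 (k : NS) e r g)) :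
    ∃ φ : LA.BoundedFormula Empty k, e = fc φ ∧ g.val = cat φ.listEncode r.val := by
  have key := LF_ind JF_ind (A := fun x => ∀ (k : ℕ) e r g, x = q4 (k:NS) e r g → 
    ∃ φ : LA.BoundedFormula Empty k, e = fc φ ∧ g.val = cat φ.listEncode r.val) ?_ h
  · exact key k e r g rfl
  · rintro x ⟨k', e, r, g, rfl, hx⟩ k e' r' g' hq
    obtain ⟨rfl, rfl, rfl, rfl⟩ := q4_inj hq
    rcases hx with ⟨rfl, h2⟩ | ⟨a, b, x, y, g', g'', hx, hy, h1, h2, h3⟩ | ⟨a, b, g1, g2, h1, h2, rfl, h3⟩ | ⟨a, g1, rfl, h1, h2⟩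
    · refine ⟨.falsum, rfl, ?_⟩
      rw [ns_CC] at h2; rw [cat_fal, h2]; simp only [ns_castval, ns_valmul, ns_valadd, ns_val1]
    · rw [ns_TI] at hx hy
      obtain ⟨t, rfl, hx⟩ := hx
      obtain ⟨u, rfl, hy⟩ := hy
      rw [ns_CC] at h1 h2
      rcases h3 with ⟨rfl, rfl⟩ | ⟨rfl, g3, h3, h4⟩
      · exact ⟨.equal t u, rfl, by rw [cat_eq, h2, h1, hx, hy]⟩
      · refine ⟨leF t u, rfl, ?_⟩
        rw [ns_CC] at h3 h4
        rw [cat_le, h4, h3, h2, h1, hx, hy]; simp only [ns_castval, ns_valmul, ns_valadd, ns_val1]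
    · obtain ⟨u, rfl, h4⟩ := h1 _ _ _ _ rfl
      obtain ⟨t, rfl, h5⟩ := h2 _ _ _ _ rfl
      refine ⟨.imp t u, rfl, ?_⟩
      rw [ns_CC, ns_castval] at h3; rw [cat_imp, h3, h5, h4]
    · obtain ⟨t, rfl, h3⟩ := h1 (k+1) _ _ _ (by rw [Nat.cast_succ])
      refine ⟨.all t, rfl, ?_⟩
      rw [ns_CC, ns_castval] at h2; rw [cat_all, h2, h3]

theorem gnum_eq (φ : Snt) : gnum φ = cat (BoundedFormula.listEncode φ) 0 := by
  rw [← cat_encode]; rfl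

theorem gnum_inj {φ ψ : Snt} (h : gnum φ = gnum ψ) : φ = ψ := by
  have h1 := BoundedFormula.encoding.encode_injective (Encodable.encode_injective h)
  simpa using h1

/-- The set of codes of axioms of a computable theory is `Σ_1`. -/
theorem ax_sigma {T : Thy} (hT : CompThy T) : ∃ F : Fam 1, Sg 1 F ∧ ∀ x : NS, F NS ![x] ↔ ∃ φ ∈ T, x = fc φ := by
  have V := fun {m : ℕ} (i : Fin m) => Tm.var i
  obtain ⟨Q, hQ, hQ'⟩ := re_D0 hT.to_re
  refine ⟨fun M _ v => ∃ g s, LF JF M (q4 ((0:ℕ):M) (v 0) ((0:ℕ):M) g) ∧ Q M ![g, s], ?_, ?_⟩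
  · refine Sg.ex (Sg.ex (Sg.and (Sg.LF JF_ind (Tm.q4 (Tm.cast _) (V _) (Tm.cast _) (V _))) ?_))
    refine (hQ.subst (ts := ![fun M _ w => w 1, fun M _ w => w 2]) (fun i => by fin_cases i <;> exact Tm.var _)).sg.of_iff fun M _ v => ?_
    apply iff_of_eq; congr 1; funext i; fin_cases i <;> rfl
  · intro x
    constructor
    · rintro ⟨g, s, h1, h2⟩
      obtain ⟨φ, h3, h4⟩ := GF_sound _ _ _ _ h1
      rw [ns_castval] at h4
      have h5 := (hQ' g.val).2 ⟨s.val, by rw [← ns_surj, ← ns_surj]; exact h2⟩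
      obtain ⟨φ', h6, h7⟩ := h5
      have : φ' = φ := gnum_inj (by rw [h7, h4, gnum_eq])
      subst this
      exact ⟨_, h6, h3⟩
    · rintro ⟨φ, hφ, rfl⟩
      obtain ⟨s, hs⟩ := (hQ' (gnum φ)).1 ⟨φ, hφ, rfl⟩
      refine ⟨_, (s : NS), GF_complete φ 0, ?_⟩
      exact (gnum_eq φ) ▸ hs

end Guaspari

set_option linter.unusedSimpArgs false
set_option linter.unusedVariables false
namespace Guaspari

/-! ## A propositional calculus for first-order consequence -/
section
variable {M : Type} [CommSemiring M]
def eqB (a b : M) : M := tg 0 (pr a b)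
def leB (a b : M) : M := tg 1 (pr a b)
def satB (e w : M) : M := tg 2 (pr e w)
def nmN (k : M) : M := tg 0 k
def scN (a : M) : M := tg 1 a
def adN (a b : M) : M := tg 2 (pr a b)
def mlN (a b : M) : M := tg 3 (pr a b)
def clN (t w : M) : M := tg 4 (pr t w)
def wtN (e w : M) : M := tg 5 (pr e w)
def posL (b : M) : M := pr b ((2:ℕ):M)
def negL (b : M) : M := pr b ((1:ℕ):M)
end
section
variable {m : ℕ} {t u : TFam m}
theorem Tm.eqB (ht : Tm t) (hu : Tm u) : Tm (fun M _ v => eqB (t M v) (u M v)) := Tm.tg _ (Tm.pr ht hu)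
theorem Tm.leB (ht : Tm t) (hu : Tm u) : Tm (fun M _ v => leB (t M v) (u M v)) := Tm.tg _ (Tm.pr ht hu)
theorem Tm.satB (ht : Tm t) (hu : Tm u) : Tm (fun M _ v => satB (t M v) (u M v)) := Tm.tg _ (Tm.pr ht hu)
theorem Tm.nmN (ht : Tm t) : Tm (fun M _ v => nmN (t M v)) := Tm.tg _ ht
theorem Tm.scN (ht : Tm t) : Tm (fun M _ v => scN (t M v)) := Tm.tg _ ht
theorem Tm.adN (ht : Tm t) (hu : Tm u) : Tm (fun M _ v => adN (t M v) (u M v)) := Tm.tg _ (Tm.pr ht hu)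
theorem Tm.mlN (ht : Tm t) (hu : Tm u) : Tm (fun M _ v => mlN (t M v) (u M v)) := Tm.tg _ (Tm.pr ht hu)
theorem Tm.clN (ht : Tm t) (hu : Tm u) : Tm (fun M _ v => clN (t M v) (u M v)) := Tm.tg _ (Tm.pr ht hu)
theorem Tm.wtN (ht : Tm t) (hu : Tm u) : Tm (fun M _ v => wtN (t M v) (u M v)) := Tm.tg _ (Tm.pr ht hu)
theorem Tm.posL (ht : Tm t) : Tm (fun M _ v => posL (t M v)) := Tm.pr ht (Tm.cast _)
theorem Tm.negL (ht : Tm t) : Tm (fun M _ v => negL (t M v)) := Tm.pr ht (Tm.cast _)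
theorem Sg.eq1 (ht : Tm t) (hu : Tm u) : Sg 1 (fun M _ v => t M v = u M v) := (D0.eq ht hu).sg
end

def UE {M : Type} [PAM M] (a b : M) : Prop :=
  a = b ∨ (∃ k, a = nmN (k + 1) ∧ b = scN (nmN k)) ∨ (∃ y w, a = clN (tvarC 0) (pr y w) ∧ b = y) ∨
  (∃ j y w, a = clN (tvarC (j+1)) (pr y w) ∧ b = clN (tvarC j) w) ∨ (∃ w, a = clN tzeroC w ∧ b = nmN 0) ∨
  (∃ t w, a = clN (tsuccC t) w ∧ b = scN (clN t w)) ∨ (∃ t u w, a = clN (taddC t u) w ∧ b = adN (clN t w) (clN u w)) ∨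
  (∃ t u w, a = clN (tmulC t u) w ∧ b = mlN (clN t w) (clN u w))
def EI {M : Type} [PAM M] (a b a' b' : M) : Prop :=
  (a' = scN a ∧ b' = scN b) ∨ ∃ c, (a' = adN a c ∧ b' = adN b c) ∨ (a' = adN c a ∧ b' = adN c b) ∨ 
    (a' = mlN a c ∧ b' = mlN b c) ∨ (a' = mlN c a ∧ b' = mlN c b)
def BI {M : Type} [PAM M] (a b : M) : Prop :=
  ∃ t u w, (a = satB (feqC t u) w ∧ b = eqB (clN t w) (clN u w)) ∨ (a = satB (fleC t u) w ∧ b = leB (clN t w) (clN u w))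

theorem Sg.UE {m : ℕ} {t u : TFam m} (ht : Tm t) (hu : Tm u) : Sg 1 (fun M _ v => UE (t M v) (u M v)) := by
  have h : Sg 1 (m := 2) (fun M _ v => Guaspari.UE (v 0) (v 1)) := by
    unfold Guaspari.UE
    repeat' first | with_reducible apply Sg.ex | with_reducible apply Sg.and | with_reducible apply Sg.or | with_reducible apply Sg.eq1 | with_reducible apply Tm.nmN | with_reducible apply Tm.scN | with_reducible apply Tm.adN | with_reducible apply Tm.mlN | with_reducible apply Tm.clN | with_reducible apply Tm.tvarC | with_reducible apply Tm.tzeroC | with_reducible apply Tm.tsuccC | with_reducible apply Tm.taddC | with_reducible apply Tm.tmulC | with_reducible apply Tm.pr | with_reducible apply Tm.zero | with_reducible apply Tm.one | with_reducible apply Tm.add | exact Tm.var _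
  exact h.subst (ts := ![t, u]) (fun i => by fin_cases i <;> assumption)
theorem Sg.EI {m : ℕ} {t u t' u' : TFam m} (ht : Tm t) (hu : Tm u) (ht' : Tm t') (hu' : Tm u') : Sg 1 (fun M _ v => EI (t M v) (u M v) (t' M v) (u' M v)) := by
  have h : Sg 1 (m := 4) (fun M _ v => Guaspari.EI (v 0) (v 1) (v 2) (v 3)) := by
    unfold Guaspari.EI
    repeat' first | with_reducible apply Sg.ex | with_reducible apply Sg.and | with_reducible apply Sg.or | with_reducible apply Sg.eq1 | with_reducible apply Tm.scN | with_reducible apply Tm.adN | with_reducible apply Tm.mlN | exact Tm.var _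
  exact h.subst (ts := ![t, u, t', u']) (fun i => by fin_cases i <;> assumption)
theorem Sg.BI {m : ℕ} {t u : TFam m} (ht : Tm t) (hu : Tm u) : Sg 1 (fun M _ v => BI (t M v) (u M v)) := by
  have h : Sg 1 (m := 2) (fun M _ v => Guaspari.BI (v 0) (v 1)) := by
    unfold Guaspari.BI
    repeat' first | with_reducible apply Sg.ex | with_reducible apply Sg.and | with_reducible apply Sg.or | with_reducible apply Sg.eq1 | with_reducible apply Tm.satB | with_reducible apply Tm.eqB | with_reducible apply Tm.leB | with_reducible apply Tm.clN | with_reducible apply Tm.feqC | with_reducible apply Tm.fleC | exact Tm.var _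
  exact h.subst (ts := ![t, u]) (fun i => by fin_cases i <;> assumption)

def Cl {M : Type} [PAM M] (F : Fam 1) (x1 x2 x3 : M) : Prop :=
  (∃ a b, UE a b ∧ x1 = negL (eqB a b) ∧ x2 = x1 ∧ x3 = x1) ∨
  (∃ a b c, x1 = posL (eqB a b) ∧ x2 = posL (eqB a c) ∧ x3 = negL (eqB b c)) ∨
  (∃ a b a' b', EI a b a' b' ∧ x1 = posL (eqB a b) ∧ x2 = negL (eqB a' b') ∧ x3 = x2) ∨
  (∃ a b c, x1 = posL (eqB a b) ∧ ((x2 = posL (leB a c) ∧ x3 = negL (leB b c)) ∨ (x2 = posL (leB c a) ∧ x3 = negL (leB c b)))) ∨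
  (∃ a b, BI a b ∧ ((x1 = posL a ∧ x2 = negL b) ∨ (x1 = negL a ∧ x2 = posL b)) ∧ x3 = x2) ∨
  (∃ w, x1 = posL (satB ffalC w) ∧ x2 = x1 ∧ x3 = x1) ∨
  (∃ a b w, (x1 = posL (satB (fimpC a b) w) ∧ x2 = posL (satB a w) ∧ x3 = negL (satB b w)) ∨
    (x1 = negL (satB (fimpC a b) w) ∧ (x2 = negL (satB a w) ∨ x2 = posL (satB b w)) ∧ x3 = x2)) ∨
  (∃ a w y, x1 = posL (satB (fallC a) w) ∧ x2 = negL (satB a (pr y w)) ∧ x3 = x2) ∨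
  (∃ a w, x1 = negL (satB (fallC a) w) ∧ x2 = posL (satB a (pr (wtN a w) w)) ∧ x3 = x2) ∨
  (∃ e, F M ![e] ∧ x1 = negL (satB e 0) ∧ x2 = x1 ∧ x3 = x1)

theorem sub1 {F : Fam 1} (hF : Sg 1 F) {m : ℕ} {t : TFam m} (ht : Tm t) : Sg 1 (fun M _ v => F M ![t M v]) := by
  refine (hF.subst (ts := ![t]) (fun i => by fin_cases i <;> assumption)).of_iff fun M _ v => ?_
  apply iff_of_eq; congr 1; funext i; fin_cases i <;> rfl

theorem Sg.Cl {F : Fam 1} (hF : Sg 1 F) {m : ℕ} {t u w : TFam m} (ht : Tm t) (hu : Tm u) (hw : Tm w) : Sg 1 (fun M _ v => Cl F (t M v) (u M v) (w M v)) := by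
  have h : Sg 1 (m := 3) (fun M _ v => Guaspari.Cl F (v 0) (v 1) (v 2)) := by
    unfold Guaspari.Cl
    repeat' first | with_reducible apply Sg.UE | with_reducible apply Sg.EI | with_reducible apply Sg.BI | with_reducible apply sub1 hF | with_reducible apply Sg.ex | with_reducible apply Sg.and | with_reducible apply Sg.or | with_reducible apply Sg.eq1 | with_reducible apply Tm.posL | with_reducible apply Tm.negL | with_reducible apply Tm.satB | with_reducible apply Tm.eqB | with_reducible apply Tm.leB | with_reducible apply Tm.wtN | with_reducible apply Tm.ffalC | with_reducible apply Tm.fimpC | with_reducible apply Tm.fallC | with_reducible apply Tm.pr | with_reducible apply Tm.zero | exact Tm.var _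
  exact h.subst (ts := ![t, u, w]) (fun i => by fin_cases i <;> assumption)

/-! lists -/
def JM (M : Type) [PAM M] (A : M → Prop) (x : M) : Prop :=
  ∃ a b s, x = pr a (pr b s) ∧ (a = b ∨ A (pr a s))
theorem JM_ind : Ind JM := by
  apply Ind.of
  unfold JM
  repeat' first | with_reducible apply IP.ex | with_reducible apply IP.and | with_reducible apply IP.or | with_reducible apply IP.eq | with_reducible apply IP.call | with_reducible apply Tm.pr | exact Tm.var _

abbrev Mem {M : Type} [PAM M] (a s : M) : Prop := LF JM M (pr a s)
theorem mem_cons (a b s : NS) : Mem a (pr b s) ↔ a = b ∨ Mem a s := by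
  constructor
  · intro h
    have key := LF_ind JM_ind (A := fun x => LF JM NS x ∧ ∀ a b s, x = pr a (pr b s) → a = b ∨ Mem a s) ?_ h
    · exact key.2 _ _ _ rfl
    · rintro x ⟨a, b, s, rfl, h⟩
      refine ⟨LF_intro JM_ind ⟨a, b, s, rfl, h.imp id And.left⟩, fun a' b' s' e => ?_⟩
      rw [pr_iff, pr_iff] at e
      obtain ⟨rfl, rfl, rfl⟩ := e
      exact h.imp id And.left
  · intro h
    exact LF_intro JM_ind ⟨a, b, s, rfl, h⟩

theorem pr_zero : pr (0:NS) 0 = 0 := by simp [pr]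
theorem mem_zero {a : NS} (h : Mem a 0) : a = 0 := by
  have key := LF_ind JM_ind (A := fun x => ∀ a, x = pr a 0 → a = 0) ?_ h
  · exact key _ rfl
  · rintro x ⟨a, b, s, rfl, h⟩ a' e
    rw [← pr_zero, pr_iff, pr_iff] at e
    obtain ⟨rfl, rfl, rfl⟩ := e
    rcases h with h | h
    · exact h
    · exact h _ rfl

def JU (F : Fam 1) (M : Type) [PAM M] (A : M → Prop) (x : M) : Prop :=
  ∃ g s, x = pr g s ∧ ((∃ x1 x2 x3, Cl F x1 x2 x3 ∧ Mem x1 s ∧ Mem x2 s ∧ Mem x3 s) ∨ Mem (posL g) s ∨ 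
    ∃ b, A (pr g (pr (posL b) s)) ∧ A (pr g (pr (negL b) s)))
theorem JU_ind {F : Fam 1} (hF : Sg 1 F) : Ind (JU F) := by
  have V := fun {m : ℕ} (i : Fin m) => Tm.var i
  apply Ind.of
  unfold JU
  refine IP.ex (IP.ex (IP.and (IP.eq (V _) (Tm.pr (V _) (V _))) (IP.or (IP.side (Sg.ex (Sg.ex (Sg.ex (Sg.and (Sg.Cl hF (V _) (V _) (V _))
    (Sg.and (Sg.LF JM_ind (Tm.pr (V _) (V _))) (Sg.and (Sg.LF JM_ind (Tm.pr (V _) (V _))) (Sg.LF JM_ind (Tm.pr (V _) (V _)))))))))) 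
    (IP.or (IP.side (Sg.LF JM_ind (Tm.pr (Tm.posL (V _)) (V _)))) (IP.ex (IP.and (IP.call (Tm.pr (V _) (Tm.pr (Tm.posL (V _)) (V _)))) 
      (IP.call (Tm.pr (V _) (Tm.pr (Tm.negL (V _)) (V _))))))))))

/-- truth of a literal -/
def hl (D : NS → Prop) (x : NS) : Prop := ∃ b, (x = posL b ∧ D b) ∨ (x = negL b ∧ ¬ D b)

theorem ns2ne1 : ((2:ℕ):NS) ≠ ((1:ℕ):NS) := by rw [Ne, ns_ext, ns_castval, ns_castval]; decide
theorem hl_pos {D : NS → Prop} {b : NS} : hl D (posL b) ↔ D b := by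
  constructor
  · rintro ⟨b', ⟨e, h⟩ | ⟨e, h⟩⟩
    · obtain ⟨e1, e2⟩ := pr_inj e
      rw [e1]; exact h
    · obtain ⟨e1, e2⟩ := pr_inj e
      exact (ns2ne1 e2).elim
  · intro h; exact ⟨b, Or.inl ⟨rfl, h⟩⟩
theorem hl_neg {D : NS → Prop} {b : NS} : hl D (negL b) ↔ ¬ D b := by
  constructor
  · rintro ⟨b', ⟨e, h⟩ | ⟨e, h⟩⟩
    · obtain ⟨e1, e2⟩ := pr_inj e
      exact (ns2ne1 e2.symm).elim
    · obtain ⟨e1, e2⟩ := pr_inj e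
      rw [e1]; exact h
  · intro h; exact ⟨b, Or.inr ⟨rfl, h⟩⟩
theorem hl_ne {D : NS → Prop} {x : NS} (h : hl D x) : x ≠ 0 := by
  rintro rfl
  rw [← pr_zero] at h
  obtain ⟨b, ⟨e, h⟩ | ⟨e, h⟩⟩ := h <;> obtain ⟨_, e⟩ := pr_inj e <;> rw [ns_ext, ns_val0, ns_castval] at e <;> exact absurd e (by decide)

theorem posL_ne (b : NS) : posL b ≠ 0 := hl_ne (D := fun _ => True) (hl_pos.2 trivial)
theorem negL_ne (b : NS) : negL b ≠ 0 := hl_ne (D := fun _ => False) (hl_neg.2 id)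
theorem Cl_ne {F : Fam 1} {x1 x2 x3 : NS} (hc : Cl F x1 x2 x3) : x1 ≠ 0 ∧ x2 ≠ 0 ∧ x3 ≠ 0 := by
  have p := posL_ne
  have n := negL_ne
  rcases hc with ⟨a, b, hu, rfl, rfl, rfl⟩ | ⟨a, b, c, rfl, rfl, rfl⟩ | ⟨a, b, a', b', hu, rfl, rfl, rfl⟩ | 
          ⟨a, b, c, rfl, ⟨rfl, rfl⟩ | ⟨rfl, rfl⟩⟩ | ⟨a, b, hu, ⟨rfl, rfl⟩ | ⟨rfl, rfl⟩, rfl⟩ | ⟨w, rfl, rfl, rfl⟩ | 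
          ⟨a, b, w, ⟨rfl, rfl, rfl⟩ | ⟨rfl, rfl | rfl, rfl⟩⟩ | ⟨a, w, y, rfl, rfl, rfl⟩ | ⟨a, w, rfl, rfl, rfl⟩ | ⟨e, hu, rfl, rfl, rfl⟩
  · exact ⟨n _, n _, n _⟩
  · exact ⟨p _, p _, n _⟩
  · exact ⟨p _, n _, n _⟩
  · exact ⟨p _, p _, n _⟩
  · exact ⟨p _, p _, n _⟩
  · exact ⟨p _, n _, n _⟩
  · exact ⟨n _, p _, p _⟩
  · exact ⟨p _, p _, p _⟩
  · exact ⟨p _, p _, n _⟩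
  · exact ⟨n _, n _, n _⟩
  · exact ⟨n _, p _, p _⟩
  · exact ⟨p _, n _, n _⟩
  · exact ⟨n _, p _, p _⟩
  · exact ⟨n _, n _, n _⟩

structure Good (F : Fam 1) (D : NS → Prop) : Prop where
  ue : ∀ a b, UE a b → D (eqB a b)
  euc : ∀ a b c, D (eqB a b) → D (eqB a c) → D (eqB b c)
  ei : ∀ a b a' b', EI a b a' b' → D (eqB a b) → D (eqB a' b')
  le1 : ∀ a b c, D (eqB a b) → D (leB a c) → D (leB b c)
  le2 : ∀ a b c, D (eqB a b) → D (leB c a) → D (leB c b)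
  bi : ∀ a b, BI a b → (D a ↔ D b)
  fal : ∀ w, ¬ D (satB ffalC w)
  imp : ∀ a b w, D (satB (fimpC a b) w) ↔ (D (satB a w) → D (satB b w))
  all1 : ∀ a w y, D (satB (fallC a) w) → D (satB a (pr y w))
  all2 : ∀ a w, D (satB a (pr (wtN a w) w)) → D (satB (fallC a) w)
  ax : ∀ e, F NS ![e] → D (satB e 0)

theorem Good.sound {F : Fam 1} {D : NS → Prop} (h : Good F D) {x1 x2 x3 : NS} (hc : Cl F x1 x2 x3)
    (h1 : hl D x1) (h2 : hl D x2) (h3 : hl D x3) : False := by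
  rcases hc with ⟨a, b, hu, rfl, rfl, rfl⟩ | ⟨a, b, c, rfl, rfl, rfl⟩ | ⟨a, b, a', b', hu, rfl, rfl, rfl⟩ | 
    ⟨a, b, c, rfl, ⟨rfl, rfl⟩ | ⟨rfl, rfl⟩⟩ | ⟨a, b, hu, ⟨rfl, rfl⟩ | ⟨rfl, rfl⟩, rfl⟩ | ⟨w, rfl, rfl, rfl⟩ | 
    ⟨a, b, w, ⟨rfl, rfl, rfl⟩ | ⟨rfl, rfl | rfl, rfl⟩⟩ | ⟨a, w, y, rfl, rfl, rfl⟩ | ⟨a, w, rfl, rfl, rfl⟩ | ⟨e, hu, rfl, rfl, rfl⟩ <;> 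
    simp only [hl_pos, hl_neg] at h1 h2 h3
  · exact h1 (h.ue _ _ hu)
  · exact h3 (h.euc _ _ _ h1 h2)
  · exact h3 (h.ei _ _ _ _ hu h1)
  · exact h3 (h.le1 _ _ _ h1 h2)
  · exact h3 (h.le2 _ _ _ h1 h2)
  · exact h2 ((h.bi _ _ hu).1 h1)
  · exact h1 ((h.bi _ _ hu).2 h2)
  · exact h.fal _ h1
  · exact h3 ((h.imp _ _ _).1 h1 h2)
  · exact h1 ((h.imp _ _ _).2 fun h => (h2 h).elim)
  · exact h1 ((h.imp _ _ _).2 fun _ => h2)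
  · exact h2 (h.all1 _ _ _ h1)
  · exact h1 (h.all2 _ _ h2)
  · exact h1 (h.ax _ hu)

theorem Good.complete {F : Fam 1} {D : NS → Prop} (h : ∀ x1 x2 x3 : NS, Cl F x1 x2 x3 → hl D x1 → hl D x2 → hl D x3 → False) : Good F D := by
  refine ⟨?_, ?_, ?_, ?_, ?_, ?_, ?_, ?_, ?_, ?_, ?_⟩
  · intro a b hu
    by_contra hn
    have hn := hl_neg.2 hn
    exact h _ _ _ (Or.inl ⟨a, b, hu, rfl, rfl, rfl⟩) hn hn hn
  · intro a b c h1 h2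
    by_contra hn
    exact h _ _ _ (Or.inr (Or.inl ⟨a, b, c, rfl, rfl, rfl⟩)) (hl_pos.2 h1) (hl_pos.2 h2) (hl_neg.2 hn)
  · intro a b a' b' hu h1
    by_contra hn
    exact h _ _ _ (Or.inr (Or.inr (Or.inl ⟨a, b, a', b', hu, rfl, rfl, rfl⟩))) (hl_pos.2 h1) (hl_neg.2 hn) (hl_neg.2 hn)
  · intro a b c h1 h2
    by_contra hn
    exact h _ _ _ (Or.inr (Or.inr (Or.inr (Or.inl ⟨a, b, c, rfl, Or.inl ⟨rfl, rfl⟩⟩)))) (hl_pos.2 h1) (hl_pos.2 h2) (hl_neg.2 hn)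
  · intro a b c h1 h2
    by_contra hn
    exact h _ _ _ (Or.inr (Or.inr (Or.inr (Or.inl ⟨a, b, c, rfl, Or.inr ⟨rfl, rfl⟩⟩)))) (hl_pos.2 h1) (hl_pos.2 h2) (hl_neg.2 hn)
  · intro a b hu
    constructor
    · intro h1
      by_contra hn
      exact h _ _ _ (Or.inr (Or.inr (Or.inr (Or.inr (Or.inl ⟨a, b, hu, Or.inl ⟨rfl, rfl⟩, rfl⟩))))) (hl_pos.2 h1) (hl_neg.2 hn) (hl_neg.2 hn)
    · intro h1
      by_contra hn
      exact h _ _ _ (Or.inr (Or.inr (Or.inr (Or.inr (Or.inl ⟨a, b, hu, Or.inr ⟨rfl, rfl⟩, rfl⟩))))) (hl_neg.2 hn) (hl_pos.2 h1) (hl_pos.2 h1)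
  · intro w h1
    have h1 := hl_pos.2 h1
    exact h _ _ _ (Or.inr (Or.inr (Or.inr (Or.inr (Or.inr (Or.inl ⟨w, rfl, rfl, rfl⟩)))))) h1 h1 h1
  · intro a b w
    constructor
    · intro h1 h2
      by_contra hn
      exact h _ _ _ (Or.inr (Or.inr (Or.inr (Or.inr (Or.inr (Or.inr (Or.inl ⟨a, b, w, Or.inl ⟨rfl, rfl, rfl⟩⟩))))))) (hl_pos.2 h1) (hl_pos.2 h2) (hl_neg.2 hn)
    · intro h1
      by_contra hn
      by_cases h2 : D (satB a w)
      · exact h _ _ _ (Or.inr (Or.inr (Or.inr (Or.inr (Or.inr (Or.inr (Or.inl ⟨a, b, w, Or.inr ⟨rfl, Or.inr rfl, rfl⟩⟩))))))) (hl_neg.2 hn) (hl_pos.2 (h1 h2)) (hl_pos.2 (h1 h2))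
      · exact h _ _ _ (Or.inr (Or.inr (Or.inr (Or.inr (Or.inr (Or.inr (Or.inl ⟨a, b, w, Or.inr ⟨rfl, Or.inl rfl, rfl⟩⟩))))))) (hl_neg.2 hn) (hl_neg.2 h2) (hl_neg.2 h2)
  · intro a w y h1
    by_contra hn
    exact h _ _ _ (Or.inr (Or.inr (Or.inr (Or.inr (Or.inr (Or.inr (Or.inr (Or.inl ⟨a, w, y, rfl, rfl, rfl⟩)))))))) (hl_pos.2 h1) (hl_neg.2 hn) (hl_neg.2 hn)
  · intro a w h1
    by_contra hn
    exact h _ _ _ (Or.inr (Or.inr (Or.inr (Or.inr (Or.inr (Or.inr (Or.inr (Or.inr (Or.inl ⟨a, w, rfl, rfl, rfl⟩))))))))) (hl_neg.2 hn) (hl_pos.2 h1) (hl_pos.2 h1)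
  · intro e he
    by_contra hn
    have hn := hl_neg.2 hn
    exact h _ _ _ (Or.inr (Or.inr (Or.inr (Or.inr (Or.inr (Or.inr (Or.inr (Or.inr (Or.inr ⟨e, he, rfl, rfl, rfl⟩))))))))) hn hn hn

theorem unsat_sound {F : Fam 1} (hF : Sg 1 F) {g : NS} (h : LF (JU F) NS (pr g 0)) {D : NS → Prop} (hD : Good F D) : D g := by
  by_contra hg
  have key := LF_ind (JU_ind hF) (A := fun x => ∀ s, x = pr g s → (∀ a, Mem a s → a = 0 ∨ hl D a) → False) ?_ h
  · exact key _ rfl fun a ha => Or.inl (mem_zero ha)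
  · rintro x ⟨g', s, rfl, h⟩ s' e hs
    obtain ⟨rfl, rfl⟩ := pr_inj e
    rcases h with ⟨x1, x2, x3, hc, h1, h2, h3⟩ | h | ⟨b, h1, h2⟩
    · have nz : ∀ {x}, x ≠ 0 → Mem x s → hl D x := fun hx h => (hs _ h).resolve_left hx
      have hc' := Cl_ne hc
      exact hD.sound hc (nz hc'.1 h1) (nz hc'.2.1 h2) (nz hc'.2.2 h3)
    · rcases hs _ h with h | h
      · exact posL_ne _ h
      · exact hg (hl_pos.1 h)
    · by_cases hb : D b
      · refine h1 _ rfl fun a ha => ?_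
        rcases (mem_cons _ _ _).1 ha with rfl | ha
        · exact Or.inr (hl_pos.2 hb)
        · exact hs _ ha
      · refine h2 _ rfl fun a ha => ?_
        rcases (mem_cons _ _ _).1 ha with rfl | ha
        · exact Or.inr (hl_neg.2 hb)
        · exact hs _ ha

theorem unsat_complete {F : Fam 1} (hF : Sg 1 F) {g : NS} (h : ∀ D, Good F D → D g) : LF (JU F) NS (pr g 0) := by
  classical
  by_contra hn
  obtain ⟨σ, s0, ss⟩ : ∃ σ : ℕ → NS, σ 0 = 0 ∧ ∀ i, σ (i+1) = if LF (JU F) NS (pr g (pr (posL (NS.mk i)) (σ i))) then pr (negL (NS.mk i)) (σ i) else pr (posL (NS.mk i)) (σ i) :=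
    ⟨fun k => Nat.rec 0 (fun i s => if LF (JU F) NS (pr g (pr (posL (NS.mk i)) s)) then pr (negL (NS.mk i)) s else pr (posL (NS.mk i)) s) k, rfl, fun i => rfl⟩
  have hs : ∀ k, ¬ LF (JU F) NS (pr g (σ k)) := by
    intro k
    induction k with
    | zero => rw [s0]; exact hn
    | succ k ih =>
      rw [ss]
      split_ifs with hk
      · intro hk'
        exact ih (LF_intro (JU_ind hF) ⟨g, σ k, rfl, Or.inr (Or.inr ⟨_, hk, hk'⟩)⟩)
      · exact hk
  have mono1 : ∀ k a, Mem a (σ k) → Mem a (σ (k+1)) := by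
    intro k a ha
    rw [ss]
    split_ifs <;> exact (mem_cons _ _ _).2 (Or.inr ha)
  have mono : ∀ a k j, k ≤ j → Mem a (σ k) → Mem a (σ j) := by
    intro a k j hkj hk
    induction hkj with
    | refl => exact hk
    | step _ ih => exact mono1 _ _ ih
  let D : NS → Prop := fun b => Mem (posL b) (σ (b.val + 1))
  have hm : ∀ x, hl D x → ∃ k, Mem x (σ k) := by
    rintro x ⟨b, ⟨rfl, hb⟩ | ⟨rfl, hb⟩⟩
    · exact ⟨_, hb⟩
    · refine ⟨b.val + 1, ?_⟩
      replace hb : ¬ Mem (posL b) (σ (b.val + 1)) := hb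
      have eb : NS.mk b.val = b := rfl
      rw [ss, eb] at hb ⊢
      split_ifs at hb ⊢ with h'
      · exact (mem_cons _ _ _).2 (Or.inl rfl)
      · exact (hb ((mem_cons _ _ _).2 (Or.inl rfl))).elim
  have hG : Good F D := by
    apply Good.complete
    intro x1 x2 x3 hc h1 h2 h3
    obtain ⟨k1, h1⟩ := hm _ h1
    obtain ⟨k2, h2⟩ := hm _ h2
    obtain ⟨k3, h3⟩ := hm _ h3
    refine hs (k1 + k2 + k3) (LF_intro (JU_ind hF) ⟨g, _, rfl, Or.inl ⟨x1, x2, x3, hc, mono _ _ _ ?_ h1, mono _ _ _ ?_ h2, mono _ _ _ ?_ h3⟩⟩) <;> omega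
  exact hs _ (LF_intro (JU_ind hF) ⟨g, _, rfl, Or.inr (Or.inl (h D hG))⟩)

end Guaspari

set_option linter.unusedSimpArgs false
set_option linter.unusedVariables false
namespace Guaspari

/-! ## Soundness: models give good valuations -/
theorem un_le1 (n : ℕ) : (un n).1 ≤ n := by unfold un; simp
theorem un_le2 (n : ℕ) : (un n).2 ≤ n := by
  unfold un; simp only
  have := Nat.sqrt_le_self n; omega
theorem un_lt2 {n : ℕ} (h : (un n).1 ≠ 0) : (un n).2 < n := by
  unfold un at *; simp only at *
  have := Nat.sqrt_le_self n
  have h2 : n.sqrt ≠ 0 := by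
    intro h0; rw [h0] at h
    have := Nat.sqrt_eq_zero.1 h0
    omega
  omega
theorem val_pr (a b : NS) : (pr a b).val = pr a.val b.val := rfl
theorem un_val (a b : NS) : un (pr a b).val = (a.val, b.val) := by rw [val_pr, un_pr]
theorem un_tg (n : ℕ) (x : NS) : un (tg n x).val = (n, x.val) := by rw [tg, un_val, ns_castval]

/-- entry of a coded list -/
def entry : ℕ → ℕ → ℕ
  | 0, w => (un w).1
  | j+1, w => entry j (un w).2
theorem entry_le (j w : ℕ) : entry j w ≤ w := by
  induction j generalizing w with
  | zero => exact un_le1 w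
  | succ j ih => exact (ih _).trans (un_le2 w)

section
variable {M : Type} [PAM M]

def scons (y : M) (ρ : ℕ → M) : ℕ → M
  | 0 => y
  | j+1 => ρ j

def evT (ρ : ℕ → M) (x : ℕ) : M :=
  if h : (un x).1 = 0 then ρ (un x).2 else
  if (un x).1 = 1 then 0 else
  if (un x).1 = 2 then evT ρ (un x).2 + 1 else
  if (un x).1 = 3 then evT ρ (un (un x).2).1 + evT ρ (un (un x).2).2 else
  evT ρ (un (un x).2).1 * evT ρ (un (un x).2).2
termination_by x
decreasing_by
  · exact un_lt2 h
  · exact lt_of_le_of_lt (un_le1 _) (un_lt2 h)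
  · exact lt_of_le_of_lt (un_le2 _) (un_lt2 h)
  · exact lt_of_le_of_lt (un_le1 _) (un_lt2 h)
  · exact lt_of_le_of_lt (un_le2 _) (un_lt2 h)

def evF (x : ℕ) (ρ : ℕ → M) : Prop :=
  if h : (un x).1 = 0 then False else
  if (un x).1 = 1 then evT ρ (un (un x).2).1 = evT ρ (un (un x).2).2 else
  if (un x).1 = 2 then evT ρ (un (un x).2).1 ≤ evT ρ (un (un x).2).2 else
  if (un x).1 = 3 then (evF (un (un x).2).1 ρ → evF (un (un x).2).2 ρ) else
  ∀ y, evF (un x).2 (scons y ρ)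
termination_by x
decreasing_by
  · exact lt_of_le_of_lt (un_le1 _) (un_lt2 h)
  · exact lt_of_le_of_lt (un_le2 _) (un_lt2 h)
  · exact un_lt2 h

open Classical in
noncomputable def inI (M : Type) [PAM M] (x : ℕ) : M :=
  if h : (un x).1 = 0 then ((un x).2 : M) else
  if (un x).1 = 1 then inI M (un x).2 + 1 else
  if (un x).1 = 2 then inI M (un (un x).2).1 + inI M (un (un x).2).2 else
  if (un x).1 = 3 then inI M (un (un x).2).1 * inI M (un (un x).2).2 else
  if (un x).1 = 4 then evT (fun j => inI M (entry j (un (un x).2).2)) (un (un x).2).1 else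
  if h : ∃ y, ¬ evF (un (un x).2).1 (scons y (fun j => inI M (entry j (un (un x).2).2))) then h.choose else 0
termination_by x
decreasing_by
  · exact un_lt2 h
  · exact lt_of_le_of_lt (un_le1 _) (un_lt2 h)
  · exact lt_of_le_of_lt (un_le2 _) (un_lt2 h)
  · exact lt_of_le_of_lt (un_le1 _) (un_lt2 h)
  · exact lt_of_le_of_lt (un_le2 _) (un_lt2 h)
  · exact lt_of_le_of_lt ((entry_le _ _).trans (un_le2 _)) (un_lt2 h)
  · exact lt_of_le_of_lt ((entry_le _ _).trans (un_le2 _)) (un_lt2 ‹_›)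

theorem evT_var (ρ : ℕ → M) (x : NS) : evT ρ (tvarC x).val = ρ x.val := by
  rw [evT, tvarC, un_tg]; simp
theorem evT_zero (ρ : ℕ → M) : evT ρ (tzeroC : NS).val = 0 := by
  rw [evT, tzeroC, un_tg]; simp
theorem evT_succ (ρ : ℕ → M) (x : NS) : evT ρ (tsuccC x).val = evT ρ x.val + 1 := by
  rw [evT, tsuccC, un_tg]; simp
theorem evT_add (ρ : ℕ → M) (x y : NS) : evT ρ (taddC x y).val = evT ρ x.val + evT ρ y.val := by
  rw [evT, taddC, un_tg]; simp [un_val]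
theorem evT_mul (ρ : ℕ → M) (x y : NS) : evT ρ (tmulC x y).val = evT ρ x.val * evT ρ y.val := by
  rw [evT, tmulC, un_tg]; simp [un_val]
theorem evF_fal (ρ : ℕ → M) : evF (ffalC : NS).val ρ ↔ False := by
  rw [evF, ffalC, un_tg]; simp
theorem evF_eq (ρ : ℕ → M) (x y : NS) : evF (feqC x y).val ρ ↔ evT ρ x.val = evT ρ y.val := by
  rw [evF, feqC, un_tg]; simp [un_val]
theorem evF_le (ρ : ℕ → M) (x y : NS) : evF (fleC x y).val ρ ↔ evT ρ x.val ≤ evT ρ y.val := by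
  rw [evF, fleC, un_tg]; simp [un_val]
theorem evF_imp (ρ : ℕ → M) (x y : NS) : evF (fimpC x y).val ρ ↔ (evF x.val ρ → evF y.val ρ) := by
  rw [evF, fimpC, un_tg]; simp [un_val]
theorem evF_all (ρ : ℕ → M) (x : NS) : evF (fallC x).val ρ ↔ ∀ y, evF x.val (scons y ρ) := by
  rw [evF, fallC, un_tg]; simp [un_val]

noncomputable def rw' (M : Type) [PAM M] (w : NS) : ℕ → M := fun j => inI M (entry j w.val)
theorem rw_cons (y w : NS) : rw' M (pr y w) = scons (inI M y.val) (rw' M w) := by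
  funext j
  cases j with
  | zero => simp [rw', entry, un_val, scons]
  | succ j => simp [rw', entry, un_val, scons]
theorem inI_nm (x : NS) : inI M (nmN x).val = ((x.val : ℕ) : M) := by
  rw [inI, nmN, un_tg]; simp
theorem inI_sc (x : NS) : inI M (scN x).val = inI M x.val + 1 := by
  rw [inI, scN, un_tg]; simp
theorem inI_ad (x y : NS) : inI M (adN x y).val = inI M x.val + inI M y.val := by
  rw [inI, adN, un_tg]; simp [un_val]
theorem inI_ml (x y : NS) : inI M (mlN x y).val = inI M x.val * inI M y.val := by
  rw [inI, mlN, un_tg]; simp [un_val]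
theorem inI_cl (x y : NS) : inI M (clN x y).val = evT (rw' M y) x.val := by
  rw [inI, clN, un_tg]; simp [un_val]; rfl
theorem inI_wt0 (z : ℕ) (h5 : (un z).1 = 5) (h : ∃ y : M, ¬ evF (un (un z).2).1 (scons y (fun j => inI M (entry j (un (un z).2).2)))) :
    ¬ evF (un (un z).2).1 (scons (inI M z) (fun j => inI M (entry j (un (un z).2).2))) := by
  have : inI M z = h.choose := by
    rw [inI, dif_neg (by omega), if_neg (by omega), if_neg (by omega), if_neg (by omega), if_neg (by omega), dif_pos h]
  rw [this]; exact h.choose_spec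
theorem inI_wt (x w : NS) (h : ∃ y, ¬ evF x.val (scons y (rw' M w))) : ¬ evF x.val (scons (inI M (wtN x w).val) (rw' M w)) := by
  have := inI_wt0 (M := M) (wtN x w).val (by rw [wtN, un_tg])
  have e : un (un (wtN x w).val).2 = (x.val, w.val) := by rw [wtN, un_tg, un_val]
  rw [e] at this
  exact this h

noncomputable def DM (M : Type) [PAM M] (x : NS) : Prop :=
  if (un x.val).1 = 0 then inI M (un (un x.val).2).1 = inI M (un (un x.val).2).2 else
  if (un x.val).1 = 1 then inI M (un (un x.val).2).1 ≤ inI M (un (un x.val).2).2 else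
  evF (un (un x.val).2).1 (fun j => inI M (entry j (un (un x.val).2).2))
theorem DM_eq (a b : NS) : DM M (eqB a b) ↔ inI M a.val = inI M b.val := by
  rw [DM, eqB, un_tg]; simp [un_val]
theorem DM_le (a b : NS) : DM M (leB a b) ↔ inI M a.val ≤ inI M b.val := by
  rw [DM, leB, un_tg]; simp [un_val]
theorem DM_sat (a b : NS) : DM M (satB a b) ↔ evF a.val (rw' M b) := by
  rw [DM, satB, un_tg]; simp [un_val]; rfl

theorem evT_tc {k : ℕ} (v : Fin k → M) (ρ : ℕ → M) (h : ∀ i : Fin k, ρ (k - 1 - i) = v i) (t : LA.Term (Empty ⊕ Fin k)) :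
    evT ρ (tc t).val = t.realize (Sum.elim default v) := by
  refine tm_ind (P := fun t => evT ρ (tc t).val = t.realize (Sum.elim default v)) ?_ ?_ ?_ ?_ ?_ t
  · intro i; rw [tc_var, evT_var, ns_castval, rz_vT, h]
  · rw [tc_zero, evT_zero, rz_zeroT, opZ_eq]
  · intro t ih; rw [tc_succ, evT_succ, ih, rz_succT, opS_eq]
  · intro t u ih ih'; rw [tc_add, evT_add, ih, ih', rz_addT, opA_eq]
  · intro t u ih ih'; rw [tc_mul, evT_mul, ih, ih', rz_mulT, opM_eq]
theorem evF_fc {k : ℕ} (φ : LA.BoundedFormula Empty k) : ∀ (v : Fin k → M) (ρ : ℕ → M) (h : ∀ i : Fin k, ρ (k - 1 - i) = v i),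
    (evF (fc φ).val ρ ↔ φ.Realize default v) := by
  refine fm_ind (P := fun {k} φ => ∀ (v : Fin k → M) (ρ : ℕ → M) (h : ∀ i : Fin k, ρ (k - 1 - i) = v i),
    (evF (fc φ).val ρ ↔ φ.Realize default v)) ?_ ?_ ?_ ?_ ?_ φ
  · intro k v ρ h; rw [fc_fal, evF_fal]; rfl
  · intro k t u v ρ h; rw [fc_eq, evF_eq, evT_tc v ρ h, evT_tc v ρ h]; rfl
  · intro k t u v ρ h; rw [fc_le, evF_le, evT_tc v ρ h, evT_tc v ρ h, rz_leF, opL_eq]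
  · intro k a b ih ih' v ρ h; rw [fc_imp, evF_imp, ih v ρ h, ih' v ρ h]; rfl
  · intro k a ih v ρ h; rw [fc_all, evF_all]
    refine forall_congr' fun y => ih _ _ fun i => ?_
    refine Fin.lastCases ?_ (fun i => ?_) i
    · simp [scons]
    · simp only [Fin.snoc_castSucc, ← h]
      have : k + 1 - 1 - (i.castSucc : ℕ) = (k - 1 - i) + 1 := by
        have := i.2; simp only [Fin.val_castSucc]; omega
      rw [this]; rfl

theorem DM_good {F : Fam 1} {T : Thy} (hF : ∀ x : NS, F NS ![x] → ∃ φ ∈ T, x = fc φ) (hM : M ⊨ T) : Good F (DM M) := by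
  refine ⟨?_, ?_, ?_, ?_, ?_, ?_, ?_, ?_, ?_, ?_, ?_⟩
  · intro a b h
    rw [DM_eq]
    rcases h with rfl | ⟨k, rfl, rfl⟩ | ⟨y, w, rfl, rfl⟩ | ⟨j, y, w, rfl, rfl⟩ | ⟨w, rfl, rfl⟩ | ⟨t, w, rfl, rfl⟩ | ⟨t, u, w, rfl, rfl⟩ | ⟨t, u, w, rfl, rfl⟩
    · rfl
    · rw [inI_nm, inI_sc, inI_nm, ns_valadd, ns_val1]; push_cast; rfl
    · rw [inI_cl, evT_var, rw_cons, ns_val0]; rfl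
    · rw [inI_cl, evT_var, rw_cons, ns_valadd, ns_val1, inI_cl, evT_var]; rfl
    · rw [inI_cl, evT_zero, inI_nm, ns_val0]; simp
    · rw [inI_cl, evT_succ, inI_sc, inI_cl]
    · rw [inI_cl, evT_add, inI_ad, inI_cl, inI_cl]
    · rw [inI_cl, evT_mul, inI_ml, inI_cl, inI_cl]
  · intro a b c; simp only [DM_eq]; intro h h'; rw [← h, h']
  · rintro a b a' b' (⟨rfl, rfl⟩ | ⟨c, ⟨rfl, rfl⟩ | ⟨rfl, rfl⟩ | ⟨rfl, rfl⟩ | ⟨rfl, rfl⟩⟩) h <;> rw [DM_eq] at h ⊢ <;> simp only [inI_sc, inI_ad, inI_ml, h]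
  · intro a b c; simp only [DM_eq, DM_le]; intro h h'; rw [← h]; exact h'
  · intro a b c; simp only [DM_eq, DM_le]; intro h h'; rw [← h]; exact h'
  · rintro a b ⟨t, u, w, ⟨rfl, rfl⟩ | ⟨rfl, rfl⟩⟩
    · rw [DM_sat, DM_eq, evF_eq, inI_cl, inI_cl]
    · rw [DM_sat, DM_le, evF_le, inI_cl, inI_cl]
  · intro w; rw [DM_sat, evF_fal]; exact id
  · intro a b w; rw [DM_sat, DM_sat, DM_sat, evF_imp]
  · intro a w y; rw [DM_sat, DM_sat, evF_all, rw_cons]; intro h; exact h _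
  · intro a w; rw [DM_sat, DM_sat, evF_all, rw_cons]; intro h
    by_contra hn
    push Not at hn
    exact inI_wt a w hn h
  · intro e he
    obtain ⟨φ, hφ, rfl⟩ := hF e he
    rw [DM_sat, evF_fc φ default _ (fun i => i.elim0)]
    exact hM.realize_of_mem φ hφ
end
end Guaspari

set_option linter.unusedSimpArgs false
set_option linter.unusedVariables false
set_option linter.style.haveILetI false
namespace Guaspari

/-! ## Completeness: good valuations give models -/
section
variable {F : Fam 1} {D : NS → Prop}
theorem Good.refl (h : Good F D) (a : NS) : D (eqB a a) := h.ue _ _ (Or.inl rfl)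
theorem Good.symm (h : Good F D) {a b : NS} (h1 : D (eqB a b)) : D (eqB b a) := h.euc _ _ _ h1 (h.refl a)
theorem Good.trans (h : Good F D) {a b c : NS} (h1 : D (eqB a b)) (h2 : D (eqB b c)) : D (eqB a c) :=
  h.euc _ _ _ (h.symm h1) h2

def Good.setoid (h : Good F D) : Setoid NS := ⟨fun a b => D (eqB a b), ⟨h.refl, h.symm, h.trans⟩⟩
def Good.Q (h : Good F D) : Type := Quotient h.setoid
def Good.qk (h : Good F D) (a : NS) : h.Q := Quotient.mk h.setoid a
theorem Good.qk_eq (h : Good F D) {a b : NS} : h.qk a = h.qk b ↔ D (eqB a b) :=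
  ⟨fun e => Quotient.exact e, fun e => Quotient.sound (s := h.setoid) e⟩
theorem Good.qk_surj (h : Good F D) (q : h.Q) : ∃ a, h.qk a = q := Quotient.exists_rep q

def Good.qS (h : Good F D) : h.Q → h.Q :=
  Quotient.lift (fun a => h.qk (scN a)) fun a b e => h.qk_eq.2 (h.ei _ _ _ _ (Or.inl ⟨rfl, rfl⟩) e)
def Good.qA (h : Good F D) : h.Q → h.Q → h.Q :=
  Quotient.lift₂ (fun a b => h.qk (adN a b)) fun a b a' b' e e' => h.qk_eq.2 
    (h.trans (h.ei _ _ _ _ (Or.inr ⟨b, Or.inl ⟨rfl, rfl⟩⟩) e) (h.ei _ _ _ _ (Or.inr ⟨a', Or.inr (Or.inl ⟨rfl, rfl⟩)⟩) e'))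
def Good.qM (h : Good F D) : h.Q → h.Q → h.Q :=
  Quotient.lift₂ (fun a b => h.qk (mlN a b)) fun a b a' b' e e' => h.qk_eq.2 
    (h.trans (h.ei _ _ _ _ (Or.inr ⟨b, Or.inr (Or.inr (Or.inl ⟨rfl, rfl⟩))⟩) e) (h.ei _ _ _ _ (Or.inr ⟨a', Or.inr (Or.inr (Or.inr ⟨rfl, rfl⟩))⟩) e'))
def Good.qL (h : Good F D) : h.Q → h.Q → Prop :=
  Quotient.lift₂ (fun a b => D (leB a b)) fun a b a' b' e e' => propext 
    ⟨fun l => h.le2 _ _ _ e' (h.le1 _ _ _ e l), fun l => h.le2 _ _ _ (h.symm e') (h.le1 _ _ _ (h.symm e) l)⟩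

@[reducible] def Good.str (h : Good F D) : LA.Structure h.Q where
  funMap {n} f v := match n, f, v with
    | 0, _, _ => h.qk (nmN 0)
    | 1, _, v => h.qS (v 0)
    | 2, false, v => h.qA (v 0) (v 1)
    | 2, true, v => h.qM (v 0) (v 1)
    | (_ + 3), f, _ => (show Empty from f).elim
  RelMap {n} R v := match n, R, v with
    | 2, _, v => h.qL (v 0) (v 1)
    | 0, R, _ => (show Empty from R).elim
    | 1, R, _ => (show Empty from R).elim
    | (_ + 3), R, _ => (show Empty from R).elim

theorem Good.cl_var (h : Good F D) {k : ℕ} (v : Fin k → NS) (i : Fin k) : D (eqB (clN (tvarC ((k - 1 - i : ℕ) : NS)) (env v)) (v i)) := by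
  induction k with
  | zero => exact i.elim0
  | succ k ih =>
    refine Fin.lastCases ?_ (fun i => ?_) i
    · have : k + 1 - 1 - (Fin.last k : ℕ) = 0 := by simp
      rw [this]
      refine h.ue _ _ (Or.inr (Or.inr (Or.inl ⟨v (Fin.last k), env (Fin.init v), ?_, rfl⟩)))
      simp [env]
    · have : k + 1 - 1 - (i.castSucc : ℕ) = (k - 1 - i) + 1 := by
        have := i.2; simp only [Fin.val_castSucc]; omega
      rw [this]
      refine h.trans (h.ue _ (clN (tvarC ((k - 1 - i : ℕ) : NS)) (env (Fin.init v))) (Or.inr (Or.inr (Or.inr (Or.inl ⟨((k - 1 - i : ℕ) : NS), v (Fin.last k), env (Fin.init v), ?_, rfl⟩))))) (ih (Fin.init v) i)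
      rw [Nat.cast_succ]; rfl

theorem Good.tm (h : Good F D) {k : ℕ} (v : Fin k → NS) (t : LA.Term (Empty ⊕ Fin k)) :
    letI := h.str
    t.realize (Sum.elim default (fun i => h.qk (v i))) = h.qk (clN (tc t) (env v)) := by
  letI := h.str
  refine tm_ind (P := fun t => t.realize (Sum.elim default (fun i => h.qk (v i))) = h.qk (clN (tc t) (env v))) ?_ ?_ ?_ ?_ ?_ t
  · intro i
    rw [rz_vT, eq_comm, h.qk_eq, tc_var]
    exact h.cl_var v i
  · rw [rz_zeroT, eq_comm]
    exact h.qk_eq.2 (h.ue _ _ (Or.inr (Or.inr (Or.inr (Or.inr (Or.inl ⟨_, rfl, rfl⟩))))))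
  · intro t ih
    rw [rz_succT, ih, eq_comm]
    exact h.qk_eq.2 (h.ue _ _ (Or.inr (Or.inr (Or.inr (Or.inr (Or.inr (Or.inl ⟨_, _, rfl, rfl⟩)))))))
  · intro t u ih ih'
    rw [rz_addT, ih, ih', eq_comm]
    exact h.qk_eq.2 (h.ue _ _ (Or.inr (Or.inr (Or.inr (Or.inr (Or.inr (Or.inr (Or.inl ⟨_, _, _, rfl, rfl⟩))))))))
  · intro t u ih ih'
    rw [rz_mulT, ih, ih', eq_comm]
    exact h.qk_eq.2 (h.ue _ _ (Or.inr (Or.inr (Or.inr (Or.inr (Or.inr (Or.inr (Or.inr ⟨_, _, _, rfl, rfl⟩))))))))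

theorem Good.fm (h : Good F D) {k : ℕ} (φ : LA.BoundedFormula Empty k) :
    letI := h.str
    ∀ (v : Fin k → NS), φ.Realize default (fun i => h.qk (v i)) ↔ D (satB (fc φ) (env v)) := by
  letI := h.str
  refine fm_ind (P := fun {k} φ => ∀ (v : Fin k → NS), φ.Realize default (fun i => h.qk (v i)) ↔ D (satB (fc φ) (env v))) ?_ ?_ ?_ ?_ ?_ φ
  · intro k v
    rw [fc_fal]
    exact iff_of_false id (h.fal _)
  · intro k t u v
    rw [fc_eq, h.bi _ _ ⟨_, _, _, Or.inl ⟨rfl, rfl⟩⟩, ← h.qk_eq, ← h.tm, ← h.tm]; rfl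
  · intro k t u v
    rw [fc_le, h.bi _ _ ⟨_, _, _, Or.inr ⟨rfl, rfl⟩⟩, rz_leF, h.tm, h.tm]; rfl
  · intro k a b ih ih' v
    rw [fc_imp, h.imp, ← ih, ← ih']; rfl
  · intro k a ih v
    rw [fc_all]
    have e : ∀ y, (Fin.snoc (fun i => h.qk (v i)) (h.qk y) : Fin (k+1) → h.Q) = fun i => h.qk ((Fin.snoc v y : Fin (k+1) → NS) i) := by
      intro y; funext i
      refine Fin.lastCases ?_ (fun i => ?_) i
      · simp
      · simp
    constructor
    · intro H
      have := H (h.qk (wtN (fc a) (env v)))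
      rw [e, ih, env_snoc] at this
      exact h.all2 _ _ this
    · intro H q
      obtain ⟨y, rfl⟩ := h.qk_surj q
      rw [e, ih, env_snoc]
      exact h.all1 _ _ _ H

theorem Good.model {T : Thy} (h : Good F D) (hF : ∀ φ ∈ T, F NS ![fc φ]) : 
    letI := h.str
    h.Q ⊨ T := by
  letI := h.str
  refine ⟨fun φ hφ => ?_⟩
  have := (h.fm (k := 0) φ (fun i => i.elim0)).2 (h.ax _ (hF φ hφ))
  have e : (fun i : Fin 0 => h.qk (i.elim0)) = default := Subsingleton.elim _ _
  rw [e] at this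
  exact this
end

theorem prv_models {T : Thy} {φ : Snt} (h : Prv T φ) (M : Type) [LA.Structure M] [Nonempty M] [hM : M ⊨ T] : M ⊨ φ := by
  exact Theory.ModelsBoundedFormula.realize_sentence h M

theorem extPA_models {T : Thy} (h : ExtPA T) (M : Type) [LA.Structure M] [Nonempty M] (hM : M ⊨ T) : M ⊨ PAAx :=
  ⟨fun φ hφ => prv_models (h φ hφ) M⟩

/-- arithmetization of provability -/
theorem prov_sigma {T : Thy} (hT : CompThy T) (hP : ExtPA T) {ψ : Fam 1} (hψ : FF ψ) :
    ∃ G : Fam 1, Sg 1 G ∧ ∀ n : ℕ, G NS ![(n : NS)] ↔ ∀ (M : Type) [PAM M], M ⊨ T → ψ M ![(n : M)] := by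
  obtain ⟨F, hF, hFT⟩ := ax_sigma hT
  obtain ⟨φ, hφ⟩ := hψ
  let g : TFam 1 := fun M _ v => satB (((fc φ).val : ℕ) : M) (pr (nmN (v 0)) 0)
  have hg : Tm (fun M _ v => g M v) := Tm.satB (Tm.cast _) (Tm.pr (Tm.nmN (Tm.var _)) Tm.zero)
  refine ⟨fun M _ v => LF (JU F) M (pr (g M v) 0), Sg.LF (JU_ind hF) (Tm.pr hg Tm.zero), fun n => ?_⟩
  have hgn : g NS ![(n : NS)] = satB (fc φ) (pr (nmN (n : NS)) 0) := by
    change satB (((fc φ).val : ℕ) : NS) (pr (nmN (n : NS)) 0) = _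
    rw [← ns_surj]
  beta_reduce
  rw [hgn]
  constructor
  · intro H M _ hM
    have := unsat_sound hF H (DM_good (M := M) (fun x hx => (hFT x).1 hx) hM)
    rw [DM_sat, evF_fc φ (![(n : M)]) ] at this
    · rw [hφ]; exact this
    · intro i
      have : i = 0 := Subsingleton.elim _ _
      subst this
      simp only [rw_cons, inI_nm, ns_castval]; rfl
  · intro H
    refine unsat_complete hF fun D h => ?_
    letI := h.str
    haveI : Nonempty h.Q := ⟨h.qk 0⟩
    have hm := h.model (T := T) fun φ hφ => (hFT _).2 ⟨φ, hφ, rfl⟩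
    letI : PAM h.Q := { models := extPA_models hP h.Q hm }
    have key := H h.Q hm
    rw [hφ] at key
    have hn : ∀ n : ℕ, (n : h.Q) = h.qk (nmN (n : NS)) := by
      intro n
      induction n with
      | zero => rw [Nat.cast_zero, Nat.cast_zero, ← opZ_eq]; rfl
      | succ n ih =>
        rw [Nat.cast_succ, Nat.cast_succ, ih, ← opS_eq, eq_comm]
        exact h.qk_eq.2 (h.ue _ _ (Or.inr (Or.inl ⟨_, rfl, rfl⟩)))
    have e : (![(n : h.Q)] : Fin 1 → h.Q) = fun i => h.qk ((![nmN (n : NS)] : Fin 1 → NS) i) := by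
      funext i
      have : i = 0 := Subsingleton.elim _ _
      subst this
      exact hn n
    rw [e] at key
    have key2 := (h.fm φ _).1 key
    have e2 : ∀ x : NS, env (![x] : Fin 1 → NS) = pr x 0 := fun x => by simp only [env]; rfl
    rw [e2] at key2
    exact key2
end Guaspari

set_option linter.unusedSimpArgs false
set_option linter.unusedVariables false
set_option linter.style.haveILetI false
namespace Guaspari

/-! ## The final argument -/
theorem prv_iff {V : Thy} (h : ExtPA V) {φ : Snt} :
    Prv V φ ↔ ∀ (M : Type) [PAM M], M ⊨ V → M ⊨ φ := by
  constructor
  · intro hφ M _ hM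
    haveI : Nonempty M := ⟨0⟩
    haveI := hM
    exact prv_models hφ M
  · intro hφ
    refine Theory.models_sentence_iff.2 fun M => ?_
    letI : PAM M := { toStructure := M.struc, models := extPA_models h M M.is_model }
    exact hφ M M.is_model

theorem con_iff {V : Thy} (h : ExtPA V) : Con V ↔ ∃ (M : Type) (_ : PAM M), M ⊨ V := by
  rw [Con, prv_iff h]
  push Not
  constructor
  · rintro ⟨M, i, hM, _⟩; exact ⟨M, i, hM⟩
  · rintro ⟨M, i, hM⟩; exact ⟨M, i, hM, fun h => h⟩

theorem ExtPA.mono {V W : Thy} (h : ExtPA V) (hs : V ⊆ W) : ExtPA W := fun φ hφ =>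
  Theory.models_sentence_iff.2 fun M => by
    haveI : M ⊨ V := M.is_model.mono hs
    exact prv_models (h φ hφ) M

theorem mod_union {V W : Thy} {M : Type} [LA.Structure M] : M ⊨ V ∪ W ↔ M ⊨ V ∧ M ⊨ W :=
  Theory.model_union_iff

theorem sig_index {k : ℕ} {σ : Snt} (h : σ ∈ SigmaS (k+1)) :
    ∃ e : ℕ, ∀ (M : Type) [PAM M], M ⊨ σ ↔ TS k (e:M) 0 := by
  have : Sg (k+1) (fam σ) := ⟨σ, h, fun _ _ _ => Iff.rfl⟩
  obtain ⟨e, he⟩ := Sg.index k this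
  exact ⟨e, fun M _ => he M default⟩

theorem sig_of {k : ℕ} {P : Fam 0} (h : Sg k P) : ∃ σ ∈ SigmaS k, ∀ (M : Type) [PAM M], M ⊨ σ ↔ P M default := by
  obtain ⟨σ, h1, h2⟩ := h
  exact ⟨σ, h1, fun M _ => (h2 M default).symm⟩

theorem pi_of {k : ℕ} {P : Fam 0} (h : Pg k P) : ∃ σ ∈ PiS k, ∀ (M : Type) [PAM M], M ⊨ σ ↔ P M default := by
  obtain ⟨σ, h1, h2⟩ := h
  exact ⟨σ, h1, fun M _ => (h2 M default).symm⟩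

theorem pi_index {k : ℕ} {π : Snt} (h : π ∈ PiS (k+1)) :
    ∃ e : ℕ, ∀ (M : Type) [PAM M], M ⊨ π ↔ ¬ TS k (e:M) 0 := by
  have : Pg (k+1) (fam π) := ⟨π, h, fun _ _ _ => Iff.rfl⟩
  obtain ⟨e, he⟩ := Sg.index k this.not
  refine ⟨e, fun M _ => ?_⟩
  have := he M default
  rw [not_iff_comm] at this
  exact this.symm

theorem FF.of_iff {m : ℕ} {P Q : Fam m} (h : FF P) (e : ∀ (M : Type) [PAM M] (v : Fin m → M), Q M v ↔ P M v) : FF Q := by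
  rwa [famext e]
theorem FF.imp {m : ℕ} {P Q : Fam m} (h : FF P) (h' : FF Q) : FF (fun M _ v => P M v → Q M v) := by
  obtain ⟨φ, h⟩ := h; obtain ⟨ψ, h'⟩ := h'
  exact ⟨φ ⟹ ψ, fun M _ v => by simp [h, h']⟩
theorem FF.not {m : ℕ} {P : Fam m} (h : FF P) : FF (fun M _ v => ¬ P M v) := h.imp D0.false.ff
theorem FF.and {m : ℕ} {P Q : Fam m} (h : FF P) (h' : FF Q) : FF (fun M _ v => P M v ∧ Q M v) := by
  obtain ⟨φ, h⟩ := h; obtain ⟨ψ, h'⟩ := h'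
  exact ⟨φ ⊓ ψ, fun M _ v => by simp [h, h']⟩
theorem FF.iff {m : ℕ} {P Q : Fam m} (h : FF P) (h' : FF Q) : FF (fun M _ v => P M v ↔ Q M v) := by
  obtain ⟨φ, h⟩ := h; obtain ⟨ψ, h'⟩ := h'
  exact ⟨φ ⇔ ψ, fun M _ v => by simp [h, h']⟩
theorem FF.ex {m : ℕ} {P : ∀ (M : Type) [PAM M], (Fin m → M) → M → Prop}
    (h : FF (m := m+1) (fun M _ w => P M (Fin.init w) (w (Fin.last m)))) :
    FF (fun M _ v => ∃ y, P M v y) := by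
  obtain ⟨φ, h⟩ := h
  refine ⟨∃' φ, fun M _ v => ?_⟩
  simp only [BoundedFormula.realize_ex]
  refine exists_congr fun y => ?_
  rw [← h]
  simp

theorem re4 {T : Thy} (hT : CompThy T) (hP : ExtPA T) {ψ : Fam 4} (hψ : FF ψ) :
    ∃ G : Fam 4, Sg 1 G ∧ ∀ x y c d : ℕ, G NS ![(x:NS), (y:NS), (c:NS), (d:NS)] ↔
      ∀ (M : Type) [PAM M], M ⊨ T → ψ M ![(x:M), (y:M), (c:M), (d:M)] := by
  let ψ1 : Fam 1 := fun M _ v => ¬ ∃ x y c d, v 0 = pr (pr x y) (pr c d) ∧ ¬ ψ M ![x, y, c, d]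
  have h1 : FF ψ1 := by
    obtain ⟨φ, hφ⟩ := hψ
    have h5 : FF (m := 5) (fun M _ v => ψ M ![v 1, v 2, v 3, v 4]) := by
      refine ⟨φ.liftAt 1 0, fun M _ v => ?_⟩
      beta_reduce
      rw [hφ, BoundedFormula.realize_liftAt (by omega)]
      apply iff_of_eq; congr 1; funext i; fin_cases i <;> rfl
    have h6 := (D0.eq (m := 5) (Tm.var 0) (((Tm.var 1).pr (Tm.var 2)).pr ((Tm.var 3).pr (Tm.var 4)))).ff
    refine FF.not (FF.ex (FF.ex (FF.ex (FF.ex ?_))))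
    exact (h6.and h5.not)
  obtain ⟨G, hG, h⟩ := prov_sigma hT hP h1
  refine ⟨fun M _ v => G M ![pr (pr (v 0) (v 1)) (pr (v 2) (v 3))], sub1 hG (((Tm.var 0).pr (Tm.var 1)).pr ((Tm.var 2).pr (Tm.var 3))), fun x y c d => ?_⟩
  have := h (pr (pr x y) (pr c d))
  simp only [cast_pr, ψ1] at this
  simp only [Matrix.cons_val]
  rw [this]
  refine forall_congr' fun M => forall_congr' fun _ => imp_congr_right fun _ => ?_
  simp only [Matrix.cons_val, pr_iff]
  push Not
  constructor
  · intro h; exact h x y c d ⟨⟨rfl, rfl⟩, rfl, rfl⟩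
  · rintro h _ _ _ _ ⟨⟨rfl, rfl⟩, rfl, rfl⟩; exact h

end Guaspari

set_option linter.unusedSimpArgs false
set_option linter.unusedVariables false
set_option linter.style.haveILetI false
namespace Guaspari

theorem core (k : ℕ) {GW : Fam 2} {GK : Fam 4} (hW : Sg 1 GW) (hL : Sg 1 GK) :
    ∃ e f : ℕ,
      (¬ GW NS ![(e:NS), (f:NS)] → ∀ c d : ℕ, GK NS ![(e:NS), (f:NS), (c:NS), (d:NS)] →
        ∀ (M : Type) [PAM M], (TS k (d:M) 0 → TS k (e:M) (env ![(e:M), (f:M)])) ∧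
          (TS k (f:M) (env ![(e:M), (f:M)]) → TS k (c:M) 0)) ∧
      (GW NS ![(e:NS), (f:NS)] → ∃ A : Set (ℕ × ℕ), A.Finite ∧
        (∀ p ∈ A, GK NS ![(e:NS), (f:NS), (p.1:NS), (p.2:NS)]) ∧
        ∀ (M : Type) [PAM M], (TS k (e:M) (env ![(e:M), (f:M)]) ↔ ∃ p ∈ A, TS k (p.2:M) 0) ∧
          (TS k (f:M) (env ![(e:M), (f:M)]) ↔ ∀ p ∈ A, TS k (p.1:M) 0)) := by
  obtain ⟨QW, hQW, eW⟩ := hW.nf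
  obtain ⟨QL, hQL, eL⟩ := hL.nf
  have hQW := hQW.toD0
  have hQL := hQL.toD0
  let α : Fam 2 := fun M _ v => ∃ s, ∃ c ≤ s, ∃ d ≤ s, (∃ y ≤ s, QL M ![v 0, v 1, c, d, y]) ∧
    (∀ w ≤ s, ¬ QW M ![v 0, v 1, w]) ∧ TS k d 0
  let β : Fam 2 := fun M _ v => ∃ w, QW M ![v 0, v 1, w] ∧ ∀ s ≤ w, w ≤ s ∨ ∀ c ≤ s, ∀ d ≤ s,
    (∀ y ≤ s, ¬ QL M ![v 0, v 1, c, d, y]) ∨ TS k c 0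
  have sW : ∀ {m : ℕ} (i j l : Fin m), D0 (fun M _ v => QW M ![v i, v j, v l]) := fun i j l =>
    (hQW.subst (ts := ![fun M _ v => v i, fun M _ v => v j, fun M _ v => v l])
      (fun i => by fin_cases i <;> exact Tm.var _)).of_iff fun M _ v => by
        apply iff_of_eq; congr 1; funext i; fin_cases i <;> rfl
  have sL : ∀ {m : ℕ} (i j l p q : Fin m), D0 (fun M _ v => QL M ![v i, v j, v l, v p, v q]) := fun i j l p q =>
    (hQL.subst (ts := ![fun M _ v => v i, fun M _ v => v j, fun M _ v => v l, fun M _ v => v p, fun M _ v => v q])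
      (fun i => by fin_cases i <;> exact Tm.var _)).of_iff fun M _ v => by
        apply iff_of_eq; congr 1; funext i; fin_cases i <;> rfl
  have V := fun {m : ℕ} (i : Fin m) => Tm.var i
  have hα : Sg (k+1) α := by
    refine Sg.ex (Sg.bex (V _) (Sg.bex (V _) (Sg.and ?_ (Sg.and ?_ (Sg.TS k (V _) Tm.zero)))))
    · exact (D0.bex (V _) (sL _ _ _ _ _)).sg
    · exact (D0.ball (V _) (sW _ _ _).not).sg
  have hβ : Sg (k+1) β := by
    refine Sg.ex (Sg.and (sW _ _ _).sg (Sg.ball (V _) (Sg.or (D0.le (V _) (V _)).sg (Sg.ball (V _) (Sg.ball (V _) (Sg.or ?_ (Sg.TS k (V _) Tm.zero)))))))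
    exact (D0.ball (V _) (sL _ _ _ _ _).not).sg
  obtain ⟨e, he⟩ := Sg.index k hα
  obtain ⟨f, hf⟩ := Sg.index k hβ
  refine ⟨e, f, ?_⟩
  let Wn : ℕ → Prop := fun w => QW NS ![(e:NS), (f:NS), (w:NS)]
  let Ln : ℕ → ℕ → ℕ → Prop := fun c d y => QL NS ![(e:NS), (f:NS), (c:NS), (d:NS), (y:NS)]
  have tW : ∀ (M : Type) [PAM M] (w : ℕ), QW M ![(e:M), (f:M), (w:M)] ↔ Wn w := by
    intro M _ w
    have := hQW.absNS ![e, f, w] M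
    convert this using 2 <;> (try congr 1) <;> funext i <;> fin_cases i <;> rfl
  have tL : ∀ (M : Type) [PAM M] (c d y : ℕ), QL M ![(e:M), (f:M), (c:M), (d:M), (y:M)] ↔ Ln c d y := by
    intro M _ c d y
    have := hQL.absNS ![e, f, c, d, y] M
    convert this using 2 <;> (try congr 1) <;> funext i <;> fin_cases i <;> rfl
  have gW : GW NS ![(e:NS), (f:NS)] ↔ ∃ w, Wn w := by
    rw [eW]
    constructor
    · rintro ⟨y, hy⟩; rw [ns_surj y] at hy; refine ⟨NS.val y, ?_⟩
      change QW NS _; convert hy using 1; funext i; fin_cases i <;> rfl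
    · rintro ⟨y, hy⟩; refine ⟨y, ?_⟩
      change QW NS _ at hy; convert hy using 1; funext i; fin_cases i <;> rfl
  have gL : ∀ c d : ℕ, GK NS ![(e:NS), (f:NS), (c:NS), (d:NS)] ↔ ∃ y, Ln c d y := by
    intro c d
    rw [eL]
    constructor
    · rintro ⟨y, hy⟩; rw [ns_surj y] at hy; refine ⟨NS.val y, ?_⟩
      change QL NS _; convert hy using 1; funext i; fin_cases i <;> rfl
    · rintro ⟨y, hy⟩; refine ⟨y, ?_⟩
      change QL NS _ at hy; convert hy using 1; funext i; fin_cases i <;> rfl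
  have ea : ∀ (M : Type) [PAM M], TS k (e:M) (env ![(e:M), (f:M)]) ↔ α M ![(e:M), (f:M)] := fun M _ => (he M _).symm
  have eb : ∀ (M : Type) [PAM M], TS k (f:M) (env ![(e:M), (f:M)]) ↔ β M ![(e:M), (f:M)] := fun M _ => (hf M _).symm
  simp only [ea, eb, gW, gL]
  clear_value Wn Ln
  clear ea eb gW gL he hf hα hβ sW sL eW eL
  simp only [α, β, Matrix.cons_val_zero, Matrix.cons_val_one]
  constructor
  · intro hno c d ⟨y, hy⟩ M _
    have hno' : ∀ (n : ℕ) (w : M), w ≤ (n:M) → ¬ QW M ![(e:M), (f:M), w] := by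
      intro n w hw h
      obtain ⟨j, _, rfl⟩ := cast_seg hw
      exact hno ⟨j, (tW M j).1 h⟩
    have h1 : (c:M) ≤ ((c+d+y : ℕ) : M) := Nat.cast_le.2 (by omega)
    have h2 : (d:M) ≤ ((c+d+y : ℕ) : M) := Nat.cast_le.2 (by omega)
    have h3 : (y:M) ≤ ((c+d+y : ℕ) : M) := Nat.cast_le.2 (by omega)
    constructor
    · intro hd
      exact ⟨_, c, h1, d, h2, ⟨y, h3, (tL M c d y).2 hy⟩, hno' _, hd⟩
    · rintro ⟨w, hw, h⟩
      have hlt : ((c+d+y : ℕ) : M) < w := by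
        by_contra h'; exact hno' _ w (not_lt.1 h') hw
      rcases h _ hlt.le with h | h
      · exact absurd hlt (not_lt.2 h)
      · rcases h c h1 d h2 with h | h
        · exact (h y h3 ((tL M c d y).2 hy)).elim
        · exact h
  · intro hw
    classical
    obtain ⟨w0, hw0, hmin⟩ : ∃ w, Wn w ∧ ∀ j < w, ¬ Wn j := ⟨Nat.find hw, Nat.find_spec hw, fun j hj => Nat.find_min hw hj⟩
    have key : ∀ (M : Type) [PAM M] (s : M), s < (w0:M) → ∃ j < w0, s = (j:M) := by
      intro M _ s hs
      obtain ⟨j, hj, rfl⟩ := cast_seg hs.le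
      refine ⟨j, lt_of_le_of_ne hj ?_, rfl⟩
      rintro rfl; exact lt_irrefl _ hs
    have cle : ∀ (M : Type) [PAM M] (a b : ℕ), (a:M) ≤ b ↔ a ≤ b := fun M _ a b => Nat.cast_le
    have clt : ∀ (M : Type) [PAM M] (a b : ℕ), (a:M) < b ↔ a < b := fun M _ a b => Nat.cast_lt
    refine ⟨{p | p.1 < w0 ∧ p.2 < w0 ∧ ∃ s < w0, p.1 ≤ s ∧ p.2 ≤ s ∧ ∃ y ≤ s, Ln p.1 p.2 y}, ?_, ?_, ?_⟩
    · refine Set.Finite.subset ((Set.finite_Iio w0).prod (Set.finite_Iio w0)) ?_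
      rintro p ⟨h1, h2, _⟩; exact ⟨h1, h2⟩
    · rintro p ⟨_, _, s, _, _, _, y, _, h⟩; exact ⟨y, h⟩
    · intro M _
      constructor
      · constructor
        · rintro ⟨s, c, hc, d, hd, ⟨y, hy, h⟩, hs, ht⟩
          have hsw : s < (w0:M) := by
            by_contra h'; exact hs _ (not_lt.1 h') ((tW M w0).2 hw0)
          obtain ⟨s, hs', rfl⟩ := key M s hsw
          obtain ⟨c, kc, rfl⟩ := cast_seg hc
          obtain ⟨d, kd, rfl⟩ := cast_seg hd
          obtain ⟨y, ky, rfl⟩ := cast_seg hy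
          exact ⟨(c, d), ⟨by simp only; omega, by simp only; omega, s, hs', kc, kd, y, ky, (tL M c d y).1 h⟩, ht⟩
        · rintro ⟨⟨c, d⟩, ⟨_, _, s, hs, hc, hd, y, hy, h⟩, ht⟩
          simp only at hc hd h ht
          refine ⟨s, c, (cle M _ _).2 hc, d, (cle M _ _).2 hd, ⟨y, (cle M _ _).2 hy, (tL M c d y).2 h⟩, ?_, ht⟩
          intro w hw h
          obtain ⟨w, hw, rfl⟩ := cast_seg hw
          exact hmin w (by omega) ((tW M w).1 h)
      · constructor
        · rintro ⟨w, hw, H⟩ ⟨c, d⟩ ⟨_, _, s, hs, hc, hd, y, hy, h⟩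
          simp only at hc hd h ⊢
          have hsw : (s:M) < w := by
            refine lt_of_lt_of_le ((clt M _ _).2 hs) ?_
            by_contra h'
            obtain ⟨j, hj, rfl⟩ := key M w (not_le.1 h')
            exact hmin j hj ((tW M j).1 hw)
          rcases H _ hsw.le with h' | h'
          · exact absurd hsw (not_lt.2 h')
          · rcases h' c ((cle M _ _).2 hc) d ((cle M _ _).2 hd) with h' | h'
            · exact (h' y ((cle M _ _).2 hy) ((tL M c d y).2 h)).elim
            · exact h'
        · intro H
          refine ⟨w0, (tW M w0).2 hw0, fun s hs => ?_⟩
          by_cases hsw : (w0:M) ≤ s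
          · exact Or.inl hsw
          right
          obtain ⟨s, hs', rfl⟩ := key M s (not_le.1 hsw)
          intro c hc d hd
          obtain ⟨c, kc, rfl⟩ := cast_seg hc
          obtain ⟨d, kd, rfl⟩ := cast_seg hd
          by_cases hy : ∃ y ≤ s, Ln c d y
          · exact Or.inr (H (c, d) ⟨by simp only; omega, by simp only; omega, s, hs', kc, kd, hy⟩)
          · left
            intro y hy' h
            obtain ⟨y, ky, rfl⟩ := cast_seg hy'
            exact hy ⟨y, ky, (tL M c d y).1 h⟩

end Guaspari

set_option linter.unusedSimpArgs false
set_option linter.unusedVariables false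
set_option linter.style.haveILetI false
namespace Guaspari

theorem kill {T U : Thy} (hT : ExtPA T) (hU : ExtPA U) (k : ℕ) {A : Set (ℕ × ℕ)} (hA : A.Finite)
    (h1 : ∀ (M : Type) [PAM M], M ⊨ T → ∃ p ∈ A, TS k (p.2:M) 0)
    (h2 : ∀ (M : Type) [PAM M], M ⊨ T → ∃ p ∈ A, ¬ TS k (p.1:M) 0)
    (h3 : ∀ (M : Type) [PAM M], M ⊨ U → ∀ p ∈ A, TS k (p.1:M) 0 ∧ ¬ TS k (p.2:M) 0) :
    ¬ Cmpair (k+1) T U := by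
  rintro (h | h)
  · rw [con_iff (hT.mono Set.subset_union_left)] at h
    obtain ⟨M, i, hM⟩ := h
    obtain ⟨hM, hM'⟩ := mod_union.1 hM
    obtain ⟨p, hp, h⟩ := h1 M hM
    obtain ⟨π, hπ, e⟩ := pi_of (P := fun M _ _ => ¬ TS k (p.2:M) 0) (Sg.TS k (Tm.cast _) Tm.zero).not
    have : π ∈ ThIn (PiS (k+1)) U := ⟨hπ, (prv_iff hU).2 fun N _ hN => (e N).2 (h3 N hN p hp).2⟩
    exact (e M).1 (hM'.realize_of_mem _ this) h
  · rw [con_iff (hU.mono Set.subset_union_left)] at h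
    obtain ⟨M, i, hM⟩ := h
    obtain ⟨hM, hM'⟩ := mod_union.1 hM
    have hPg : Pg (k+1) (m := 0) (fun M _ _ => ∃ p ∈ A, ¬ TS k (p.1:M) 0) := by
      clear h1 h2 h3
      induction A, hA using Set.Finite.induction_on with
      | empty => exact D0.false.pg.of_iff fun M _ v => by simp
      | insert _ _ ih =>
        rename_i p s _ _
        exact ((Sg.TS (m := 0) k (Tm.cast p.1) Tm.zero).not.or ih).of_iff fun M _ v => by simp
    obtain ⟨π, hπ, e⟩ := pi_of hPg
    have : π ∈ ThIn (PiS (k+1)) T := ⟨hπ, (prv_iff hT).2 fun N _ hN => (e N).2 (h2 N hN)⟩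
    obtain ⟨p, hp, h⟩ := (e M).1 (hM'.realize_of_mem _ this)
    exact h (h3 M hM p hp).1

theorem Cmpair.symm {n : ℕ} {T U : Thy} (h : Cmpair n T U) : Cmpair n U T := Or.symm h

theorem add_models {V : Thy} {φ : Snt} {M : Type} [LA.Structure M] (h : M ⊨ V) (h' : M ⊨ φ) : M ⊨ add V φ :=
  ⟨fun ψ hψ => by
    rcases hψ with rfl | hψ
    · exact h'
    · exact h.realize_of_mem _ hψ⟩

theorem sub_models {V T : Thy} (h : SubThy V T) (hT : ExtPA T) {M : Type} [PAM M] (hM : M ⊨ T) : M ⊨ V :=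
  ⟨fun ψ hψ => (prv_iff hT).1 (h.2 ψ ((prv_iff h.1).2 fun N _ hN => hN.realize_of_mem _ hψ)) M hM⟩

theorem mod_of {V : Thy} {M : Type} [LA.Structure M] {S : Set Snt} (h : ∀ ψ ∈ S, M ⊨ ψ) : M ⊨ (S : Thy) := ⟨h⟩

theorem Tm.of_eq' {m : ℕ} {t u : TFam m} (h : Tm t) (e : ∀ (M : Type) [PAM M] (v : Fin m → M), u M v = t M v) : Tm u := by
  obtain ⟨τ, h⟩ := h
  exact ⟨τ, fun M _ v => (e M v).trans (h M v)⟩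

theorem re4' {T U : Thy} (hT : CompThy T) (hP : ExtPA T) (hU : CompThy U) (hQ : ExtPA U) {ψ χ : Fam 4} (hψ : FF ψ) (hχ : FF χ) :
    ∃ G : Fam 4, Sg 1 G ∧ ∀ x y c d : ℕ, G NS ![(x:NS), (y:NS), (c:NS), (d:NS)] ↔
      ((∀ (M : Type) [PAM M], M ⊨ T → ψ M ![(x:M), (y:M), (c:M), (d:M)]) ∧
        (∀ (M : Type) [PAM M], M ⊨ U → χ M ![(x:M), (y:M), (c:M), (d:M)])) ∨
      ((∀ (M : Type) [PAM M], M ⊨ U → ψ M ![(x:M), (y:M), (c:M), (d:M)]) ∧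
        (∀ (M : Type) [PAM M], M ⊨ T → χ M ![(x:M), (y:M), (c:M), (d:M)])) := by
  obtain ⟨G1, g1, h1⟩ := re4 hT hP hψ
  obtain ⟨G2, g2, h2⟩ := re4 hU hQ hχ
  obtain ⟨G3, g3, h3⟩ := re4 hU hQ hψ
  obtain ⟨G4, g4, h4⟩ := re4 hT hP hχ
  exact ⟨_, (g1.and g2).or (g3.and g4), fun x y c d => by beta_reduce; rw [h1, h2, h3, h4]⟩

theorem re2 {T U : Thy} (hT : CompThy T) (hP : ExtPA T) (hU : CompThy U) (hQ : ExtPA U) {ψ : Fam 4} (hψ : FF ψ) :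
    ∃ G : Fam 2, Sg 1 G ∧ ∀ x y : ℕ, G NS ![(x:NS), (y:NS)] ↔
      (∀ (M : Type) [PAM M], M ⊨ T → ψ M ![(x:M), (y:M), 0, 0]) ∨
      (∀ (M : Type) [PAM M], M ⊨ U → ψ M ![(x:M), (y:M), 0, 0]) := by
  obtain ⟨G1, g1, h1⟩ := re4 hT hP hψ
  obtain ⟨G2, g2, h2⟩ := re4 hU hQ hψ
  have key : ∀ {G : Fam 4}, Sg 1 G → Sg 1 (m := 2) (fun M _ v => G M ![v 0, v 1, 0, 0]) := fun {G} g =>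
    (g.subst (ts := ![fun M _ v => v 0, fun M _ v => v 1, fun M _ v => 0, fun M _ v => 0])
      (fun i => by fin_cases i <;> first | exact Tm.var _ | exact Tm.zero)).of_iff fun M _ v => by
        apply iff_of_eq; congr 1; funext i; fin_cases i <;> rfl
  refine ⟨_, (key g1).or (key g2), fun x y => ?_⟩
  have h1 := h1 x y 0 0
  have h2 := h2 x y 0 0
  simp only [Nat.cast_zero] at h1 h2
  simp only [Matrix.cons_val_zero, Matrix.cons_val_one]
  rw [h1, h2]

theorem ff_env (k : ℕ) (i : Fin 4) : Sg (k+1) (m := 4) (fun M _ v => TS k (v i) (env ![v 0, v 1])) :=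
  Sg.TS k (Tm.var _) (((env_tm (m := 2)).subst (ts := ![fun M _ v => v 0, fun M _ v => v 1])
    (fun i => by fin_cases i <;> exact Tm.var _)).of_eq' fun M _ v => by
      apply congrArg env; funext i; fin_cases i <;> rfl)

/-- (1) implies (2) -/
theorem one_two {T U : Thy} (hT : GoodThy T) (hU : GoodThy U) (k : ℕ) (h : Cmpair (k+1) T U) :
    ∃ φ ∈ SigAndPiS (k+1), HDeltaCons (k+1) T φ ∧ HDeltaCons (k+1) U φ ∧ φ ∉ Th T ∪ Th U := by
  obtain ⟨cT, _, pT⟩ := hT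
  obtain ⟨cU, _, pU⟩ := hU
  have hΦ : FF (m := 4) (fun M _ v => TS k (v 0) (env ![v 0, v 1]) ∧ ¬ TS k (v 1) (env ![v 0, v 1])) :=
    (ff_env k 0).ff.and (ff_env k 1).ff.not
  have tc : FF (m := 4) (fun M _ v => TS k (v 2) 0) := (Sg.TS k (Tm.var _) Tm.zero).ff
  have td : FF (m := 4) (fun M _ v => TS k (v 3) 0) := (Sg.TS k (Tm.var _) Tm.zero).ff
  obtain ⟨GW, gW, hW⟩ := re2 cT pT cU pU hΦ
  obtain ⟨GK, gK, hK⟩ := re4' cT pT cU pU ((hΦ.imp (tc.and td.not)).and (tc.iff td.not)) ((D0.false (m := 4)).not.ff)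
  obtain ⟨e, f, hA, hB⟩ := core k gW gK
  simp only [hW] at hA hB
  simp only [hK] at hA hB
  simp only [Matrix.cons_val, not_false_eq_true, implies_true, and_true] at hA hB
  obtain ⟨σ, hσ, eσ⟩ := sig_of (P := fun M _ _ => TS k (e:M) (env ![(e:M), (f:M)])) (Sg.TS k (Tm.cast _) (((env_tm (m := 2)).subst (ts := ![fun M _ v => (e:M), fun M _ v => (f:M)])
    (fun i => by fin_cases i <;> exact Tm.cast _)).of_eq' fun M _ v => by
      apply congrArg env; funext i; fin_cases i <;> rfl))
  obtain ⟨π, hπ, eπ⟩ := pi_of (P := fun M _ _ => ¬ TS k (f:M) (env ![(e:M), (f:M)])) (Sg.TS k (Tm.cast _) (((env_tm (m := 2)).subst (ts := ![fun M _ v => (e:M), fun M _ v => (f:M)])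
    (fun i => by fin_cases i <;> exact Tm.cast _)).of_eq' fun M _ v => by
      apply congrArg env; funext i; fin_cases i <;> rfl)).not
  have eφ : ∀ (M : Type) [PAM M], M ⊨ (σ ⊓ π) ↔ TS k (e:M) (env ![(e:M), (f:M)]) ∧ ¬ TS k (f:M) (env ![(e:M), (f:M)]) := by
    intro M _; rw [← eσ, ← eπ]; exact BoundedFormula.realize_inf
  by_cases hw : (∀ (M : Type) [PAM M], M ⊨ T → TS k (e:M) (env ![(e:M), (f:M)]) ∧ ¬ TS k (f:M) (env ![(e:M), (f:M)])) ∨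
      (∀ (M : Type) [PAM M], M ⊨ U → TS k (e:M) (env ![(e:M), (f:M)]) ∧ ¬ TS k (f:M) (env ![(e:M), (f:M)]))
  · exfalso
    obtain ⟨A, fA, hA1, hA2⟩ := hB hw
    have main : ∀ {T U : Thy}, ExtPA T → ExtPA U → Cmpair (k+1) T U →
        (∀ p ∈ A, (∀ (M : Type) [PAM M], M ⊨ T →
          ((TS k (e:M) (env ![(e:M), (f:M)]) ∧ ¬ TS k (f:M) (env ![(e:M), (f:M)])) → (TS k (p.1:M) 0 ∧ ¬ TS k (p.2:M) 0)) ∧ (TS k (p.1:M) 0 ↔ ¬ TS k (p.2:M) 0)) ∨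
          (∀ (M : Type) [PAM M], M ⊨ U →
          ((TS k (e:M) (env ![(e:M), (f:M)]) ∧ ¬ TS k (f:M) (env ![(e:M), (f:M)])) → (TS k (p.1:M) 0 ∧ ¬ TS k (p.2:M) 0)) ∧ (TS k (p.1:M) 0 ↔ ¬ TS k (p.2:M) 0))) →
        ¬ (∀ (M : Type) [PAM M], M ⊨ T → TS k (e:M) (env ![(e:M), (f:M)]) ∧ ¬ TS k (f:M) (env ![(e:M), (f:M)])) := by
      intro T U pT pU hc h hΦ
      let B := A ∩ {p | ∀ (M : Type) [PAM M], M ⊨ U →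
          ((TS k (e:M) (env ![(e:M), (f:M)]) ∧ ¬ TS k (f:M) (env ![(e:M), (f:M)])) → (TS k (p.1:M) 0 ∧ ¬ TS k (p.2:M) 0)) ∧ (TS k (p.1:M) 0 ↔ ¬ TS k (p.2:M) 0)}
      have hB : ∀ p ∈ A, ∀ (M : Type) [PAM M], M ⊨ T → ¬ (TS k (p.1:M) 0 ∧ ¬ TS k (p.2:M) 0) → p ∈ B := by
        intro p hp M _ hM h'
        rcases h p hp with h | h
        · exact absurd ((h M hM).1 (hΦ M hM)) h'
        · exact ⟨hp, h⟩
      refine kill pT pU k (A := B) (fA.subset Set.inter_subset_left) ?_ ?_ ?_ hc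
      · intro M _ hM
        obtain ⟨p, hp, h'⟩ := (hA2 M).1.1 (hΦ M hM).1
        exact ⟨p, hB p hp M hM (fun h => h.2 h'), h'⟩
      · intro M _ hM
        have := mt (hA2 M).2.2 (hΦ M hM).2
        push Not at this
        obtain ⟨p, hp, h'⟩ := this
        exact ⟨p, hB p hp M hM (fun h => h' h.1), h'⟩
      · rintro M _ hM p ⟨hp, h⟩
        obtain ⟨hx, hy⟩ := h M hM
        by_cases hd : TS k (p.2:M) 0
        · exact hx ⟨(hA2 M).1.2 ⟨p, hp, hd⟩, fun hb => hy.1 ((hA2 M).2.1 hb p hp) hd⟩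
        · exact ⟨hy.2 hd, hd⟩
    rcases hw with hw | hw
    · exact main pT pU h hA1 hw
    · exact main pU pT h.symm (fun p hp => (hA1 p hp).symm) hw
  · refine ⟨σ ⊓ π, ⟨σ, hσ, π, hπ, rfl⟩, ?_, ?_, ?_⟩
    rotate_left 2
    · rintro (hp | hp)
      · exact hw (Or.inl fun M _ hM => (eφ M).1 ((prv_iff pT).1 hp M hM))
      · exact hw (Or.inr fun M _ hM => (eφ M).1 ((prv_iff pU).1 hp M hM))
    all_goals
      rintro V hV δ ⟨⟨σ', hσ', h1⟩, π', hπ', h2⟩ hp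
      obtain ⟨c, hc⟩ := sig_index hσ'
      obtain ⟨d, hd⟩ := pi_index hπ'
      have pTh : ExtPA (Th V) := hV.1.mono (fun φ hφ => (prv_iff hV.1).2 fun N _ hN => hN.realize_of_mem _ hφ)
      have mTh : ∀ (M : Type) [PAM M], M ⊨ V → M ⊨ Th V := fun M _ hM => ⟨fun ψ hψ => (prv_iff hV.1).1 hψ M hM⟩
      have e1 : ∀ (M : Type) [PAM M], M ⊨ V → (M ⊨ δ ↔ TS k (c:M) 0) := fun M _ hM => by
        rw [← hc]; exact BoundedFormula.realize_iff.1 ((prv_iff pTh).1 h1 M (mTh M hM))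
      have e2 : ∀ (M : Type) [PAM M], M ⊨ V → (M ⊨ δ ↔ ¬ TS k (d:M) 0) := fun M _ hM => by
        rw [← hd]; exact BoundedFormula.realize_iff.1 ((prv_iff pTh).1 h2 M (mTh M hM))
      have e3 : ∀ (M : Type) [PAM M], M ⊨ V → M ⊨ (σ ⊓ π) → M ⊨ δ := fun M _ hM hφ =>
        (prv_iff (hV.1.mono (Set.subset_insert _ _))).1 hp M (add_models hM hφ)
      have e4 : ∀ (M : Type) [PAM M], M ⊨ V → (((TS k (e:M) (env ![(e:M), (f:M)]) ∧ ¬ TS k (f:M) (env ![(e:M), (f:M)])) → (TS k (c:M) 0 ∧ ¬ TS k (d:M) 0)) ∧ (TS k (c:M) 0 ↔ ¬ TS k (d:M) 0)) := by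
        intro M _ hM
        rw [← eφ, ← e1 M hM, ← e2 M hM]
        exact ⟨fun h => ⟨e3 M hM h, e3 M hM h⟩, Iff.rfl⟩
      have e5 := hA hw c d (by
        first
        | exact Or.inl fun M _ hM => e4 M (sub_models hV pT hM)
        | exact Or.inr fun M _ hM => e4 M (sub_models hV pU hM))
      refine (prv_iff hV.1).2 fun M _ hM => ?_
      by_contra hn
      have hd' : TS k (d:M) 0 := by
        by_contra h; exact hn ((e2 M hM).2 h)
      have hc' : ¬ TS k (c:M) 0 := fun h => hn ((e1 M hM).2 h)
      exact hn (e3 M hM ((eφ M).2 ⟨(e5 M).1 hd', fun h => hc' ((e5 M).2 h)⟩))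

end Guaspari

set_option linter.unusedSimpArgs false
set_option linter.unusedVariables false
set_option linter.style.haveILetI false
namespace Guaspari

theorem extPA_inter {T U : Thy} (pT : ExtPA T) (pU : ExtPA U) : ExtPA (Th T ∩ Th U) := fun φ hφ =>
  Theory.models_sentence_iff.2 fun M => M.is_model.realize_of_mem _ ⟨pT φ hφ, pU φ hφ⟩

theorem mod_inter {T U : Thy} (pT : ExtPA T) {M : Type} [PAM M] (hM : M ⊨ T) : M ⊨ (Th T ∩ Th U : Thy) :=
  ⟨fun ψ hψ => (prv_iff pT).1 hψ.1 M hM⟩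
theorem mod_inter' {T U : Thy} (pU : ExtPA U) {M : Type} [PAM M] (hM : M ⊨ U) : M ⊨ (Th T ∩ Th U : Thy) :=
  ⟨fun ψ hψ => (prv_iff pU).1 hψ.2 M hM⟩

/-- (1) implies (5) -/
theorem one_five {T U : Thy} (hT : GoodThy T) (hU : GoodThy U) (k : ℕ) (h : Cmpair (k+1) T U) :
    ∃ φ ∈ SigmaS (k+1), ¬ Prv T φ ∧ ¬ Prv U φ ∧
         ∀ V : Thy, (SubThy V T ∨ SubThy V U) → (∀ ψ ∈ Th T ∩ Th U, Prv V ψ) →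
           DeltaConsRel (k+1) (Th T ∩ Th U) V φ := by
  obtain ⟨cT, _, pT⟩ := hT
  obtain ⟨cU, _, pU⟩ := hU
  have hΦ : FF (m := 4) (fun M _ v => TS k (v 0) (env ![v 0, v 1])) := (ff_env k 0).ff
  have tc : FF (m := 4) (fun M _ v => TS k (v 2) 0) := (Sg.TS k (Tm.var _) Tm.zero).ff
  have td : FF (m := 4) (fun M _ v => TS k (v 3) 0) := (Sg.TS k (Tm.var _) Tm.zero).ff
  obtain ⟨GW, gW, hW⟩ := re2 cT pT cU pU hΦ
  obtain ⟨GK, gK, hK⟩ := re4' cT pT cU pU ((hΦ.imp (tc.and td.not)).and (tc.iff td.not)) (tc.iff td.not)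
  obtain ⟨e, f, hA, hB⟩ := core k gW gK
  simp only [hW] at hA hB
  simp only [hK] at hA hB
  simp only [Matrix.cons_val] at hA hB
  obtain ⟨σ, hσ, eφ⟩ := sig_of (P := fun M _ _ => TS k (e:M) (env ![(e:M), (f:M)])) (Sg.TS k (Tm.cast _) (((env_tm (m := 2)).subst (ts := ![fun M _ v => (e:M), fun M _ v => (f:M)])
    (fun i => by fin_cases i <;> exact Tm.cast _)).of_eq' fun M _ v => by
      apply congrArg env; funext i; fin_cases i <;> rfl))
  by_cases hw : (∀ (M : Type) [PAM M], M ⊨ T → TS k (e:M) (env ![(e:M), (f:M)])) ∨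
      (∀ (M : Type) [PAM M], M ⊨ U → TS k (e:M) (env ![(e:M), (f:M)]))
  · exfalso
    obtain ⟨A, fA, hA1, hA2⟩ := hB hw
    have main : ∀ {T U : Thy}, ExtPA T → ExtPA U → Cmpair (k+1) T U →
        (∀ p ∈ A, ((∀ (M : Type) [PAM M], M ⊨ T →
          (TS k (e:M) (env ![(e:M), (f:M)]) → (TS k (p.1:M) 0 ∧ ¬ TS k (p.2:M) 0)) ∧ (TS k (p.1:M) 0 ↔ ¬ TS k (p.2:M) 0)) ∧
          (∀ (M : Type) [PAM M], M ⊨ U → (TS k (p.1:M) 0 ↔ ¬ TS k (p.2:M) 0))) ∨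
          ((∀ (M : Type) [PAM M], M ⊨ U →
          (TS k (e:M) (env ![(e:M), (f:M)]) → (TS k (p.1:M) 0 ∧ ¬ TS k (p.2:M) 0)) ∧ (TS k (p.1:M) 0 ↔ ¬ TS k (p.2:M) 0)) ∧
          (∀ (M : Type) [PAM M], M ⊨ T → (TS k (p.1:M) 0 ↔ ¬ TS k (p.2:M) 0)))) →
        ¬ (∀ (M : Type) [PAM M], M ⊨ T → TS k (e:M) (env ![(e:M), (f:M)])) := by
      intro T U pT pU hc h hΦ
      let B := A ∩ {p | ((∀ (M : Type) [PAM M], M ⊨ U →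
          (TS k (e:M) (env ![(e:M), (f:M)]) → (TS k (p.1:M) 0 ∧ ¬ TS k (p.2:M) 0)) ∧ (TS k (p.1:M) 0 ↔ ¬ TS k (p.2:M) 0)) ∧
          (∀ (M : Type) [PAM M], M ⊨ T → (TS k (p.1:M) 0 ↔ ¬ TS k (p.2:M) 0)))}
      have hB : ∀ (M : Type) [PAM M], M ⊨ T → ∃ p ∈ B, TS k (p.2:M) 0 := by
        intro M _ hM
        obtain ⟨p, hp, h'⟩ := (hA2 M).1.1 (hΦ M hM)
        rcases h p hp with h | h
        · exact absurd h' ((h.1 M hM).1 (hΦ M hM)).2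
        · exact ⟨p, ⟨hp, h⟩, h'⟩
      refine kill pT pU k (A := B) (fA.subset Set.inter_subset_left) hB ?_ ?_ hc
      · intro M _ hM
        obtain ⟨p, hp, h'⟩ := hB M hM
        exact ⟨p, hp, fun h => (hp.2.2 M hM).1 h h'⟩
      · rintro M _ hM p ⟨hp, h, _⟩
        obtain ⟨hx, hy⟩ := h M hM
        by_cases hd : TS k (p.2:M) 0
        · exact hx ((hA2 M).1.2 ⟨p, hp, hd⟩)
        · exact ⟨hy.2 hd, hd⟩
    rcases hw with hw | hw
    · exact main pT pU h hA1 hw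
    · exact main pU pT h.symm (fun p hp => (hA1 p hp).symm) hw
  · refine ⟨σ, hσ, ?_, ?_, ?_⟩
    · intro hp
      exact hw (Or.inl fun M _ hM => (eφ M).1 ((prv_iff pT).1 hp M hM))
    · intro hp
      exact hw (Or.inr fun M _ hM => (eφ M).1 ((prv_iff pU).1 hp M hM))
    rintro V hV hV' δ ⟨⟨σ', hσ', h1⟩, π', hπ', h2⟩ hp
    have pV : ExtPA V := hV.elim (fun h => h.1) (fun h => h.1)
    have pI := extPA_inter pT pU
    obtain ⟨c, hc⟩ := sig_index hσ'
    obtain ⟨d, hd⟩ := pi_index hπ'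
    have mV : ∀ (M : Type) [PAM M], M ⊨ V → M ⊨ (Th T ∩ Th U : Thy) := fun M _ hM =>
      ⟨fun ψ hψ => (prv_iff pV).1 (hV' ψ hψ) M hM⟩
    have e1 : ∀ (M : Type) [PAM M], M ⊨ (Th T ∩ Th U : Thy) → (M ⊨ δ ↔ TS k (c:M) 0) := fun M _ hM => by
      rw [← hc]; exact BoundedFormula.realize_iff.1 ((prv_iff pI).1 h1 M hM)
    have e2 : ∀ (M : Type) [PAM M], M ⊨ (Th T ∩ Th U : Thy) → (M ⊨ δ ↔ ¬ TS k (d:M) 0) := fun M _ hM => by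
      rw [← hd]; exact BoundedFormula.realize_iff.1 ((prv_iff pI).1 h2 M hM)
    have e3 : ∀ (M : Type) [PAM M], M ⊨ V → M ⊨ σ → M ⊨ δ := fun M _ hM hφ =>
      (prv_iff (pV.mono (Set.subset_insert _ _))).1 hp M (add_models hM hφ)
    have e0 : ∀ (M : Type) [PAM M], M ⊨ (Th T ∩ Th U : Thy) → (TS k (c:M) 0 ↔ ¬ TS k (d:M) 0) := by
      intro M _ hM
      rw [← e1 M hM, ← e2 M hM]
    have e4 : ∀ (M : Type) [PAM M], M ⊨ V → ((TS k (e:M) (env ![(e:M), (f:M)]) → (TS k (c:M) 0 ∧ ¬ TS k (d:M) 0)) ∧ (TS k (c:M) 0 ↔ ¬ TS k (d:M) 0)) := by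
      intro M _ hM
      refine ⟨fun h => ?_, e0 M (mV M hM)⟩
      rw [← e1 M (mV M hM), ← e2 M (mV M hM)]
      have := e3 M hM ((eφ M).2 h)
      exact ⟨this, this⟩
    have e5 := hA hw c d (by
      rcases hV with hV | hV
      · exact Or.inl ⟨fun M _ hM => e4 M (sub_models hV pT hM), fun M _ hM => e0 M (mod_inter' pU hM)⟩
      · exact Or.inr ⟨fun M _ hM => e4 M (sub_models hV pU hM), fun M _ hM => e0 M (mod_inter pT hM)⟩)
    refine (prv_iff pV).2 fun M _ hM => ?_
    by_contra hn
    have hd' : TS k (d:M) 0 := by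
      by_contra h; exact hn ((e2 M (mV M hM)).2 h)
    exact hn (e3 M hM ((eφ M).2 ((e5 M).1 hd')))

/-- compactness: inconsistency with the `Π` theorems of `U` is witnessed by a single one -/
theorem incon {T U : Thy} (pT : ExtPA T) (pU : ExtPA U) (k : ℕ) (h : ¬ Con (T ∪ ThIn (PiS k) U)) :
    ∃ π ∈ PiS k, (∀ (M : Type) [PAM M], M ⊨ U → M ⊨ π) ∧ ∀ (M : Type) [PAM M], M ⊨ T → ¬ M ⊨ π := by
  by_contra hc
  push Not at hc
  apply h
  have step : ∀ s : Set Snt, s.Finite → s ⊆ ThIn (PiS k) U → ∃ π ∈ PiS k, (∀ (M : Type) [PAM M], M ⊨ U → M ⊨ π) ∧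
      ∀ (M : Type) [PAM M], M ⊨ π → ∀ ψ ∈ s, M ⊨ ψ := by
    intro s hs
    induction s, hs using Set.Finite.induction_on with
    | empty =>
      intro _
      obtain ⟨π, hπ, e⟩ := pi_of (k := k) (D0.false (m := 0)).not.pg
      exact ⟨π, hπ, fun M _ _ => (e M).2 (fun h => h), fun M _ _ ψ h => h.elim⟩
    | insert _ _ ih =>
      rename_i φ s _ _
      intro hsub
      obtain ⟨π, hπ, h1, h2⟩ := ih (fun x hx => hsub (Set.mem_insert_of_mem _ hx))
      obtain ⟨hφ, hφ'⟩ := hsub (Set.mem_insert _ _)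
      have g1 : Pg k (fam φ) := ⟨φ, hφ, fun _ _ _ => Iff.rfl⟩
      have g2 : Pg k (fam π) := ⟨π, hπ, fun _ _ _ => Iff.rfl⟩
      obtain ⟨ρ, hρ, e⟩ := pi_of (g1.and g2)
      refine ⟨ρ, hρ, fun M _ hM => (e M).2 ⟨(prv_iff pU).1 hφ' M hM, h1 M hM⟩, fun M _ hM ψ hψ => ?_⟩
      obtain ⟨q1, q2⟩ := (e M).1 hM
      rcases hψ with rfl | hψ
      · exact q1
      · exact h2 M q2 ψ hψ
  have hsat : Theory.IsSatisfiable (T ∪ ThIn (PiS k) U : Thy) := by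
    rw [Theory.isSatisfiable_iff_isFinitelySatisfiable]
    intro T0 hT0
    have hfin : ((T0 : Set Snt) \ T).Finite := T0.finite_toSet.subset Set.diff_subset
    obtain ⟨π, hπ, h1, h2⟩ := step _ hfin (fun x hx => (hT0 hx.1).resolve_left hx.2)
    obtain ⟨M, i, hM, hM'⟩ := hc π hπ h1
    haveI : Nonempty M := ⟨0⟩
    haveI : M ⊨ (T0 : Thy) := ⟨fun ψ hψ => by
      by_cases hx : ψ ∈ T
      · exact hM.realize_of_mem _ hx
      · exact h2 M hM' ψ ⟨hψ, hx⟩⟩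
    exact Theory.Model.isSatisfiable M
  obtain ⟨M⟩ := hsat
  intro hb
  exact prv_models hb M

theorem last {T U : Thy} (pT : ExtPA T) (pU : ExtPA U) {k : ℕ} (h : ¬ Cmpair k T U) :
    ∃ δ ∈ SigmaS k, ∃ π ∈ PiS k, (∀ (M : Type) [PAM M], M ⊨ T → M ⊨ δ ∧ M ⊨ π) ∧ (∀ (M : Type) [PAM M], M ⊨ U → ¬ M ⊨ δ ∧ ¬ M ⊨ π) := by
  rw [Cmpair, not_or] at h
  obtain ⟨π, hπ, h1, h2⟩ := incon pT pU k h.1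
  obtain ⟨π', hπ', h1', h2'⟩ := incon pU pT k h.2
  have g1 : Pg k (fam π) := ⟨π, hπ, fun _ _ _ => Iff.rfl⟩
  obtain ⟨δ, hδ, e⟩ := sig_of g1.not
  exact ⟨δ, hδ, π', hπ', fun M _ hM => ⟨(e M).2 (h2 M hM), h1' M hM⟩, fun M _ hM => ⟨fun h => (e M).1 h (h1 M hM), h2' M hM⟩⟩

theorem four_one {T U : Thy} (pT : ExtPA T) (pU : ExtPA U) {k : ℕ} (h : ∃ φ : Snt, HDeltaCons k T φ ∧ φ ∉ Th U) : Cmpair k T U := by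
  by_contra hc
  obtain ⟨δ, hδ, π, hπ, h1, h2⟩ := last pT pU hc
  obtain ⟨φ, hφ, hn⟩ := h
  let V : Thy := PAAx ∪ {δ ⇔ π, φ ⟹ δ}
  have mV : ∀ (M : Type) [PAM M], M ⊨ V ↔ (M ⊨ δ ↔ M ⊨ π) ∧ (M ⊨ φ → M ⊨ δ) := by
    intro M _
    constructor
    · intro hM
      exact ⟨BoundedFormula.realize_iff.1 (hM.realize_of_mem (δ ⇔ π) (by simp [V])),
        BoundedFormula.realize_imp.1 (hM.realize_of_mem (φ ⟹ δ) (by simp [V]))⟩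
    · rintro ⟨q1, q2⟩
      refine ⟨fun ψ hψ => ?_⟩
      rcases hψ with hψ | rfl | rfl
      · exact (PAM.models (M := M)).realize_of_mem _ hψ
      · exact BoundedFormula.realize_iff.2 q1
      · exact BoundedFormula.realize_imp.2 q2
  have pV : ExtPA V := fun ψ hψ => Theory.models_sentence_iff.2 fun M => M.is_model.realize_of_mem _ (Or.inl hψ)
  have sV : SubThy V T := ⟨pV, fun ψ hψ => (prv_iff pT).2 fun M _ hM => (prv_iff pV).1 hψ M ((mV M).2
    ⟨iff_of_true (h1 M hM).1 (h1 M hM).2, fun _ => (h1 M hM).1⟩)⟩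
  have hTh : ∀ ψ, Prv V ψ → Prv (Th V) ψ := fun ψ hψ => Theory.models_sentence_iff.2 fun M => M.is_model.realize_of_mem _ hψ
  have hp : Prv V δ := by
    refine hφ V sV δ ⟨⟨δ, hδ, hTh _ ?_⟩, π, hπ, hTh _ ?_⟩ ?_
    · exact (prv_iff pV).2 fun M _ hM => BoundedFormula.realize_iff.2 Iff.rfl
    · exact (prv_iff pV).2 fun M _ hM => BoundedFormula.realize_iff.2 ((mV M).1 hM).1
    · refine (prv_iff (pV.mono (Set.subset_insert _ _))).2 fun M _ hM => ?_
      have q : M ⊨ V := hM.mono (Set.subset_insert _ _)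
      exact ((mV M).1 q).2 (hM.realize_of_mem _ (Set.mem_insert _ _))
  apply hn
  refine (prv_iff pU).2 fun M _ hM => ?_
  by_contra hx
  exact (h2 M hM).1 ((prv_iff pV).1 hp M ((mV M).2 ⟨iff_of_false (h2 M hM).1 (h2 M hM).2, fun h => absurd h hx⟩))

theorem six_one {T U : Thy} (pT : ExtPA T) (pU : ExtPA U) {k : ℕ} (h : ∃ φ : Snt, ¬ Prv U φ ∧
         ∀ V : Thy, SubThy V T → (∀ ψ ∈ Th T ∩ Th U, Prv V ψ) →
           DeltaConsRel k (Th T ∩ Th U) V φ) : Cmpair k T U := by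
  by_contra hc
  obtain ⟨δ, hδ, π, hπ, h1, h2⟩ := last pT pU hc
  obtain ⟨φ, hn, hφ⟩ := h
  let I : Thy := Th T ∩ Th U
  have pI : ExtPA I := extPA_inter pT pU
  let V : Thy := insert (φ ⟹ δ) I
  have mV : ∀ (M : Type) [PAM M], M ⊨ V ↔ M ⊨ I ∧ (M ⊨ φ → M ⊨ δ) := by
    intro M _
    constructor
    · intro hM
      exact ⟨hM.mono (Set.subset_insert _ _),
        BoundedFormula.realize_imp.1 (hM.realize_of_mem (φ ⟹ δ) (by simp [V]))⟩
    · rintro ⟨q1, q2⟩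
      refine ⟨fun ψ hψ => ?_⟩
      rcases hψ with rfl | hψ
      · exact BoundedFormula.realize_imp.2 q2
      · exact q1.realize_of_mem _ hψ
  have pV : ExtPA V := pI.mono (Set.subset_insert _ _)
  have sV : SubThy V T := ⟨pV, fun ψ hψ => (prv_iff pT).2 fun M _ hM => (prv_iff pV).1 hψ M ((mV M).2
    ⟨mod_inter pT hM, fun _ => (h1 M hM).1⟩)⟩
  have hp : Prv V δ := by
    refine hφ V sV (fun ψ hψ => (prv_iff pV).2 fun M _ hM => ((mV M).1 hM).1.realize_of_mem _ hψ) δ ⟨⟨δ, hδ, ?_⟩, π, hπ, ?_⟩ ?_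
    · exact (prv_iff pI).2 fun M _ hM => BoundedFormula.realize_iff.2 Iff.rfl
    · refine (prv_iff pI).2 fun M _ hM => hM.realize_of_mem _ ⟨?_, ?_⟩
      · exact (prv_iff pT).2 fun M _ hM => BoundedFormula.realize_iff.2 (iff_of_true (h1 M hM).1 (h1 M hM).2)
      · exact (prv_iff pU).2 fun M _ hM => BoundedFormula.realize_iff.2 (iff_of_false (h2 M hM).1 (h2 M hM).2)
    · refine (prv_iff (pV.mono (Set.subset_insert _ _))).2 fun M _ hM => ?_
      have q : M ⊨ V := hM.mono (Set.subset_insert _ _)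
      exact ((mV M).1 q).2 (hM.realize_of_mem _ (Set.mem_insert _ _))
  apply hn
  refine (prv_iff pU).2 fun M _ hM => ?_
  by_contra hx
  exact (h2 M hM).1 ((prv_iff pV).1 hp M ((mV M).2 ⟨mod_inter' pU hM, fun h => absurd h hx⟩))

/-- Theorem 6.5. -/
theorem stmt_13 (T U : Thy) (hT : GoodThy T) (hU : GoodThy U) (n : ℕ) (hn : 1 ≤ n) :
    List.TFAE
      [Cmpair n T U,
       ∃ φ ∈ SigAndPiS n, HDeltaCons n T φ ∧ HDeltaCons n U φ ∧ φ ∉ Th T ∪ Th U,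
       ∃ φ : Snt, HDeltaCons n T φ ∧ HDeltaCons n U φ ∧ φ ∉ Th T ∪ Th U,
       ∃ φ : Snt, HDeltaCons n T φ ∧ φ ∉ Th U,
       ∃ φ ∈ SigmaS n, ¬ Prv T φ ∧ ¬ Prv U φ ∧
         ∀ V : Thy, (SubThy V T ∨ SubThy V U) → (∀ ψ ∈ Th T ∩ Th U, Prv V ψ) →
           DeltaConsRel n (Th T ∩ Th U) V φ,
       ∃ φ : Snt, ¬ Prv U φ ∧
         ∀ V : Thy, SubThy V T → (∀ ψ ∈ Th T ∩ Th U, Prv V ψ) →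
           DeltaConsRel n (Th T ∩ Th U) V φ] := by
  obtain ⟨k, rfl⟩ : ∃ k, n = k + 1 := ⟨n - 1, by omega⟩
  tfae_have 1 → 2 := one_two hT hU k
  tfae_have 2 → 3 := fun ⟨φ, _, h⟩ => ⟨φ, h⟩
  tfae_have 3 → 4 := fun ⟨φ, h1, _, h⟩ => ⟨φ, h1, fun h' => h (Or.inr h')⟩
  tfae_have 4 → 1 := four_one hT.2.2 hU.2.2
  tfae_have 1 → 5 := one_five hT hU k
  tfae_have 5 → 6 := fun ⟨φ, _, _, h1, h⟩ => ⟨φ, h1, fun V hV => h V (Or.inl hV)⟩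
  tfae_have 6 → 1 := six_one hT.2.2 hU.2.2
  tfae_finish

end Guaspari
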